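/- arXiv:2002.04702 — 3 statements merged into one kernel-verified Lean document; each statement's English description precedes it below -/
import Mathlib

section
/- Let k ≥ 1 be an integer, let G_1, …, G_k be connected finite simple graphs with minimum degrees d_1, …, d_k (each d_i ≥ 1), and let H be a connected finite simple graph with maximum degree Δ(H) = d_1 + ⋯ + d_k. Assume: (i) if k = 1 then H is not isomorphic to G_1; (ii) if G_i is isomorphic to the complete graph K_{d_i+1} for every 1 ≤ i ≤ k, then H is not isomorphic to K_{Δ(H)+1}; (iii) if G_i is isomorphic to K_2 for every 1 ≤ i ≤ k, then H is neither an odd cycle nor a complete graph. Then there is a partition of V(H) into sets V_1, …, V_k such that the induced subgraph H[V_i] is G_i-free for every i, and moreover the set V_1 can be chosen to be a maximum G_1-free subset of V(H). -/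
open SimpleGraph

/-- `H` contains a subgraph isomorphic to `G`, i.e. there is an injective graph
homomorphism from `G` to `H`. -/
def HasCopy {α β : Type*} (G : SimpleGraph α) (H : SimpleGraph β) : Prop :=
  ∃ f : G →g H, Function.Injective f

/-- `H` is isomorphic to an odd cycle (a cycle on an odd number `≥ 3` of vertices). -/
def IsOddCycle {β : Type*} (H : SimpleGraph β) : Prop :=
  ∃ n : ℕ, Odd n ∧ 3 ≤ n ∧ Nonempty (H ≃g cycleGraph n)

lemma SimpleGraph.Connected.forall_mem {V : Type*} {H : SimpleGraph V} {s : Set V}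
    (hH : H.Connected) {v : V} (hv : v ∈ s)
    (hs : ∀ x ∈ s, ∀ y, H.Adj x y → y ∈ s) (w : V) : w ∈ s := by
  obtain ⟨p⟩ := hH.preconnected v w
  induction p with
  | nil => exact hv
  | cons hadj _ ih => exact ih (hs _ hv _ hadj)

section Sliding

variable {V : Type*} [Fintype V] [DecidableEq V] {H : SimpleGraph V} [DecidableRel H.Adj]

/-- A family of configurations `(S, v)`, where `v` is a hole and `S` a set of marked vertices,
that is closed under sliding the hole along edges (the label of the vertex entered by the hole
moves to the vertex left by it) and in which the hole always has exactly `d` marked and `e`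
unmarked neighbours. -/
structure IsSlidingFamily (H : SimpleGraph V) [DecidableRel H.Adj] (d e : ℕ)
    (M : Finset V → V → Prop) : Prop where
  hole_notMem : ∀ {S v}, M S v → v ∉ S
  card_inter : ∀ {S v}, M S v → (H.neighborFinset v ∩ S).card = d
  card_sdiff : ∀ {S v}, M S v → (H.neighborFinset v \ S).card = e
  slide : ∀ {S v u}, M S v → H.Adj v u → M (S.map (Equiv.swap v u).toEmbedding) u

variable {d e : ℕ} {M : Finset V → V → Prop}

namespace IsSlidingFamily

lemma exists_hole (hM : IsSlidingFamily H d e M) (hH : H.Connected) {S₀ : Finset V} {v₀ : V}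
    (h₀ : M S₀ v₀) (v : V) : ∃ S, M S v := by
  obtain ⟨p⟩ := hH.preconnected v₀ v
  induction p generalizing S₀ with
  | nil => exact ⟨S₀, h₀⟩
  | cons hadj _ ih => exact ih (hM.slide h₀ hadj)

lemma degree_eq (hM : IsSlidingFamily H d e M) (hH : H.Connected) {S₀ : Finset V} {v₀ : V}
    (h₀ : M S₀ v₀) (v : V) : H.degree v = d + e := by
  obtain ⟨S, hS⟩ := hM.exists_hole hH h₀ v
  rw [← hM.card_inter hS, ← hM.card_sdiff hS, Finset.card_inter_add_card_sdiff,
    SimpleGraph.card_neighborFinset_eq_degree]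

lemma exists_slide_path (hM : IsSlidingFamily H d e M) {S : Finset V} {h : V} (hS : M S h)
    {z : ℕ → V} {s t : ℕ} (hst : s ≤ t) (hinj : Set.InjOn z (Set.Icc s t))
    (hh : ∀ i ∈ Set.Icc s t, z i ≠ h) (hs : H.Adj h (z s))
    (hadj : ∀ i, s ≤ i → i < t → H.Adj (z i) (z (i + 1))) :
    ∃ S', M S' (z t) ∧ (∀ i, s ≤ i → i < t → (z i ∈ S' ↔ z (i + 1) ∈ S)) ∧
      (h ∈ S' ↔ z s ∈ S) ∧ ∀ x, x ≠ h → (∀ i ∈ Set.Icc s t, x ≠ z i) → (x ∈ S' ↔ x ∈ S) := by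
  induction t, hst using Nat.le_induction with
  | base =>
    refine ⟨_, hM.slide hS hs, by intros; omega, by simp [Finset.mem_map_equiv], ?_⟩
    intro x hxh hx
    have := hx s (by simp)
    simp [Finset.mem_map_equiv, Equiv.swap_apply_of_ne_of_ne hxh this]
  | succ t hst ih =>
    have hsub : Set.Icc s t ⊆ Set.Icc s (t + 1) := Set.Icc_subset_Icc_right (by omega)
    obtain ⟨S', hS', h1, h2, h3⟩ := ih (hinj.mono hsub) (fun i hi => hh i (hsub hi))
      (fun i hi hi' => hadj i hi (by omega))
    have hne : ∀ i, s ≤ i → i ≤ t → z i ≠ z (t + 1) := fun i hi hi' hz => by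
      have := hinj (⟨hi, by omega⟩ : i ∈ Set.Icc s (t + 1)) ⟨by omega, le_rfl⟩ hz
      omega
    have hne' : ∀ i, s ≤ i → i < t → z i ≠ z t := fun i hi hi' hz => by
      have := hinj (⟨hi, by omega⟩ : i ∈ Set.Icc s (t + 1)) ⟨by omega, by omega⟩ hz
      omega
    refine ⟨_, hM.slide hS' (hadj t hst (by omega)), ?_, ?_, ?_⟩
    · intro i hi hi'
      rcases Nat.lt_succ_iff_lt_or_eq.1 hi' with hlt | rfl
      · simp [Finset.mem_map_equiv,
          Equiv.swap_apply_of_ne_of_ne (hne' i hi hlt) (hne i hi hlt.le), h1 i hi hlt]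
      · simp only [Finset.mem_map_equiv, Equiv.symm_swap, Equiv.swap_apply_left]
        exact h3 _ (hh _ ⟨by omega, le_rfl⟩) fun j hj => (hne j hj.1 hj.2).symm
    · have a1 := (hh t ⟨hst, by omega⟩).symm
      have a2 := (hh (t + 1) ⟨by omega, le_rfl⟩).symm
      simp [Finset.mem_map_equiv, Equiv.swap_apply_of_ne_of_ne a1 a2, h2]
    · intro x hxh hx
      have a1 := hx t ⟨hst, by omega⟩
      have a2 := hx (t + 1) ⟨by omega, le_rfl⟩
      simp only [Finset.mem_map_equiv, Equiv.symm_swap, Equiv.swap_apply_of_ne_of_ne a1 a2]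
      exact h3 x hxh fun i hi => hx i (hsub hi)

/-- Sliding the hole once around a cycle rotates the labels of the other vertices. -/
lemma exists_rotate (hM : IsSlidingFamily H d e M) {S : Finset V} {h : V} (hS : M S h)
    {z : ℕ → V} {s t : ℕ} (hst : s ≤ t) (hinj : Set.InjOn z (Set.Icc s t))
    (hs : H.Adj h (z s)) (ht : H.Adj h (z t)) (hh : ∀ i ∈ Set.Icc s t, z i ≠ h)
    (hadj : ∀ i, s ≤ i → i < t → H.Adj (z i) (z (i + 1))) :
    ∃ S', M S' h ∧ (∀ i, s ≤ i → i < t → (z i ∈ S' ↔ z (i + 1) ∈ S)) ∧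
      (z t ∈ S' ↔ z s ∈ S) ∧ ∀ x, (∀ i ∈ Set.Icc s t, x ≠ z i) → (x ∈ S' ↔ x ∈ S) := by
  obtain ⟨S', hS', h1, h2, h3⟩ := hM.exists_slide_path hS hst hinj hh hs hadj
  refine ⟨_, hM.slide hS' ht.symm, ?_, by simp [Finset.mem_map_equiv, h2], ?_⟩
  · intro i hi hi'
    have a1 : z i ≠ z t := fun hz => by
      have := hinj (⟨hi, by omega⟩ : i ∈ Set.Icc s t) ⟨by omega, by omega⟩ hz
      omega
    simp [Finset.mem_map_equiv,
      Equiv.swap_apply_of_ne_of_ne a1 (hh i ⟨hi, hi'.le⟩), h1 i hi hi']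
  · intro x hx
    have a1 := hx t ⟨hst, le_rfl⟩
    by_cases hxh : x = h
    · subst hxh
      simp [Finset.mem_map_equiv, hM.hole_notMem hS, hM.hole_notMem hS']
    · simp [Finset.mem_map_equiv, Equiv.swap_apply_of_ne_of_ne a1 hxh, h3 x hxh hx]

lemma exists_rotate_symm (hM : IsSlidingFamily H d e M) {S : Finset V} {h : V} (hS : M S h)
    {z : ℕ → V} {s t : ℕ} (hst : s ≤ t) (hinj : Set.InjOn z (Set.Icc s t))
    (hs : H.Adj h (z s)) (ht : H.Adj h (z t)) (hh : ∀ i ∈ Set.Icc s t, z i ≠ h)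
    (hadj : ∀ i, s ≤ i → i < t → H.Adj (z i) (z (i + 1))) :
    ∃ S', M S' h ∧ (∀ i, s ≤ i → i < t → (z (i + 1) ∈ S' ↔ z i ∈ S)) ∧
      (z s ∈ S' ↔ z t ∈ S) ∧ ∀ x, (∀ i ∈ Set.Icc s t, x ≠ z i) → (x ∈ S' ↔ x ∈ S) := by
  have hmem : ∀ i ∈ Set.Icc s t, s + t - i ∈ Set.Icc s t := by
    rintro i ⟨hi, hi'⟩
    exact ⟨by omega, by omega⟩
  obtain ⟨S', hS', h1, h2, h3⟩ := hM.exists_rotate hS (z := fun i => z (s + t - i)) hst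
    (by
      intro i hi j hj hij
      have h' := hinj (hmem i hi) (hmem j hj) hij
      obtain ⟨_, _⟩ := hi
      obtain ⟨_, _⟩ := hj
      omega)
    (by simpa using ht) (by simpa using hs) (fun i hi => hh _ (hmem i hi))
    (by
      intro i hi hi'
      have := (hadj (s + t - (i + 1)) (by omega) (by omega)).symm
      rwa [show s + t - (i + 1) + 1 = s + t - i by omega] at this)
  refine ⟨S', hS', ?_, by simpa using h2, ?_⟩
  · intro i hi hi'
    have := h1 (s + t - (i + 1)) (by omega) (by omega)
    rwa [show s + t - (s + t - (i + 1)) = i + 1 by omega,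
      show s + t - (s + t - (i + 1) + 1) = i by omega] at this
  · exact fun x hx => h3 x fun i hi => hx _ (hmem i hi)

/-- If the hole lies on a cycle that contains all its neighbours, at least three in number, then it
is adjacent to the whole cycle. -/
lemma adj_of_cycle (hM : IsSlidingFamily H d e M) (hd : 1 ≤ d) (he : 1 ≤ e) (hde : 3 ≤ d + e)
    {S₀ : Finset V} {h : V} (h₀ : M S₀ h) {z : ℕ → V} {m : ℕ} (hinj : Set.InjOn z (Set.Icc 0 m))
    (hz0 : H.Adj h (z 0)) (hzm : H.Adj h (z m)) (hh : ∀ i ∈ Set.Icc 0 m, z i ≠ h)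
    (hadj : ∀ i, i < m → H.Adj (z i) (z (i + 1)))
    (hN : ∀ x, H.Adj h x → ∃ i ≤ m, x = z i) : ∀ i ≤ m, H.Adj h (z i) := by
  have hinj' : ∀ i ≤ m, ∀ j ≤ m, z i = z j → i = j := fun i hi j hj hij =>
    hinj ⟨Nat.zero_le _, hi⟩ ⟨Nat.zero_le _, hj⟩ hij
  have rot : ∀ S, M S h → ∀ s t, s ≤ t → t ≤ m → H.Adj h (z s) → H.Adj h (z t) →
      ∃ S', M S' h ∧ (∀ i, s ≤ i → i < t → (z i ∈ S' ↔ z (i + 1) ∈ S)) ∧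
        (z t ∈ S' ↔ z s ∈ S) ∧ ∀ x, (∀ i ∈ Set.Icc s t, x ≠ z i) → (x ∈ S' ↔ x ∈ S) :=
    fun S hS s t hst htm hs ht => hM.exists_rotate hS hst
      (hinj.mono (Set.Icc_subset_Icc (Nat.zero_le _) htm)) hs ht
      (fun i hi => hh i ⟨Nat.zero_le _, hi.2.trans htm⟩) fun i _ hi => hadj i (by omega)
  have rot' : ∀ S, M S h → ∀ s t, s ≤ t → t ≤ m → H.Adj h (z s) → H.Adj h (z t) →
      ∃ S', M S' h ∧ (∀ i, s ≤ i → i < t → (z (i + 1) ∈ S' ↔ z i ∈ S)) ∧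
        (z s ∈ S' ↔ z t ∈ S) ∧ ∀ x, (∀ i ∈ Set.Icc s t, x ≠ z i) → (x ∈ S' ↔ x ∈ S) :=
    fun S hS s t hst htm hs ht => hM.exists_rotate_symm hS hst
      (hinj.mono (Set.Icc_subset_Icc (Nat.zero_le _) htm)) hs ht
      (fun i hi => hh i ⟨Nat.zero_le _, hi.2.trans htm⟩) fun i _ hi => hadj i (by omega)
  have out : ∀ s t k, k ≤ m → t ≤ m → (k < s ∨ t < k) → ∀ i ∈ Set.Icc s t, z k ≠ z i := by
    rintro s t k hk ht hkst i ⟨hi, hi'⟩ hki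
    have := hinj' k hk i (by omega) hki
    omega
  -- two cyclically consecutive labels are never always equal
  have key : ∀ r, r < m → ¬ ∀ S, M S h → (z r ∈ S ↔ z (r + 1) ∈ S) := by
    intro r hr hall
    have up : ∀ n, r + n < m → ∀ S, M S h → (z (r + n) ∈ S ↔ z (r + n + 1) ∈ S) := by
      intro n
      induction n with
      | zero => exact fun _ => hall
      | succ n ih =>
        intro hn S hS
        obtain ⟨S', hS', h1, -, -⟩ := rot S hS 0 m (Nat.zero_le _) le_rfl hz0 hzm
        have := ih (by omega) S' hS'
        rwa [h1 _ (by omega) (by omega), h1 _ (by omega) (by omega)] at this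
    have last : ∀ S, M S h → (z m ∈ S ↔ z 0 ∈ S) := by
      intro S hS
      obtain ⟨S', hS', h1, h2, -⟩ := rot S hS 0 m (Nat.zero_le _) le_rfl hz0 hzm
      have := up (m - 1 - r) (by omega) S' hS'
      rw [show r + (m - 1 - r) = m - 1 by omega] at this
      rw [h1 _ (by omega) (by omega), show m - 1 + 1 = m by omega, h2] at this
      exact this
    have first : ∀ S, M S h → (z 0 ∈ S ↔ z 1 ∈ S) := by
      intro S hS
      obtain ⟨S', hS', h1, h2, -⟩ := rot S hS 0 m (Nat.zero_le _) le_rfl hz0 hzm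
      have := last S' hS'
      rw [h2, h1 0 le_rfl (by omega)] at this
      exact this
    have all : ∀ n, n < m → ∀ S, M S h → (z n ∈ S ↔ z (n + 1) ∈ S) := by
      intro n
      induction n with
      | zero => exact fun _ => first
      | succ n ih =>
        intro hn S hS
        obtain ⟨S', hS', h1, -, -⟩ := rot S hS 0 m (Nat.zero_le _) le_rfl hz0 hzm
        have := ih (by omega) S' hS'
        rwa [h1 _ (by omega) (by omega), h1 _ (by omega) (by omega)] at this
    have const : ∀ n, n ≤ m → (z n ∈ S₀ ↔ z 0 ∈ S₀) := by
      intro n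
      induction n with
      | zero => simp
      | succ n ih =>
        intro hn
        rw [← all n (by omega) S₀ h₀, ih (by omega)]
    obtain ⟨x, hx⟩ := Finset.card_pos.1 (by rw [hM.card_inter h₀]; omega)
    obtain ⟨y, hy⟩ := Finset.card_pos.1 (by rw [hM.card_sdiff h₀]; omega)
    simp only [Finset.mem_inter, Finset.mem_sdiff, SimpleGraph.mem_neighborFinset] at hx hy
    obtain ⟨i, hi, rfl⟩ := hN x hx.1
    obtain ⟨j, hj, rfl⟩ := hN y hy.1
    exact hy.2 ((const j hj).2 ((const i hi).1 hx.2))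
  -- consecutive neighbours of the hole on the cycle
  have gap : ∀ j q, j + 1 < q → q ≤ m → H.Adj h (z j) → H.Adj h (z q) →
      (∀ i, j < i → i < q → ¬ H.Adj h (z i)) → ∀ S, M S h → (z (j + 1) ∈ S ↔ z q ∈ S) := by
    intro j q hjq hq hj hq' hno S hS
    obtain ⟨S', hS', h1, h2, h3⟩ := rot S hS j q (by omega) hq hj hq'
    have hne : z j ≠ z q := fun hz => by
      have := hinj' j (by omega) q hq hz
      omega
    set B := ((H.neighborFinset h).erase (z j)).erase (z q) with hB
    have split : ∀ T : Finset V, (H.neighborFinset h ∩ T).card =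
        (B ∩ T).card +
          ((if z j ∈ T then 1 else 0) + (if z q ∈ T then 1 else 0)) := by
      intro T
      have e1 : H.neighborFinset h =
          insert (z q) (insert (z j) B) := by
        rw [hB, Finset.insert_comm, Finset.insert_erase, Finset.insert_erase] <;>
          simp [hj, hq', hne.symm]
      conv_lhs => rw [e1]
      by_cases a : z j ∈ T <;> by_cases b : z q ∈ T <;>
        simp [Finset.insert_inter_of_mem, Finset.insert_inter_of_notMem, a, b, hne.symm, hB]
    have same : B ∩ S' =
        B ∩ S := by
      ext x
      simp only [hB, Finset.mem_inter, Finset.mem_erase, SimpleGraph.mem_neighborFinset]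
      refine and_congr_right fun hx => h3 x ?_
      rintro i ⟨hi, hi'⟩ rfl
      refine hno i ?_ ?_ hx.2.2
      · exact lt_of_le_of_ne hi fun hij => hx.2.1 (by rw [hij])
      · exact lt_of_le_of_ne hi' fun hij => hx.1 (by rw [hij])
    have c1 := hM.card_inter hS
    have c2 := hM.card_inter hS'
    rw [split] at c1 c2
    rw [same] at c2
    simp only [h1 j le_rfl (by omega), h2] at c2
    clear_value B
    clear split same h3
    split_ifs at c1 c2 <;> first | tauto | omega
  by_contra! hcon
  obtain ⟨g, hg, hg'⟩ := hcon
  obtain ⟨j, hjg, hj, hjmax⟩ : ∃ j, j < g ∧ H.Adj h (z j) ∧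
      ∀ i, j < i → i ≤ g → ¬ H.Adj h (z i) := by
    classical
    have hex : ∃ n, n ≤ g ∧ H.Adj h (z (g - n)) := ⟨g, le_rfl, by simpa using hz0⟩
    obtain ⟨a, b⟩ := Nat.find_spec hex
    refine ⟨g - Nat.find hex, ?_, b, ?_⟩
    · rcases Nat.eq_zero_or_pos (Nat.find hex) with h0 | h0
      · rw [h0] at b
        exact absurd b hg'
      · omega
    · intro i hi hi' hadj'
      exact Nat.find_min hex (m := g - i) (by omega)
        ⟨by omega, by rwa [show g - (g - i) = i by omega]⟩
  obtain ⟨q, hgq, hqm, hq, hqmin⟩ : ∃ q, g < q ∧ q ≤ m ∧ H.Adj h (z q) ∧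
      ∀ i, g ≤ i → i < q → ¬ H.Adj h (z i) := by
    classical
    have hex : ∃ n, g ≤ n ∧ H.Adj h (z n) := ⟨m, hg, hzm⟩
    obtain ⟨a, b⟩ := Nat.find_spec hex
    refine ⟨Nat.find hex, lt_of_le_of_ne a fun h0 => hg' (h0 ▸ b),
      Nat.find_min' hex ⟨hg, hzm⟩, b, ?_⟩
    exact fun i hi hi' hadj' => Nat.find_min hex hi' ⟨hi, hadj'⟩
  have hpq := gap j q (by omega) hqm hj hq fun i hi hi' =>
    if hig : i ≤ g then hjmax i hi hig else hqmin i (by omega) hi'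
  obtain ⟨r, hrm, hr, hrj, hrq⟩ : ∃ r ≤ m, H.Adj h (z r) ∧ r ≠ j ∧ r ≠ q := by
    by_contra! hno
    have hsub : H.neighborFinset h ⊆ {z j, z q} := by
      intro x hx
      rw [SimpleGraph.mem_neighborFinset] at hx
      obtain ⟨i, hi, rfl⟩ := hN x hx
      by_cases hij : i = j
      · simp [hij]
      · simp [hno i hi hx hij]
    have h2 := (Finset.card_le_card hsub).trans Finset.card_le_two
    have h3 := Finset.card_inter_add_card_sdiff (H.neighborFinset h) S₀
    rw [hM.card_inter h₀, hM.card_sdiff h₀] at h3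
    omega
  have hrcase : r < j ∨ q < r := by
    by_contra! hc
    by_cases hrg : r ≤ g
    · exact hjmax r (by omega) hrg hr
    · exact hqmin r (by omega) (by omega) hr
  rcases hrcase with hrj | hqr
  · have c1 : ∀ S, M S h → (z j ∈ S ↔ z (q - 1) ∈ S) := by
      intro S hS
      obtain ⟨S', hS', h1, -, -⟩ := rot' S hS r q (by omega) hqm hr hq
      have := hpq S' hS'
      have h1q := h1 (q - 1) (by omega) (by omega)
      rw [show q - 1 + 1 = q by omega] at h1q
      rwa [h1 j (by omega) (by omega), h1q] at this
    have c2 : ∀ S, M S h → (z r ∈ S ↔ z (q - 1) ∈ S) := by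
      intro S hS
      obtain ⟨S', hS', -, h2, h3⟩ := rot S hS r j (by omega) (by omega) hr hj
      have := c1 S' hS'
      rwa [h2, h3 _ (out r j (q - 1) (by omega) (by omega) (by omega))] at this
    refine key r (by omega) fun S hS => ?_
    obtain ⟨S', hS', h1, h2, h3⟩ := rot S hS r j (by omega) (by omega) hr hj
    have := (c2 S' hS').trans (c1 S' hS').symm
    rw [h1 r le_rfl (by omega), h2] at this
    exact this.symm
  · have c1 : ∀ S, M S h → (z (j + 1 + 1) ∈ S ↔ z (q + 1) ∈ S) := by
      intro S hS
      obtain ⟨S', hS', h1, -, -⟩ := rot S hS j r (by omega) hrm hj hr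
      have := hpq S' hS'
      rwa [h1 _ (by omega) (by omega), h1 _ (by omega) (by omega)] at this
    have c2 : ∀ S, M S h → (z (j + 1) ∈ S ↔ z (q + 1) ∈ S) := by
      intro S hS
      obtain ⟨S', hS', h1, -, h3⟩ := rot' S hS j q (by omega) (by omega) hj hq
      have := c1 S' hS'
      rwa [h1 _ (by omega) (by omega), h3 _ (out j q (q + 1) (by omega) (by omega) (by omega))]
        at this
    exact key q (by omega) fun S hS => (hpq S hS).symm.trans (c2 S hS)

end IsSlidingFamily

end Sliding

section LongestPath

variable {V : Type*} {H : SimpleGraph V}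

/-- `l` lists the vertices of a path of `H` of maximum length. -/
def IsLongestPathList (H : SimpleGraph V) (l : List V) : Prop :=
  (l.IsChain H.Adj ∧ l.Nodup) ∧
    ∀ l' : List V, l'.IsChain H.Adj → l'.Nodup → l'.length ≤ l.length

lemma exists_isLongestPathList_cons [Finite V] [Nonempty V] (H : SimpleGraph V) :
    ∃ h t, IsLongestPathList H (h :: t) := by
  have := Fintype.ofFinite V
  let s : Set ℕ := {n | ∃ l : List V, (l.IsChain H.Adj ∧ l.Nodup) ∧ l.length = n}
  obtain ⟨v⟩ := ‹Nonempty V›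
  have h1 : 1 ∈ s := ⟨[v], by simp⟩
  have hb : BddAbove s := ⟨Fintype.card V, by
    rintro n ⟨l, ⟨-, hl⟩, rfl⟩
    exact hl.length_le_card⟩
  obtain ⟨l, hl, hlen⟩ := Nat.sSup_mem ⟨1, h1⟩ hb
  have hpos := le_csSup hb h1
  have hmax : IsLongestPathList H l :=
    ⟨hl, fun l' hc hn => (le_csSup hb ⟨l', ⟨hc, hn⟩, rfl⟩).trans_eq hlen.symm⟩
  cases l with
  | nil => simp at hlen; omega
  | cons h t => exact ⟨h, t, hmax⟩

lemma IsLongestPathList.mem_of_adj {h x : V} {t : List V} (hl : IsLongestPathList H (h :: t))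
    (hx : H.Adj h x) : x ∈ t := by
  by_contra hxt
  have := hl.2 (x :: h :: t) (by simpa [hx.symm] using hl.1.1)
    (List.nodup_cons.2 ⟨by simp [hx.ne', hxt], hl.1.2⟩)
  simp at this

end LongestPath

namespace IsSlidingFamily

variable {V : Type*} [Fintype V] [DecidableEq V] {H : SimpleGraph V} [DecidableRel H.Adj]
  {d e : ℕ} {M : Finset V → V → Prop}

lemma neighborFinset_eq_of_isLongestPathList (hM : IsSlidingFamily H d e M) (hH : H.Connected)
    (hd : 1 ≤ d) (he : 1 ≤ e) (hde : 3 ≤ d + e) {S₀ : Finset V} {v₀ : V} (h₀ : M S₀ v₀)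
    {h : V} {t : List V} (hl : IsLongestPathList H (h :: t)) :
    H.neighborFinset h = (t.take (d + e)).toFinset ∧ d + e ≤ t.length := by
  obtain ⟨S, hS⟩ := hM.exists_hole hH h₀ h
  have hdeg := hM.degree_eq hH h₀ h
  have hnd := hl.1.2
  rw [List.nodup_cons] at hnd
  have hch := hl.1.1
  set z : ℕ → V := fun i => t.getD i h with hz
  have hzt : ∀ i (hi : i < t.length), z i = t[i] := fun i hi => by simp [hz, hi]
  have hmem : ∀ x, H.Adj h x → ∃ i < t.length, x = z i := by
    intro x hx
    obtain ⟨i, hi, rfl⟩ := List.getElem_of_mem (hl.mem_of_adj hx)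
    exact ⟨i, hi, (hzt i hi).symm⟩
  obtain ⟨x, hx⟩ := (H.degree_pos_iff_exists_adj h).1 (by omega)
  obtain ⟨i₀, hi₀, rfl⟩ := hmem x hx
  have hz0 : H.Adj h (z 0) := by
    rw [hzt 0 (by omega)]
    exact hch.getElem 0 (by simp; omega)
  obtain ⟨m, hm⟩ : ∃ m, (m < t.length ∧ H.Adj h (z m)) ∧
      ∀ i, m < i → i < t.length → ¬ H.Adj h (z i) := by
    have hp : Nat.findGreatest (fun i => i < t.length ∧ H.Adj h (z i)) t.length < t.length ∧ _ :=
      Nat.findGreatest_spec (P := fun i => i < t.length ∧ H.Adj h (z i)) hi₀.le ⟨hi₀, hx⟩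
    exact ⟨_, hp, fun i hi hi' ha => Nat.findGreatest_is_greatest hi hi'.le ⟨hi', ha⟩⟩
  obtain ⟨⟨hmt, hzm⟩, hmmax⟩ := hm
  have hinj : Set.InjOn z (Set.Icc 0 m) := by
    rintro i ⟨-, hi⟩ j ⟨-, hj⟩ hij
    rw [hzt i (by omega), hzt j (by omega)] at hij
    exact (hnd.2.getElem_inj_iff).1 hij
  have hN : ∀ x, H.Adj h x → ∃ i ≤ m, x = z i := by
    intro x hx
    obtain ⟨i, hi, rfl⟩ := hmem x hx
    exact ⟨i, not_lt.1 fun hmi => hmmax i hmi hi hx, rfl⟩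
  have hadj := hM.adj_of_cycle hd he hde hS hinj hz0 hzm
    (by
      rintro i ⟨-, hi⟩ hih
      rw [hzt i (by omega)] at hih
      exact hnd.1 (hih ▸ List.getElem_mem _))
    (by
      intro i hi
      rw [hzt i (by omega), hzt (i + 1) (by omega)]
      exact hch.getElem (i + 1) (by simp; omega)) hN
  have hset : H.neighborFinset h = (t.take (m + 1)).toFinset := by
    ext x
    rw [SimpleGraph.mem_neighborFinset, List.mem_toFinset, List.mem_take_iff_getElem]
    constructor
    · intro hx
      obtain ⟨i, hi, rfl⟩ := hN x hx
      exact ⟨i, by omega, (hzt i (by omega)).symm⟩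
    · rintro ⟨i, hi, rfl⟩
      rw [← hzt i (by omega)]
      exact hadj i (by omega)
  have hcard : m + 1 = d + e := by
    rw [← hdeg, ← SimpleGraph.card_neighborFinset_eq_degree, hset, List.toFinset_card_of_nodup
      (hnd.2.sublist (List.take_sublist _ _)), List.length_take]
    omega
  exact ⟨hcard ▸ hset, by omega⟩

lemma adj_of_ne (hM : IsSlidingFamily H d e M) (hH : H.Connected)
    (hd : 1 ≤ d) (he : 1 ≤ e) (hde : 3 ≤ d + e) {S₀ : Finset V} {v₀ : V} (h₀ : M S₀ v₀) :
    ∀ x y, x ≠ y → H.Adj x y := by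
  have := hH.nonempty
  obtain ⟨h, t, hl⟩ := exists_isLongestPathList_cons H
  obtain ⟨hset, hlen⟩ := hM.neighborFinset_eq_of_isLongestPathList hH hd he hde h₀ hl
  set T := t.take (d + e) with hT
  have hadjh : ∀ x, H.Adj h x ↔ x ∈ T := fun x => by
    rw [← SimpleGraph.mem_neighborFinset, hset, List.mem_toFinset]
  have hnd := List.nodup_cons.1 hl.1.2
  -- reroute the path so that it ends in any prescribed vertex of `T` but the last one
  have hclique : ∀ k (hk : k + 1 < d + e), ∀ x ∈ T, x ≠ t[k] → H.Adj t[k] x := by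
    intro k hk x hx hxk
    obtain ⟨u, y, w, htu, huk, hy⟩ : ∃ u y w, t = u ++ y :: w ∧ u.length = k ∧ y = t[k] :=
      ⟨t.take k, t[k], t.drop (k + 1), by simp, by simp; omega, rfl⟩
    rw [← hy] at hxk ⊢
    have hTu : T = u ++ y :: w.take (d + e - k - 1) := by
      rw [hT, htu, List.take_append, huk, List.take_of_length_le (by omega),
        show d + e - k = (d + e - k - 1) + 1 by omega, List.take_succ_cons]
      simp
    have hch : (h :: t).IsChain H.Adj := hl.1.1
    have hch' : t.IsChain H.Adj := hch.tail
    have hl' : IsLongestPathList H (y :: (u.reverse ++ h :: w)) := by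
      refine ⟨⟨?_, ?_⟩, ?_⟩
      · rw [show y :: (u.reverse ++ h :: w) = (u ++ [y]).reverse ++ h :: w by simp]
        rw [htu, show u ++ y :: w = (u ++ [y]) ++ w by simp] at hch'
        refine List.isChain_append.2 ⟨?_, ?_, ?_⟩
        · rw [List.isChain_reverse]
          exact hch'.left_of_append.imp fun a b hab => hab.symm
        · refine List.isChain_cons.2 ⟨fun a ha => (hadjh a).2 ?_, hch'.right_of_append⟩
          rw [hTu, show d + e - k - 1 = (d + e - k - 2) + 1 by omega]
          cases w with
          | nil => simp at ha
          | cons b w => simp at ha; simp [ha]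
        · intro a ha b hb
          obtain rfl : h = b := by simpa using hb
          rw [List.getLast?_reverse] at ha
          refine ((hadjh a).2 ?_).symm
          rw [hTu]
          cases u <;> simp at ha <;> simp [ha]
      · have hnd' := hl.1.2
        rw [htu] at hnd'
        refine (List.Perm.nodup_iff ?_).1 hnd'
        have p1 : (u ++ y :: w).Perm (y :: (u.reverse ++ w)) :=
          List.perm_middle.trans (((List.reverse_perm u).symm.append_right w).cons y)
        have p2 : (u.reverse ++ h :: w).Perm (h :: (u.reverse ++ w)) := List.perm_middle
        exact (p1.cons h).trans ((List.Perm.swap y h _).trans (p2.symm.cons y))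
      · intro l' hc hn
        refine (hl.2 l' hc hn).trans_eq ?_
        rw [htu]
        simp
    obtain ⟨hset', -⟩ := hM.neighborFinset_eq_of_isLongestPathList hH hd he hde h₀ hl'
    rw [← SimpleGraph.mem_neighborFinset, hset', List.mem_toFinset, List.take_append,
      List.take_of_length_le (by simp; omega), List.length_reverse, huk,
      show d + e - k = (d + e - k - 1) + 1 by omega, List.take_succ_cons]
    rw [hTu] at hx
    simp only [List.mem_append, List.mem_cons, List.mem_reverse] at hx ⊢
    tauto
  have hZ : ∀ x ∈ h :: T, ∀ y ∈ h :: T, x ≠ y → H.Adj x y := by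
    have hTT : ∀ x ∈ T, ∀ y ∈ T, x ≠ y → H.Adj x y := by
      intro x hx y hy hxy
      obtain ⟨i, hi, rfl⟩ := List.mem_take_iff_getElem.1 hx
      obtain ⟨j, hj, rfl⟩ := List.mem_take_iff_getElem.1 hy
      by_cases hi' : i + 1 < d + e
      · exact hclique i hi' _ hy hxy.symm
      · have hij : i ≠ j := fun h => hxy (by simp [h])
        exact (hclique j (by omega) _ hx hxy).symm
    intro x hx y hy hxy
    rcases List.mem_cons.1 hx with rfl | hx' <;> rcases List.mem_cons.1 hy with rfl | hy'
    · exact absurd rfl hxy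
    · exact (hadjh y).2 hy'
    · exact ((hadjh x).2 hx').symm
    · exact hTT x hx' y hy' hxy
  have hTlen : T.length = d + e := by rw [hT, List.length_take]; omega
  have hndZ : (h :: T).Nodup := hl.1.2.sublist ((List.take_sublist _ _).cons_cons h)
  have hclosed : ∀ x y, H.Adj x y → x ∈ h :: T → y ∈ h :: T := by
    intro x y hxy hx
    have hsub : (h :: T).toFinset.erase x ⊆ H.neighborFinset x := by
      intro a ha
      rw [Finset.mem_erase, List.mem_toFinset] at ha
      exact (SimpleGraph.mem_neighborFinset ..).2 (hZ x hx a ha.2 ha.1.symm)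
    have heq := Finset.eq_of_subset_of_card_le hsub (by
      rw [SimpleGraph.card_neighborFinset_eq_degree, hM.degree_eq hH h₀ x,
        Finset.card_erase_of_mem (List.mem_toFinset.2 hx), List.toFinset_card_of_nodup hndZ]
      simp [hTlen])
    have : y ∈ H.neighborFinset x := (SimpleGraph.mem_neighborFinset ..).2 hxy
    rw [← heq, Finset.mem_erase, List.mem_toFinset] at this
    exact this.2
  have hall : ∀ x, x ∈ h :: T :=
    hH.forall_mem (s := {x | x ∈ h :: T}) List.mem_cons_self fun x hx y hxy => hclosed x y hxy hx
  exact fun x y => hZ x (hall x) y (hall y)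

lemma not_colorable_two (hM : IsSlidingFamily H 1 1 M) {S₀ : Finset V} {v₀ : V} (h₀ : M S₀ v₀)
    (c : H.Coloring Bool) : False := by
  classical
  let P : Finset (Finset V × V) := Finset.univ.filter fun p => M p.1 p.2
  obtain ⟨⟨S, v⟩, hSv, hmax⟩ := P.exists_max_image
    (fun p => (p.1.filter fun x => c x = c p.2).card) ⟨(S₀, v₀), by simp [P, h₀]⟩
  simp only [P, Finset.mem_filter, Finset.mem_univ, true_and] at hSv
  obtain ⟨u, hu⟩ := Finset.card_pos.1 (by rw [hM.card_inter hSv]; omega)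
  simp only [Finset.mem_inter, SimpleGraph.mem_neighborFinset] at hu
  have hS' := hM.slide hSv hu.1
  obtain ⟨w, hw⟩ := Finset.card_pos.1 (by rw [hM.card_sdiff hS']; omega)
  simp only [Finset.mem_sdiff, SimpleGraph.mem_neighborFinset] at hw
  have hS'' := hM.slide hS' hw.1
  have hv := hM.hole_notMem hSv
  have hu' := hM.hole_notMem hS'
  have cu := c.valid hu.1
  have cw := c.valid hw.1
  have cwv : c w = c v := by
    revert cu cw
    cases c u <;> cases c v <;> cases c w <;> simp
  have hle := hmax ((S.map (Equiv.swap v u).toEmbedding).map (Equiv.swap u w).toEmbedding, w)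
    (Finset.mem_filter.2 ⟨Finset.mem_univ _, hS''⟩)
  refine absurd hle (not_le.2 ?_)
  refine Finset.card_lt_card (Finset.ssubset_iff.2 ⟨v, by simp [hv], ?_⟩)
  have hwv : w ≠ v := by
    rintro rfl
    exact hw.2 (by simp [Finset.mem_map_equiv, hu.2])
  have hvu := hu.1.ne
  intro x hx
  simp only [Finset.mem_insert, Finset.mem_filter, Finset.mem_map_equiv, Equiv.symm_swap] at hx hw ⊢
  rcases hx with rfl | ⟨hxS, hcx⟩
  · simp [cwv, Equiv.swap_apply_of_ne_of_ne hvu hwv.symm, hu.2]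
  · have hxu : x ≠ u := by rintro rfl; exact cu hcx.symm
    have hxv : x ≠ v := by rintro rfl; exact hv hxS
    have hxw : x ≠ w := by
      rintro rfl
      rw [Equiv.swap_apply_of_ne_of_ne hxv hxu] at hw
      exact hw.2 hxS
    simp [cwv, hcx, Equiv.swap_apply_of_ne_of_ne hxu hxw, Equiv.swap_apply_of_ne_of_ne hxv hxu, hxS]

end IsSlidingFamily

lemma nonempty_iso_of_injective_hom {α β : Type*} [Fintype α] [Fintype β] [Nonempty α]
    {G : SimpleGraph α} {H : SimpleGraph β} [DecidableRel G.Adj] [DecidableRel H.Adj]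
    (hH : H.Connected) (f : G →g H) (hf : Function.Injective f)
    (hdeg : ∀ a, H.degree (f a) ≤ G.degree a) : Nonempty (H ≃g G) := by
  classical
  have hnb : ∀ a, (G.neighborFinset a).image f = H.neighborFinset (f a) := by
    intro a
    refine Finset.eq_of_subset_of_card_le ?_ ?_
    · intro b hb
      obtain ⟨c, hc, rfl⟩ := Finset.mem_image.1 hb
      rw [SimpleGraph.mem_neighborFinset] at hc ⊢
      exact f.map_adj hc
    · rw [Finset.card_image_of_injective _ hf]
      simpa using hdeg a
  have hclosed : ∀ a b, H.Adj (f a) b → ∃ c, G.Adj a c ∧ f c = b := by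
    intro a b hab
    rw [← SimpleGraph.mem_neighborFinset, ← hnb] at hab
    simpa using hab
  have hsurj : Function.Surjective f := fun b => by
    refine hH.forall_mem (s := Set.range f) ⟨Classical.arbitrary α, rfl⟩ ?_ b
    rintro _ ⟨a, rfl⟩ b hab
    obtain ⟨c, -, hc⟩ := hclosed a b hab
    exact ⟨c, hc⟩
  refine ⟨RelIso.symm ⟨Equiv.ofBijective f ⟨hf, hsurj⟩, ?_⟩⟩
  intro a b
  refine ⟨fun hab => ?_, fun hab => f.map_adj hab⟩
  obtain ⟨c, hc, hcb⟩ := hclosed a _ hab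
  rwa [← hf hcb]

lemma IsSlidingFamily.isOddCycle {V : Type*} [Fintype V] [DecidableEq V] {H : SimpleGraph V}
    [DecidableRel H.Adj] {M : Finset V → V → Prop} (hM : IsSlidingFamily H 1 1 M)
    (hH : H.Connected) {S₀ : Finset V} {v₀ : V} (h₀ : M S₀ v₀) : IsOddCycle H := by
  have := hH.nonempty
  obtain ⟨h, t, hl⟩ := exists_isLongestPathList_cons H
  have hdeg : ∀ v, H.degree v = 2 := hM.degree_eq hH h₀
  have hch := hl.1.1
  have hnd := hl.1.2
  have hnd' := (List.nodup_cons.1 hnd)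
  obtain ⟨x, y, hxy, hN⟩ := Finset.card_eq_two.1
    ((SimpleGraph.card_neighborFinset_eq_degree (G := H) h).trans (hdeg h))
  have hx : H.Adj h x := by
    rw [← SimpleGraph.mem_neighborFinset, hN]; simp
  have hy : H.Adj h y := by
    rw [← SimpleGraph.mem_neighborFinset, hN]; simp
  obtain ⟨q, hq0, hq, hhq⟩ : ∃ q, 0 < q ∧ ∃ hq : q < t.length, H.Adj h t[q] := by
    obtain ⟨i, hi, rfl⟩ := List.getElem_of_mem (hl.mem_of_adj hx)
    obtain ⟨j, hj, rfl⟩ := List.getElem_of_mem (hl.mem_of_adj hy)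
    by_cases hi0 : i = 0
    · refine ⟨j, Nat.pos_of_ne_zero fun hj0 => hxy ?_, hj, hy⟩
      simp [hi0, hj0]
    · exact ⟨i, Nat.pos_of_ne_zero hi0, hi, hx⟩
  have hlast : q + 1 = t.length := by
    by_contra hne
    have hq' : q + 1 < t.length := by omega
    have a1 : H.Adj t[q - 1] t[q] := by
      have := hch.getElem q (by simp; omega)
      simpa [List.getElem_cons, hq0.ne'] using this
    have a2 : H.Adj t[q] t[q + 1] := hch.getElem (q + 1) (by simp; omega)
    have hsub : {h, t[q - 1], t[q + 1]} ⊆ H.neighborFinset t[q] := by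
      intro a ha
      simp only [Finset.mem_insert, Finset.mem_singleton] at ha
      rw [SimpleGraph.mem_neighborFinset]
      rcases ha with rfl | rfl | rfl
      · exact hhq.symm
      · exact a1.symm
      · exact a2
    have := Finset.card_le_card hsub
    rw [SimpleGraph.card_neighborFinset_eq_degree, hdeg, Finset.card_eq_three.2
      ⟨_, _, _, ?_, ?_, ?_, rfl⟩] at this
    · omega
    · rintro h0
      exact hnd'.1 (h0 ▸ List.getElem_mem _)
    · rintro h0
      exact hnd'.1 (h0 ▸ List.getElem_mem _)
    · intro h0
      have := hnd'.2.getElem_inj_iff.1 h0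
      omega
  obtain ⟨r, rfl⟩ : ∃ r, q = r + 1 := ⟨q - 1, by omega⟩
  have hlen : (h :: t).length = r + 3 := by simp; omega
  let f : Fin (r + 3) → V := fun i => (h :: t)[i.val]'(by omega)
  have hfsucc : ∀ i : Fin (r + 3), H.Adj (f i) (f (i + 1)) := by
    intro i
    simp only [f]
    by_cases hi : i = Fin.last _
    · simp only [Fin.val_add_one, hi, if_pos]
      exact hhq.symm
    · simp only [Fin.val_add_one, hi, if_false]
      exact hch.getElem _ _
  have hfinj : Function.Injective f := fun i j hij => Fin.ext (hnd.getElem_inj_iff.1 hij)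
  let F : cycleGraph (r + 3) →g H := ⟨f, by
    intro i j hij
    rcases cycleGraph_adj.1 hij with h1 | h1
    · rw [sub_eq_iff_eq_add'.1 h1]
      simpa [add_comm] using (hfsucc j).symm
    · rw [sub_eq_iff_eq_add'.1 h1]
      simpa [add_comm] using hfsucc i⟩
  have hiso := nonempty_iso_of_injective_hom hH F hfinj fun a => by
    rw [hdeg, cycleGraph_degree_three_le]
  refine ⟨r + 3, ?_, by omega, hiso⟩
  by_contra hodd
  obtain ⟨φ⟩ := hiso
  exact hM.not_colorable_two h₀
    ((cycleGraph.bicoloring_of_even (r + 3) (Nat.not_odd_iff_even.1 hodd)).comp φ.toHom)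

section FreeOn

variable {α V : Type*} {G : SimpleGraph α} {H : SimpleGraph V}

/-- The vertex set `S` contains no copy of `G` in `H`. -/
def FreeOn (G : SimpleGraph α) (H : SimpleGraph V) (S : Set V) : Prop :=
  ∀ f : G →g H, Function.Injective f → ∃ a, f a ∉ S

lemma hasCopy_induce_iff {S : Set V} : HasCopy G (H.induce S) ↔ ¬ FreeOn G H S := by
  unfold FreeOn
  push Not
  constructor
  · rintro ⟨f, hf⟩
    exact ⟨(Embedding.induce S).toHom.comp f, Subtype.val_injective.comp hf, fun a => (f a).2⟩
  · rintro ⟨f, hf, hS⟩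
    exact ⟨⟨fun a => ⟨f a, hS a⟩, fun hab => f.map_adj hab⟩,
      fun a b hab => hf (congrArg Subtype.val hab)⟩

lemma FreeOn.mono {S T : Set V} (hT : FreeOn G H T) (hST : S ⊆ T) : FreeOn G H S :=
  fun f hf => (hT f hf).imp fun _ ha => fun h => ha (hST h)

lemma freeOn_empty [Nonempty α] : FreeOn G H ∅ :=
  fun _ _ => ⟨Classical.arbitrary α, Set.notMem_empty _⟩

lemma freeOn_of_card_lt [Fintype α] {S : Finset V} (hS : S.card < Fintype.card α) :
    FreeOn G H S := by
  classical
  intro f hf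
  by_contra! h
  have := Finset.card_le_card (s := Finset.univ.image f) (t := S) (by
    intro x hx
    obtain ⟨a, -, rfl⟩ := Finset.mem_image.1 hx
    exact Finset.mem_coe.1 (h a))
  rw [Finset.card_image_of_injective _ hf, Finset.card_univ] at this
  omega

lemma minDegree_le_card_inter [Fintype α] [DecidableRel G.Adj] [Fintype V] [DecidableEq V]
    [DecidableRel H.Adj] {f : G →g H} (hf : Function.Injective f) {S : Finset V}
    (hS : ∀ a, f a ∈ S) (a : α) : G.minDegree ≤ (H.neighborFinset (f a) ∩ S).card := by
  classical
  refine (G.minDegree_le_degree a).trans ?_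
  rw [← SimpleGraph.card_neighborFinset_eq_degree, ← Finset.card_image_of_injective _ hf]
  refine Finset.card_le_card ?_
  intro b hb
  obtain ⟨c, hc, rfl⟩ := Finset.mem_image.1 hb
  rw [SimpleGraph.mem_neighborFinset] at hc
  simpa [hS c] using f.map_adj hc

lemma FreeOn.insert [Fintype α] [DecidableRel G.Adj] [Fintype V] [DecidableEq V]
    [DecidableRel H.Adj] {S : Finset V} {v : V} (hS : FreeOn G H S)
    (hv : (H.neighborFinset v ∩ S).card < G.minDegree) :
    FreeOn G H (insert v S : Finset V) := by
  intro f hf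
  by_contra! h
  simp only [Finset.mem_coe] at h
  have hfv : ∃ a, f a = v := by
    by_contra! hne
    obtain ⟨a, ha⟩ := hS f hf
    exact ha ((Finset.mem_insert.1 (h a)).resolve_left (hne a))
  obtain ⟨a, rfl⟩ := hfv
  have := minDegree_le_card_inter hf h a
  rw [Finset.inter_insert_of_notMem (by simp)] at this
  omega

lemma card_le_two_of_closed_pair [Fintype α] (hG : G.Connected) {a b : α}
    (ha : ∀ x, G.Adj a x → x = b) (hb : ∀ x, G.Adj b x → x = a) : Fintype.card α ≤ 2 := by
  classical
  have : (Finset.univ : Finset α) ⊆ {a, b} := by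
    intro x _
    have := hG.forall_mem (s := {a, b}) (v := a) (by simp) (by
      rintro x (rfl | rfl) y hxy
      · simp [ha y hxy]
      · simp [hb y hxy]) x
    simpa using this
  exact (Finset.card_le_card this).trans Finset.card_le_two

lemma nonempty_iso_top_of_card_eq [Fintype α] [DecidableRel G.Adj]
    (h : Fintype.card α = G.minDegree + 1) :
    Nonempty (G ≃g (⊤ : SimpleGraph (Fin (G.minDegree + 1)))) := by
  classical
  have htop : G = ⊤ := by
    ext a b
    simp only [SimpleGraph.top_adj]
    refine ⟨fun hab => hab.ne, fun hab => ?_⟩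
    have hsub : G.neighborFinset a ⊆ Finset.univ.erase a := by
      intro x hx
      rw [SimpleGraph.mem_neighborFinset] at hx
      simp [hx.ne']
    have heq := Finset.eq_of_subset_of_card_le hsub (by
      rw [Finset.card_erase_of_mem (Finset.mem_univ _), Finset.card_univ, h,
        SimpleGraph.card_neighborFinset_eq_degree]
      simpa using G.minDegree_le_degree a)
    rw [← SimpleGraph.mem_neighborFinset, heq]
    simp [hab.symm]
  have e := Fintype.equivFinOfCardEq h
  exact ⟨⟨e, by simp [htop]⟩⟩

end FreeOn

section Partition

variable {ι V : Type*} {α : ι → Type*} {G : ∀ i, SimpleGraph (α i)} {H : SimpleGraph V}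

/-- The vertex set `W` can be partitioned into `G i`-free sets, `i ∈ s`. -/
def FreePartitionable (G : ∀ i, SimpleGraph (α i)) (H : SimpleGraph V) (s : Finset ι)
    (W : Finset V) : Prop :=
  ∃ c : V → ι, (∀ x ∈ W, c x ∈ s) ∧ ∀ i ∈ s, FreeOn (G i) H {x | x ∈ W ∧ c x = i}

lemma freePartitionable_or_exists_card_inter [Nonempty ι] [DecidableEq ι] [∀ i, Fintype (α i)]
    [∀ i, Nonempty (α i)] [∀ i, DecidableRel (G i).Adj] [Fintype V] [DecidableEq V]
    [DecidableRel H.Adj] (s : Finset ι) (W : Finset V) :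
    FreePartitionable G H s W ∨ ∃ U ⊆ W, U.Nonempty ∧
      ∀ u ∈ U, ∑ i ∈ s, (G i).minDegree ≤ (H.neighborFinset u ∩ U).card := by
  induction W using Finset.strongInduction with
  | H W ih =>
  rcases W.eq_empty_or_nonempty with rfl | hW
  · exact Or.inl ⟨fun _ => Classical.arbitrary ι, by simp, fun i _ => by
      simpa using freeOn_empty⟩
  by_cases hfull : ∀ u ∈ W, ∑ i ∈ s, (G i).minDegree ≤ (H.neighborFinset u ∩ W).card
  · exact Or.inr ⟨W, subset_rfl, hW, hfull⟩
  push Not at hfull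
  obtain ⟨u, hu, hlt⟩ := hfull
  rcases ih _ (Finset.erase_ssubset hu) with ⟨c, hc, hfree⟩ | ⟨U, hU, h⟩
  · left
    have hsum : ∑ i ∈ s, ((H.neighborFinset u ∩ W.erase u).filter fun x => c x = i).card
        < ∑ i ∈ s, (G i).minDegree := by
      refine lt_of_le_of_lt ?_ hlt
      rw [← Finset.card_eq_sum_card_fiberwise]
      · exact Finset.card_le_card (Finset.inter_subset_inter_left (Finset.erase_subset _ _))
      · intro x hx
        exact hc x (Finset.mem_inter.1 hx).2
    obtain ⟨j, hj, hjlt⟩ := Finset.exists_lt_of_sum_lt hsum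
    refine ⟨Function.update c u j, ?_, ?_⟩
    · intro x hx
      by_cases hxu : x = u
      · simp [hxu, hj]
      · simpa [hxu] using hc x (Finset.mem_erase.2 ⟨hxu, hx⟩)
    · intro i hi
      by_cases hij : i = j
      · subst hij
        have hS : FreeOn (G i) H ((W.erase u).filter fun x => c x = i : Finset V) :=
          (hfree i hi).mono (by intro x; simp)
        refine (hS.insert (v := u) ?_).mono ?_
        · rwa [Finset.inter_filter]
        · intro x hx
          by_cases hxu : x = u
          · simp [hxu]
          · simpa [hxu] using hx
      · refine (hfree i hi).mono ?_
        rintro x ⟨hx, hxi⟩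
        have hxu : x ≠ u := by
          rintro rfl
          exact hij (by simpa using hxi.symm)
        simpa [hxu, hx] using hxi
  · exact Or.inr ⟨U, hU.trans (Finset.erase_subset _ _), h⟩

lemma freePartitionable_of_card_le [DecidableEq ι] [∀ i, Fintype (α i)] [Nonempty ι]
    [∀ i, Nonempty (α i)] (s : Finset ι) (W : Finset V)
    (hW : W.card ≤ ∑ i ∈ s, (Fintype.card (α i) - 1)) : FreePartitionable G H s W := by
  classical
  induction s using Finset.induction_on generalizing W with
  | empty =>
    have : W = ∅ := by simpa using hW
    exact ⟨fun _ => Classical.arbitrary ι, by simp [this], by simp⟩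
  | insert j s hj ih =>
    rw [Finset.sum_insert hj] at hW
    obtain ⟨A, hAW, hA⟩ := Finset.exists_subset_card_eq
      (min_le_left W.card (Fintype.card (α j) - 1))
    obtain ⟨c, hc, hfree⟩ := ih (W \ A) (by rw [Finset.card_sdiff_of_subset hAW]; omega)
    refine ⟨fun x => if x ∈ A then j else c x, ?_, ?_⟩
    · intro x hx
      by_cases hxA : x ∈ A
      · simp [hxA]
      · simpa [hxA] using Or.inr (hc x (Finset.mem_sdiff.2 ⟨hx, hxA⟩))
    · intro i hi
      by_cases hij : i = j
      · subst hij
        have := Fintype.card_pos (α := α i)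
        refine (freeOn_of_card_lt (S := A) (by omega)).mono ?_
        rintro x ⟨hx, hxi⟩
        by_contra hxA
        rw [Finset.mem_coe] at hxA
        simp only [if_neg hxA] at hxi
        exact hj (hxi ▸ hc x (Finset.mem_sdiff.2 ⟨hx, hxA⟩))
      · refine (hfree i (Finset.mem_of_mem_insert_of_ne hi hij)).mono ?_
        rintro x ⟨hx, hxi⟩
        by_cases hxA : x ∈ A
        · exact absurd hxi (by simpa [hxA] using Ne.symm hij)
        · simpa [hx, hxA] using hxi

end Partition

section ExistsSliding

variable {V : Type*} [Fintype V] [DecidableEq V] {H : SimpleGraph V} [DecidableRel H.Adj]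

lemma exists_isSlidingFamily {d e : ℕ} {P : Finset V → Prop} (hdeg : ∀ v, H.degree v ≤ d + e)
    (he : 1 ≤ e) (hP : ∃ S, P S)
    (hinter : ∀ S v, P S → v ∉ S → d ≤ (H.neighborFinset v ∩ S).card)
    (hslide : ∀ S v u, P S → v ∉ S → u ∈ S → H.Adj v u → (H.neighborFinset v ∩ S).card = d →
      P (S.map (Equiv.swap v u).toEmbedding))
    (hfull : ∀ S, P S → ∃ U ⊆ Sᶜ, U.Nonempty ∧ ∀ u ∈ U, e ≤ (H.neighborFinset u ∩ U).card) :
    ∃ M : Finset V → V → Prop, IsSlidingFamily H d e M ∧ (∀ S v, M S v → P S) ∧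
      ∃ S v, M S v := by
  let full : Finset V → Prop := fun U => ∀ u ∈ U, e ≤ (H.neighborFinset u ∩ U).card
  classical
  let core : Finset V → Finset V := fun T => Finset.univ.filter fun x => ∃ U ⊆ T, full U ∧ x ∈ U
  have mem_core : ∀ T x, x ∈ core T ↔ ∃ U ⊆ T, full U ∧ x ∈ U := fun T x => by simp [core]
  let N : Finset V → V → Prop := fun S v => P S ∧ v ∉ S
  let M : Finset V → V → Prop := fun S v => N S v ∧
    ∀ S' v', N S' v' → (core (Sᶜ.erase v)).card ≤ (core (S'ᶜ.erase v')).card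
  have hin : ∀ S v, N S v → (∃ U ⊆ Sᶜ, full U ∧ v ∈ U) →
      (H.neighborFinset v ∩ S).card = d ∧ (H.neighborFinset v \ S).card = e := by
    rintro S v ⟨hS, hv⟩ ⟨U, hU, hUf, hvU⟩
    have h1 := hinter S v hS hv
    have h2 : e ≤ (H.neighborFinset v \ S).card := by
      refine (hUf v hvU).trans (Finset.card_le_card ?_)
      intro x hx
      rw [Finset.mem_inter] at hx
      exact Finset.mem_sdiff.2 ⟨hx.1, Finset.mem_compl.1 (hU hx.2)⟩
    have h3 := Finset.card_inter_add_card_sdiff (H.neighborFinset v) S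
    rw [SimpleGraph.card_neighborFinset_eq_degree] at h3
    have := hdeg v
    omega
  have hmem : ∀ S v, M S v → ∃ U ⊆ Sᶜ, full U ∧ v ∈ U := by
    rintro S v ⟨⟨hS, hv⟩, hmin⟩
    by_contra hno
    obtain ⟨U, hU, ⟨u, hu⟩, hUf⟩ := hfull S hS
    refine absurd (hmin S u ⟨hS, Finset.mem_compl.1 (hU hu)⟩) (not_le.2 ?_)
    refine Finset.card_lt_card (Finset.ssubset_iff.2 ⟨u, ?_, ?_⟩)
    · rw [mem_core]
      rintro ⟨U', hU', -, hu'⟩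
      exact absurd (hU' hu') (Finset.notMem_erase _ _)
    · have key : ∀ U' ⊆ Sᶜ, full U' → U' ⊆ Sᶜ.erase v := fun U' hU' hf x hx =>
        Finset.mem_erase.2 ⟨fun hxv => hno ⟨U', hU', hf, hxv ▸ hx⟩, hU' hx⟩
      intro x hx
      rw [Finset.mem_insert, mem_core] at hx
      rw [mem_core]
      rcases hx with rfl | ⟨U', hU', hf, hx⟩
      · exact ⟨U, key U hU hUf, hUf, hu⟩
      · exact ⟨U', key U' (hU'.trans (Finset.erase_subset _ _)) hf, hf, hx⟩
  refine ⟨M, ⟨fun h => h.1.2, fun {S v} h => (hin S v h.1 (hmem S v h)).1,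
    fun {S v} h => (hin S v h.1 (hmem S v h)).2, ?_⟩, fun S v h => h.1.1, ?_⟩
  · intro S v u h hvu
    obtain ⟨h1, h2⟩ := hin S v h.1 (hmem S v h)
    obtain ⟨⟨hS, hv⟩, hmin⟩ := h
    by_cases hu : u ∈ S
    · refine ⟨⟨hslide S v u hS hv hu hvu h1, by simp [Finset.mem_map_equiv, hv]⟩, ?_⟩
      have : (S.map (Equiv.swap v u).toEmbedding)ᶜ.erase u = Sᶜ.erase v := by
        ext x
        simp only [Finset.mem_erase, Finset.mem_compl, Finset.mem_map_equiv, Equiv.symm_swap]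
        by_cases hxu : x = u
        · simp [hxu, hu]
        by_cases hxv : x = v
        · simp [hxv, hu]
        rw [Equiv.swap_apply_of_ne_of_ne hxv hxu]
        simp [hxu, hxv]
      rwa [this]
    · have hmap : S.map (Equiv.swap v u).toEmbedding = S := by
        ext x
        rw [Finset.mem_map_equiv, Equiv.symm_swap]
        by_cases hxu : x = u
        · simp [hxu, hu, hv]
        by_cases hxv : x = v
        · simp [hxv, hu, hv]
        rw [Equiv.swap_apply_of_ne_of_ne hxv hxu]
      rw [hmap]
      refine ⟨⟨hS, hu⟩, fun S' v' h' => le_trans (Finset.card_le_card ?_) (hmin S' v' h')⟩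
      intro x hx
      rw [mem_core] at hx ⊢
      obtain ⟨U, hU, hf, hxU⟩ := hx
      refine ⟨U, fun y hy => Finset.mem_erase.2 ⟨?_, (Finset.mem_erase.1 (hU hy)).2⟩, hf, hxU⟩
      rintro rfl
      have hsub : H.neighborFinset y ∩ U ⊆ (H.neighborFinset y \ S).erase u := by
        intro z hz
        rw [Finset.mem_inter] at hz
        have := hU hz.2
        simp only [Finset.mem_erase, Finset.mem_compl] at this
        simp [this.1, this.2, (SimpleGraph.mem_neighborFinset ..).1 hz.1]
      have := Finset.card_le_card hsub
      rw [Finset.card_erase_of_mem (by simp [hvu, hu]), h2] at this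
      have := hf y hy
      omega
  · obtain ⟨S, hS⟩ := hP
    obtain ⟨U, hU, ⟨u, hu⟩, -⟩ := hfull S hS
    let Q : Finset (Finset V × V) := Finset.univ.filter fun p => N p.1 p.2
    obtain ⟨⟨S', v'⟩, hmem', hmin⟩ := Q.exists_min_image
      (fun p => (core (p.1ᶜ.erase p.2)).card)
      ⟨(S, u), Finset.mem_filter.2 ⟨Finset.mem_univ _, hS, Finset.mem_compl.1 (hU hu)⟩⟩
    exact ⟨S', v', (Finset.mem_filter.1 hmem').2, fun S'' v'' h'' =>
      hmin (S'', v'') (Finset.mem_filter.2 ⟨Finset.mem_univ _, h''⟩)⟩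

end ExistsSliding

section MaximumFree

variable {β V : Type*} {K : SimpleGraph β} {H : SimpleGraph V}

/-- The vertex set `S` is a maximum `K`-free subset of the vertices of `H`. -/
def IsMaximumFree (K : SimpleGraph β) (H : SimpleGraph V) (S : Finset V) : Prop :=
  FreeOn K H S ∧ ∀ T : Finset V, FreeOn K H T → T.card ≤ S.card

lemma IsMaximumFree.not_freeOn_insert [DecidableEq V] {S : Finset V} {v : V}
    (hS : IsMaximumFree K H S) (hv : v ∉ S) : ¬ FreeOn K H (insert v S : Finset V) := by
  intro h
  have := hS.2 _ h
  rw [Finset.card_insert_of_notMem hv] at this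
  omega

end MaximumFree

section FreePartition

variable {ι V : Type*} [Fintype ι] {α : ι → Type*} [∀ i, Fintype (α i)]
  {G : ∀ i, SimpleGraph (α i)} [∀ i, DecidableRel (G i).Adj] [Fintype V] {H : SimpleGraph V}
  [DecidableRel H.Adj]

lemma exists_isMaximumFree {β : Type*} [Nonempty β] (G : SimpleGraph β) (H : SimpleGraph V) :
    ∃ S, IsMaximumFree G H S := by
  classical
  obtain ⟨S, hS, hmax⟩ := (Finset.univ.filter fun S : Finset V => FreeOn G H S).exists_max_image
    Finset.card ⟨∅, by simpa using freeOn_empty⟩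
  simp only [Finset.mem_filter, Finset.mem_univ, true_and] at hS hmax
  exact ⟨S, hS, hmax⟩

namespace IsMaximumFree

variable {β : Type*} [Fintype β] {K : SimpleGraph β} [DecidableRel K.Adj] [DecidableEq V]
  {S : Finset V} {u v : V}

lemma minDegree_le (hS : IsMaximumFree K H S) (hv : v ∉ S) :
    K.minDegree ≤ (H.neighborFinset v ∩ S).card :=
  not_lt.1 fun hlt => hS.not_freeOn_insert hv (hS.1.insert hlt)

lemma map_swap (hS : IsMaximumFree K H S) (hv : v ∉ S) (hu : u ∈ S) (hvu : H.Adj v u)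
    (hcard : (H.neighborFinset v ∩ S).card = K.minDegree) :
    IsMaximumFree K H (S.map (Equiv.swap v u).toEmbedding) := by
  refine ⟨?_, fun T hT => by simpa using hS.2 T hT⟩
  have hS' : FreeOn K H (S.erase u : Finset V) := hS.1.mono (by simp)
  refine (hS'.insert (v := v) ?_).mono ?_
  · rw [← hcard, Finset.inter_erase]
    exact Finset.card_erase_lt_of_mem (by simp [hu, hvu])
  · intro x hx
    rw [Finset.mem_coe, Finset.mem_map_equiv, Equiv.symm_swap] at hx
    by_cases hxv : x = v
    · simp [hxv]
    by_cases hxu : x = u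
    · exact absurd (by simpa [hxu] using hx) hv
    rw [Equiv.swap_apply_of_ne_of_ne hxv hxu] at hx
    simp [hx, hxu]

end IsMaximumFree

lemma card_le_two_of_isSlidingFamily [DecidableEq V] {β : Type*} [Fintype β]
    {K : SimpleGraph β} [DecidableRel K.Adj] {e : ℕ} {M : Finset V → V → Prop}
    (hM : IsSlidingFamily H 1 e M) (hK : K.Connected) (hK1 : 1 ≤ K.minDegree) {S : Finset V}
    {v : V} (hSv : M S v) (hS : IsMaximumFree K H S) : Fintype.card β ≤ 2 := by
  have hv := hM.hole_notMem hSv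
  have hno := hS.not_freeOn_insert hv
  unfold FreeOn at hno
  push Not at hno
  obtain ⟨f, hf, hfS⟩ := hno
  simp only [Finset.mem_coe, Finset.mem_insert] at hfS
  obtain ⟨a, hfa⟩ : ∃ a, f a = v := by
    by_contra! hne
    obtain ⟨a, ha⟩ := hS.1 f hf
    exact ha ((hfS a).resolve_left (hne a))
  obtain ⟨b, hab⟩ := (K.degree_pos_iff_exists_adj a).1 (hK1.trans (K.minDegree_le_degree a))
  have hva : ∀ x, K.Adj a x → f x ∈ H.neighborFinset v ∩ S := by
    intro x hx
    have := f.map_adj hx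
    rw [hfa] at this
    simp [this, (hfS x).resolve_left this.ne']
  have hadj : H.Adj v (f b) := hfa ▸ f.map_adj hab
  have hS' := hM.slide hSv hadj
  have hvb : ∀ x, K.Adj b x →
      f x ∈ H.neighborFinset (f b) ∩ S.map (Equiv.swap v (f b)).toEmbedding := by
    intro x hx
    have hbx := f.map_adj hx
    have hbS := (Finset.mem_inter.1 (hva b hab)).2
    rw [Finset.mem_inter, SimpleGraph.mem_neighborFinset, Finset.mem_map_equiv, Equiv.symm_swap]
    refine ⟨hbx, ?_⟩
    by_cases hxv : f x = v
    · simpa [hxv] using hbS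
    · rw [Equiv.swap_apply_of_ne_of_ne hxv hbx.ne']
      exact (hfS x).resolve_left hxv
  exact card_le_two_of_closed_pair hK (a := a) (b := b)
    (fun x hx => hf (Finset.card_le_one.1 (hM.card_inter hSv).le _ (hva x hx) _ (hva b hab)))
    (fun x hx => hf (Finset.card_le_one.1 (hM.card_inter hS').le _ (hvb x hx) _
      (hvb a hab.symm)))

lemma freeOn_compl_of_card_sdiff_le_one [DecidableEq V] {β : Type*} [Fintype β]
    {K : SimpleGraph β} [DecidableRel K.Adj] (hK : K.Connected) (hK1 : 1 ≤ K.minDegree)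
    (hcard : 2 < Fintype.card β) {S : Finset V}
    (hS : ∀ x, x ∉ S → (H.neighborFinset x \ S).card ≤ 1) : FreeOn K H (Sᶜ : Finset V) := by
  intro f hf
  by_contra! hfS
  simp only [Finset.coe_compl, Set.mem_compl_iff, Finset.mem_coe] at hfS
  obtain ⟨a⟩ := hK.nonempty
  obtain ⟨b, hab⟩ := (K.degree_pos_iff_exists_adj a).1 (hK1.trans (K.minDegree_le_degree a))
  have key : ∀ a b, K.Adj a b → ∀ x, K.Adj a x → x = b := fun a b hab x hax =>
    hf (Finset.card_le_one.1 (hS _ (hfS a)) _ (by simp [f.map_adj hax, hfS x]) _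
      (by simp [f.map_adj hab, hfS b]))
  exact absurd (card_le_two_of_closed_pair hK (key a b hab) (key b a hab.symm)) (by omega)

lemma exists_isMaximumFree_freePartitionable_compl [DecidableEq ι] [DecidableEq V] (i₀ : ι)
    (hGconn : ∀ i, (G i).Connected) (hd : ∀ i, 1 ≤ (G i).minDegree) (hH : H.Connected)
    (hΔ : H.maxDegree = ∑ i, (G i).minDegree)
    (h1 : (∀ i, i = i₀) → ¬ Nonempty (H ≃g G i₀))
    (h2 : (∀ i, Nonempty (G i ≃g (⊤ : SimpleGraph (Fin ((G i).minDegree + 1))))) →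
      ¬ Nonempty (H ≃g (⊤ : SimpleGraph (Fin (H.maxDegree + 1)))))
    (h3 : (∀ i, Nonempty (G i ≃g (⊤ : SimpleGraph (Fin 2)))) → ¬ IsOddCycle H) :
    ∃ S, IsMaximumFree (G i₀) H S ∧ FreePartitionable G H (Finset.univ.erase i₀) Sᶜ := by
  have hne : ∀ i, Nonempty (α i) := fun i => (hGconn i).nonempty
  have hι : Nonempty ι := ⟨i₀⟩
  have hsum := Finset.add_sum_erase Finset.univ (fun i => (G i).minDegree) (Finset.mem_univ i₀)
  by_cases hsub : ∀ i, i = i₀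
  · have herase : Finset.univ.erase i₀ = ∅ := by
      ext i
      simp [hsub i]
    refine ⟨Finset.univ, ⟨fun f hf => ?_, fun T _ => Finset.card_le_univ T⟩, ?_⟩
    · refine absurd (nonempty_iso_of_injective_hom hH f hf fun a => ?_) (h1 hsub)
      refine (H.degree_le_maxDegree _).trans (le_trans ?_ ((G i₀).minDegree_le_degree a))
      simp only [herase, Finset.sum_empty] at hsum
      omega
    · rw [herase]
      exact ⟨fun _ => i₀, by simp, by simp⟩
  push Not at hsub
  obtain ⟨i₁, hi₁⟩ := hsub
  by_contra! hcon
  set d := (G i₀).minDegree with hd_def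
  set D := ∑ i ∈ Finset.univ.erase i₀, (G i).minDegree with hD_def
  have hd1 : 1 ≤ d := hd i₀
  have hcardD : (Finset.univ.erase i₀).card ≤ D := by
    simpa using Finset.card_nsmul_le_sum (Finset.univ.erase i₀) _ 1 fun i _ => hd i
  have hi₁mem : i₁ ∈ Finset.univ.erase i₀ := by simp [hi₁]
  have hD1 : 1 ≤ D := (Finset.card_pos.2 ⟨i₁, hi₁mem⟩).trans_le hcardD
  have hdeg : ∀ v, H.degree v ≤ d + D := fun v => (H.degree_le_maxDegree v).trans (by omega)
  obtain ⟨M, hM, hMS, S, v, hSv⟩ := exists_isSlidingFamily (P := IsMaximumFree (G i₀) H) hdeg hD1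
    (exists_isMaximumFree _ _) (fun S v hS hv => hS.minDegree_le hv)
    (fun S v u hS hv hu hvu hcard => hS.map_swap hv hu hvu hcard)
    (fun S hS => (freePartitionable_or_exists_card_inter (G := G) _ Sᶜ).resolve_left (hcon S hS))
  have hS := hMS S v hSv
  have hv := hM.hole_notMem hSv
  by_cases h3d : 3 ≤ d + D
  · have hadj := hM.adj_of_ne hH hd1 hD1 h3d hSv
    have hN : H.neighborFinset v = Finset.univ.erase v := by
      ext x
      simp only [SimpleGraph.mem_neighborFinset, Finset.mem_erase, Finset.mem_univ, and_true]
      exact ⟨fun h => h.ne', fun h => hadj v x h.symm⟩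
    have hcS : S.card = d := by
      rw [← hM.card_inter hSv, hN, Finset.erase_inter, Finset.univ_inter,
        Finset.erase_eq_of_notMem hv]
    have hcC : Sᶜ.card = D + 1 := by
      have := hM.card_sdiff hSv
      rw [hN, Finset.erase_sdiff_comm, ← Finset.compl_eq_univ_sdiff,
        Finset.card_erase_of_mem (Finset.mem_compl.2 hv)] at this
      omega
    have hcV : Fintype.card V = H.maxDegree + 1 := by
      rw [← Finset.card_add_card_compl S]
      omega
    have hcomplete : Nonempty (H ≃g (⊤ : SimpleGraph (Fin (H.maxDegree + 1)))) := by
      refine ⟨⟨Fintype.equivFinOfCardEq hcV, ?_⟩⟩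
      intro a b
      simp only [SimpleGraph.top_adj, ne_eq, EmbeddingLike.apply_eq_iff_eq]
      exact ⟨hadj a b, fun h => h.ne⟩
    refine h2 (fun i => nonempty_iso_top_of_card_eq ?_) hcomplete
    by_contra hcard
    have hlt := fun i => (G i).minDegree_lt_card
    have hlti := hlt i
    by_cases hi : i = i₀
    · subst hi
      refine hS.not_freeOn_insert hv (freeOn_of_card_lt ?_)
      rw [Finset.card_insert_of_notMem hv]
      omega
    · refine hcon S hS (freePartitionable_of_card_le _ _ ?_)
      rw [hcC, hD_def]
      refine Nat.succ_le_of_lt (Finset.sum_lt_sum (fun j _ => ?_)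
        ⟨i, Finset.mem_erase.2 ⟨hi, Finset.mem_univ _⟩, by omega⟩)
      have := hlt j
      omega
  · have hd' : d = 1 := by omega
    have hD' : D = 1 := by omega
    rw [hd', hD'] at hM
    obtain ⟨j, hj⟩ := Finset.card_eq_one.1
      (le_antisymm (hcardD.trans hD'.le) (Finset.card_pos.2 ⟨i₁, hi₁mem⟩))
    have hdeg1 : ∀ i, (G i).minDegree = 1 := by
      intro i
      by_cases hi : i = i₀
      · rw [hi, ← hd_def, hd']
      · have : i ∈ Finset.univ.erase i₀ := by simp [hi]
        rw [hj, Finset.mem_singleton] at this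
        rwa [hD_def, hj, Finset.sum_singleton, ← this] at hD'
    refine h3 (fun i => ?_) (hM.isOddCycle hH hSv)
    have hiso := nonempty_iso_top_of_card_eq (G := G i)
    rw [hdeg1 i] at hiso
    refine hiso (le_antisymm (not_lt.1 fun hcard => ?_) ?_)
    · by_cases hi : i = i₀
      · subst hi
        have := card_le_two_of_isSlidingFamily hM (hGconn i) (hd i) hSv hS
        omega
      · refine hcon S hS ⟨fun _ => i, fun _ _ => by simp [hi], fun i' hi' => ?_⟩
        have hii : i' = i := by
          have : i ∈ Finset.univ.erase i₀ := by simp [hi]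
          rw [hj, Finset.mem_singleton] at this hi'
          rw [this, hi']
        subst hii
        refine (freeOn_compl_of_card_sdiff_le_one (hGconn i') (hd i') hcard
          (S := S) fun x hx => ?_).mono fun x hx => by simpa using hx
        have h := Finset.card_inter_add_card_sdiff (H.neighborFinset x) S
        rw [SimpleGraph.card_neighborFinset_eq_degree] at h
        have := hS.minDegree_le hx
        have := hdeg x
        omega
    · have := (G i).minDegree_lt_card
      rwa [hdeg1 i] at this

end FreePartition

/-- **Theorem 1 (main theorem).**  Let `k ≥ 1`, let `G 0, …, G (k-1)` be connected finite
simple graphs with minimum degrees `d i ≥ 1`, and let `H` be a connected finite simple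
graph with `Δ(H) = d 0 + ⋯ + d (k-1)`.  Assume (i) if `k = 1` then `H ≇ G i`;
(ii) if every `G i ≅ K_{d i + 1}` then `H ≇ K_{Δ(H)+1}`; (iii) if every `G i ≅ K₂` then
`H` is neither an odd cycle nor a complete graph.  Then `V(H)` can be partitioned into
sets `V 0, …, V (k-1)` (the colour classes of a map `c : V → Fin k`) such that `H[V i]`
is `G i`-free for every `i`, and the class of colour `0` is a maximum `G 0`-free subset. -/
theorem gfree_partition_with_maximum_class
    {k : ℕ} (hk : 1 ≤ k)
    {α : Fin k → Type*} [∀ i, Fintype (α i)]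
    (G : ∀ i, SimpleGraph (α i)) [∀ i, DecidableRel (G i).Adj]
    {V : Type*} [Fintype V]
    (H : SimpleGraph V) [DecidableRel H.Adj]
    (hGconn : ∀ i, (G i).Connected)
    (hd : ∀ i, 1 ≤ (G i).minDegree)
    (hHconn : H.Connected)
    (hΔ : H.maxDegree = ∑ i, (G i).minDegree)
    (h1 : k = 1 → ∀ i, ¬ Nonempty (H ≃g G i))
    (h2 : (∀ i, Nonempty (G i ≃g (⊤ : SimpleGraph (Fin ((G i).minDegree + 1))))) →
      ¬ Nonempty (H ≃g (⊤ : SimpleGraph (Fin (H.maxDegree + 1)))))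
    (h3 : (∀ i, Nonempty (G i ≃g (⊤ : SimpleGraph (Fin 2)))) →
      ¬ IsOddCycle H ∧ ¬ ∃ n : ℕ, Nonempty (H ≃g (⊤ : SimpleGraph (Fin n)))) :
    ∃ c : V → Fin k,
      (∀ i : Fin k, ¬ HasCopy (G i) (H.induce {v | c v = i})) ∧
      (∀ T : Set V, ¬ HasCopy (G ⟨0, hk⟩) (H.induce T) →
        T.ncard ≤ {v | c v = ⟨0, hk⟩}.ncard) := by
  classical
  obtain ⟨S, hS, c, hc, hfree⟩ := exists_isMaximumFree_freePartitionable_compl (G := G) ⟨0, hk⟩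
    hGconn hd hHconn hΔ
    (fun hall => h1 (by
      by_contra hk1
      have := congrArg Fin.val (hall ⟨1, by omega⟩)
      simp at this) _) h2 (fun h => (h3 h).1)
  have hzero : ∀ x, (if x ∈ S then ⟨0, hk⟩ else c x) = ⟨0, hk⟩ ↔ x ∈ S := by
    intro x
    by_cases hx : x ∈ S
    · simp [hx]
    · simpa [hx] using Finset.ne_of_mem_erase (hc x (Finset.mem_compl.2 hx))
  refine ⟨fun x => if x ∈ S then ⟨0, hk⟩ else c x, fun i => ?_, fun T hT => ?_⟩
  · rw [hasCopy_induce_iff, not_not]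
    by_cases hi : i = ⟨0, hk⟩
    · subst hi
      exact hS.1.mono fun x hx => Finset.mem_coe.2 ((hzero x).1 hx)
    · refine (hfree i (by simp [hi])).mono ?_
      intro x hx
      simp only [Set.mem_ofPred_eq] at hx
      have hxS : x ∉ S := fun hxS => hi (by rw [← hx, if_pos hxS])
      rw [if_neg hxS] at hx
      exact ⟨Finset.mem_compl.2 hxS, hx⟩
  · rw [hasCopy_induce_iff, not_not] at hT
    have hSset : {x | (if x ∈ S then ⟨0, hk⟩ else c x) = ⟨0, hk⟩} = (S : Set V) := by
      ext x
      exact hzero x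
    rw [hSset, Set.ncard_coe_finset, Set.ncard_eq_toFinset_card' T]
    exact hS.2 _ (by simpa using hT)
end

section
/- Let G be a connected finite simple graph with minimum degree δ(G) ≥ 1, let H be a connected finite simple graph with maximum degree Δ(H) ≥ 1, and set k = ⌈Δ(H)/δ(G)⌉. Assume: (i) if G is regular, then H is not isomorphic to G; (ii) if G is isomorphic to K_{δ(G)+1}, then H is not isomorphic to K_{k·δ(G)+1}; (iii) if G is isomorphic to K_2, then H is neither an odd cycle nor a complete graph. Then H has a G-free k-coloring, i.e. a partition of V(H) into k sets each inducing a G-free subgraph, one of whose color classes is a maximum G-free subset of V(H). -/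
open SimpleGraph

namespace GFreeColoring

open Finset
open scoped Classical

variable {α V : Type*} (G : SimpleGraph α) (H : SimpleGraph V)

/-- The neighbours of `v` inside `A`. -/
noncomputable def nbrs (v : V) (A : Finset V) : Finset V := {w ∈ A | H.Adj v w}

/-- The vertex set `A` spans no copy of `G` in `H`. -/
def CopyFree (A : Finset V) : Prop :=
  ¬ ∃ f : α → V, Function.Injective f ∧ (∀ a, f a ∈ A) ∧ ∀ a b, G.Adj a b → H.Adj (f a) (f b)

/-- The vertex set `A` can be partitioned into `m` classes spanning no copy of `G`. -/
def PartColorable (m : ℕ) (A : Finset V) : Prop :=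
  ∃ c : V → Fin m, ∀ i, CopyFree G H {v ∈ A | c v = i}

/-- `A` induces a preconnected subgraph: no nonempty proper subset of `A` is closed under
adjacency in `A`. -/
def ConnectedSet (A : Finset V) : Prop :=
  ∀ C ⊆ A, C.Nonempty → (∀ x ∈ C, ∀ y ∈ A, H.Adj x y → y ∈ C) → C = A

/-- `A` is minimal among the vertex sets that are not `m`-colorable. -/
def Critical (m : ℕ) (A : Finset V) : Prop :=
  ¬ PartColorable G H m A ∧ ∀ C ⊂ A, PartColorable G H m C

variable {G H}

section nbrs

@[simp] lemma mem_nbrs {v w : V} {A : Finset V} : w ∈ nbrs H v A ↔ w ∈ A ∧ H.Adj v w := by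
  simp [nbrs]

lemma nbrs_mono (v : V) {A B : Finset V} (h : A ⊆ B) : nbrs H v A ⊆ nbrs H v B :=
  filter_subset_filter _ h

lemma card_nbrs_mono (v : V) {A B : Finset V} (h : A ⊆ B) :
    #(nbrs H v A) ≤ #(nbrs H v B) := card_le_card (nbrs_mono v h)

lemma card_nbrs_erase {v w : V} {A : Finset V} (hw : w ∈ A) (h : H.Adj v w) :
    #(nbrs H v (A.erase w)) + 1 = #(nbrs H v A) := by
  have : nbrs H v (A.erase w) = (nbrs H v A).erase w := by ext; simp; tauto
  rw [this, card_erase_add_one (by simp [*])]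

lemma nbrs_insert_of_not_adj {v w : V} {A : Finset V} (h : ¬ H.Adj v w) :
    nbrs H v (insert w A) = nbrs H v A := by
  ext x; simp only [mem_nbrs, mem_insert]
  constructor
  · rintro ⟨rfl | hx, hv⟩
    · exact absurd hv h
    · exact ⟨hx, hv⟩
  · tauto

lemma nbrs_insert_self (v : V) (A : Finset V) : nbrs H v (insert v A) = nbrs H v A :=
  nbrs_insert_of_not_adj H.irrefl

lemma nbrs_erase_self (v : V) (A : Finset V) : nbrs H v (A.erase v) = nbrs H v A := by
  ext x; simp only [mem_nbrs, mem_erase]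
  constructor
  · tauto
  · exact fun h ↦ ⟨⟨h.2.ne', h.1⟩, h.2⟩

lemma nbrs_union (v : V) (A B : Finset V) : nbrs H v (A ∪ B) = nbrs H v A ∪ nbrs H v B :=
  filter_union ..

lemma card_nbrs_add {v : V} {S X : Finset V} (h : S ⊆ X) :
    #(nbrs H v S) + #(nbrs H v (X \ S)) = #(nbrs H v X) := by
  have : Disjoint (nbrs H v S) (nbrs H v (X \ S)) :=
    disjoint_of_subset_left (filter_subset _ _)
      (disjoint_of_subset_right (filter_subset _ _) disjoint_sdiff)
  rw [← card_union_of_disjoint this, ← nbrs_union, union_sdiff_of_subset h]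

end nbrs

section CopyFree

lemma CopyFree.mono {A B : Finset V} (h : CopyFree G H B) (hAB : A ⊆ B) : CopyFree G H A :=
  fun ⟨f, hf, hA, hadj⟩ ↦ h ⟨f, hf, fun a ↦ hAB (hA a), hadj⟩

variable [Fintype α] {d : ℕ}

lemma copyFree_of_card_lt {A : Finset V} (h : #A < Fintype.card α) : CopyFree G H A := by
  rintro ⟨f, hf, hA, -⟩
  have : #(univ.image f) ≤ #A := card_le_card (by simpa [subset_iff] using hA)
  rw [card_image_of_injective _ hf, card_univ] at this
  omega

lemma le_card_nbrs_of_copy (hG : ∀ a, d ≤ #(nbrs G a univ)) {A : Finset V} {f : α → V}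
    (hf : Function.Injective f) (hA : ∀ a, f a ∈ A) (hadj : ∀ a b, G.Adj a b → H.Adj (f a) (f b))
    (a : α) : d ≤ #(nbrs H (f a) (A ∩ univ.image f)) := by
  calc d ≤ #((nbrs G a univ).image f) := by rw [card_image_of_injective _ hf]; exact hG a
    _ ≤ _ := card_le_card (by
      intro x
      simp only [mem_image, mem_nbrs, mem_univ, true_and, mem_inter]
      rintro ⟨b, hb, rfl⟩
      exact ⟨⟨hA b, b, rfl⟩, hadj _ _ hb⟩)

/-- If adding `v` to a `G`-free set creates a copy of `G`, the copy uses `v`. -/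
lemma exists_copy_of_not_copyFree_insert {A : Finset V} {v : V} (hA : CopyFree G H A)
    (h : ¬ CopyFree G H (insert v A)) :
    ∃ f : α → V, Function.Injective f ∧ (∀ a, f a ∈ insert v A) ∧
      (∀ a b, G.Adj a b → H.Adj (f a) (f b)) ∧ ∃ a, f a = v := by
  obtain ⟨f, hf, hfA, hadj⟩ := not_not.1 h
  refine ⟨f, hf, hfA, hadj, ?_⟩
  by_contra! hv
  exact hA ⟨f, hf, fun a ↦ (mem_insert.1 (hfA a)).resolve_left (hv a), hadj⟩

lemma le_card_nbrs_of_not_copyFree_insert (hG : ∀ a, d ≤ #(nbrs G a univ)) {A : Finset V} {v : V}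
    (hA : CopyFree G H A) (h : ¬ CopyFree G H (insert v A)) : d ≤ #(nbrs H v A) := by
  obtain ⟨f, hf, hfA, hadj, a, rfl⟩ := exists_copy_of_not_copyFree_insert hA h
  calc d ≤ _ := le_card_nbrs_of_copy hG hf hfA hadj a
    _ ≤ _ := card_nbrs_mono _ inter_subset_left
    _ = _ := by rw [nbrs_insert_self]

lemma copyFree_insert_of_card_nbrs_lt (hG : ∀ a, d ≤ #(nbrs G a univ)) {A : Finset V} {v : V}
    (hA : CopyFree G H A) (h : #(nbrs H v A) < d) : CopyFree G H (insert v A) := by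
  by_contra h'
  exact absurd (le_card_nbrs_of_not_copyFree_insert hG hA h') (by omega)

lemma mem_copy_of_card_nbrs_eq (hG : ∀ a, d ≤ #(nbrs G a univ)) {A : Finset V} {f : α → V}
    (hf : Function.Injective f) (hA : ∀ a, f a ∈ A) (hadj : ∀ a b, G.Adj a b → H.Adj (f a) (f b))
    {a : α} (h : #(nbrs H (f a) A) = d) {w : V} (hw : w ∈ nbrs H (f a) A) : ∃ b, f b = w := by
  have h1 := le_card_nbrs_of_copy hG hf hA hadj a
  have h2 := eq_of_subset_of_card_le (nbrs_mono (H := H) (f a) (inter_subset_left (s₁ := A)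
    (s₂ := univ.image f))) (by omega)
  rw [← h2] at hw
  simpa using (mem_inter.1 (mem_nbrs.1 hw).1).2

lemma CopyFree.swap (hG : ∀ a, d ≤ #(nbrs G a univ)) {A : Finset V} {v w : V}
    (hA : CopyFree G H A) (h : #(nbrs H v A) = d) (hw : w ∈ nbrs H v A) :
    CopyFree G H (insert v (A.erase w)) := by
  rw [mem_nbrs] at hw
  have := card_nbrs_erase hw.1 hw.2
  exact copyFree_insert_of_card_nbrs_lt hG (hA.mono (erase_subset _ _)) (by omega)

end CopyFree

section ConnectedSet

lemma ConnectedSet.subset_of_closed {A B C : Finset V} (hA : ConnectedSet H A) (hAC : A ⊆ C)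
    (hB : ∀ x ∈ B, ∀ y ∈ C, H.Adj x y → y ∈ B) (h : (A ∩ B).Nonempty) : A ⊆ B := by
  have := hA (A ∩ B) inter_subset_left h (fun x hx y hy hxy ↦
    mem_inter.2 ⟨hy, hB x (mem_inter.1 hx).2 y (hAC hy) hxy⟩)
  exact inter_eq_left.1 this

lemma ConnectedSet.insert {D : Finset V} {x y : V} (hD : ConnectedSet H D) (hy : y ∈ D)
    (hxy : H.Adj x y) : ConnectedSet H (insert x D) := by
  intro C hC hne hcl
  have hDC : D ⊆ C := by
    refine hD.subset_of_closed (subset_insert x D) hcl ?_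
    obtain ⟨z, hz⟩ := hne
    rcases mem_insert.1 (hC hz) with rfl | hzD
    · exact ⟨y, mem_inter.2 ⟨hy, hcl _ hz _ (mem_insert_of_mem hy) hxy⟩⟩
    · exact ⟨z, mem_inter.2 ⟨hzD, hz⟩⟩
  exact hC.antisymm (insert_subset (hcl y (hDC hy) x (mem_insert_self _ _) hxy.symm) hDC)

lemma connectedSet_singleton (x : V) : ConnectedSet H {x} := by
  intro C hC hne _
  exact (subset_singleton_iff.1 hC).resolve_left hne.ne_empty

/-- A connected set with at least two elements has a non-cut vertex other than a given one. -/
lemma ConnectedSet.exists_erase {B : Finset V} (hB : ConnectedSet H B) (hcard : 1 < #B) {r : V}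
    (hr : r ∈ B) : ∃ v ∈ B, v ≠ r ∧ ConnectedSet H (B.erase v) := by
  have hne : ({D ∈ B.powerset | r ∈ D ∧ D ≠ B ∧ ConnectedSet H D}).Nonempty := by
    refine ⟨{r}, ?_⟩
    simp only [mem_filter, mem_powerset, singleton_subset_iff, mem_singleton, true_and, hr]
    exact ⟨fun h ↦ by simp [← h] at hcard, connectedSet_singleton r⟩
  obtain ⟨D, hD, hmax⟩ := exists_max_image _ card hne
  simp only [mem_filter, mem_powerset, and_imp] at hD hmax
  obtain ⟨hDB, hrD, hDne, hDc⟩ := hD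
  have : ∃ y ∈ D, ∃ x ∈ B, H.Adj y x ∧ x ∉ D := by
    by_contra! h
    exact hDne (hB D hDB ⟨r, hrD⟩ h)
  obtain ⟨y, hy, x, hx, hyx, hxD⟩ := this
  have hins : Insert.insert x D = B := by
    by_contra h
    have := hmax (Insert.insert x D) (insert_subset hx hDB) (mem_insert_of_mem hrD) h
      (hDc.insert hy hyx.symm)
    rw [card_insert_of_notMem hxD] at this
    omega
  refine ⟨x, hx, fun h ↦ hxD (h ▸ hrD), ?_⟩
  rwa [← hins, erase_insert hxD]

lemma connectedSet_of_pairwise_adj {A : Finset V}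
    (h : ∀ x ∈ A, ∀ y ∈ A, x ≠ y → H.Adj x y) : ConnectedSet H A := by
  intro C hC ⟨x, hx⟩ hcl
  refine hC.antisymm fun y hy ↦ ?_
  by_cases hxy : x = y
  · exact hxy ▸ hx
  · exact hcl x hx y hy (h x (hC hx) y hy hxy)

lemma connectedSet_univ [Fintype V] (h : H.Connected) : ConnectedSet H (univ : Finset V) := by
  intro C _ ⟨x, hx⟩ hcl
  refine eq_univ_of_forall fun y ↦ ?_
  obtain ⟨p⟩ := h.preconnected x y
  induction p with
  | nil => exact hx
  | cons hadj _ ih => exact ih (hcl _ hx _ (mem_univ _) hadj)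

end ConnectedSet

section Critical

variable {m : ℕ}

lemma PartColorable.mono {A B : Finset V} (h : PartColorable G H m B) (hAB : A ⊆ B) :
    PartColorable G H m A :=
  h.imp fun _ hc i ↦ (hc i).mono (filter_subset_filter _ hAB)

lemma partColorable_one {A : Finset V} : PartColorable G H 1 A ↔ CopyFree G H A := by
  constructor
  · rintro ⟨c, hc⟩
    simpa [Subsingleton.elim _ (0 : Fin 1)] using hc 0
  · intro h
    exact ⟨fun _ ↦ 0, fun i ↦ h.mono (filter_subset _ _)⟩

lemma partColorable_insert {A : Finset V} {v : V} {c : V → Fin m}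
    (hc : ∀ i, CopyFree G H {x ∈ A | c x = i}) {i : Fin m}
    (hi : CopyFree G H (insert v {x ∈ A | c x = i})) : PartColorable G H m (insert v A) := by
  refine ⟨Function.update c v i, fun j ↦ ?_⟩
  by_cases hj : j = i
  · subst hj
    refine hi.mono fun x ↦ ?_
    by_cases hx : x = v <;> simp [hx, Function.update_apply]
  · refine (hc j).mono fun x ↦ ?_
    by_cases hx : x = v <;> simp [hx, Function.update_apply]
    exact fun h ↦ absurd h.symm hj

lemma partColorable_union (hG : G.Preconnected) {A B : Finset V} (hA : PartColorable G H m A)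
    (hB : PartColorable G H m B) (hAB : ∀ x ∈ A, ∀ y ∈ B, H.Adj x y → y ∈ A) :
    PartColorable G H m (A ∪ B) := by
  obtain ⟨c, hc⟩ := hA
  obtain ⟨c', hc'⟩ := hB
  refine ⟨fun v ↦ if v ∈ A then c v else c' v, fun i ⟨f, hf, hfi, hadj⟩ ↦ ?_⟩
  simp only [mem_filter, mem_union] at hfi
  have key : ∀ a b, f a ∈ A → f b ∈ A := by
    intro a b ha
    obtain ⟨p⟩ := hG a b
    induction p with
    | nil => exact ha
    | @cons u v w h _ ih =>
      refine ih ?_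
      rcases (hfi v).1 with h' | h'
      · exact h'
      · exact hAB _ ha _ h' (hadj _ _ h)
  by_cases h : ∃ a, f a ∈ A
  · obtain ⟨a, ha⟩ := h
    refine hc i ⟨f, hf, fun b ↦ ?_, hadj⟩
    have := (hfi b).2
    rw [if_pos (key a b ha)] at this
    simp [key a b ha, this]
  · push Not at h
    refine hc' i ⟨f, hf, fun b ↦ ?_, hadj⟩
    have := hfi b
    simp only [h b, false_or, if_false] at this
    simp [this]

lemma exists_critical_subset {A : Finset V} (h : ¬ PartColorable G H m A) :
    ∃ B ⊆ A, Critical G H m B := by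
  induction A using Finset.strongInduction with
  | H A ih =>
    by_cases h' : ∀ C ⊂ A, PartColorable G H m C
    · exact ⟨A, subset_rfl, h, h'⟩
    · push Not at h'
      obtain ⟨C, hC, hCc⟩ := h'
      obtain ⟨B, hB, hBc⟩ := ih C hC hCc
      exact ⟨B, hB.trans hC.1, hBc⟩

lemma Critical.connectedSet (hG : G.Preconnected) {B : Finset V} (hB : Critical G H m B) :
    ConnectedSet H B := by
  intro C hC hne hcl
  by_contra hCB
  have h1 := hB.2 C (hC.ssubset_of_ne hCB)
  have h2 := hB.2 (B \ C) (sdiff_ssubset hC hne)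
  have := partColorable_union hG h1 h2 (fun x hx y hy ↦ hcl x hx y (mem_sdiff.1 hy).1)
  rw [union_sdiff_of_subset hC] at this
  exact hB.1 this

lemma sum_card_nbrs_color (v : V) (A : Finset V) (c : V → Fin m) :
    ∑ i, #(nbrs H v {x ∈ A | c x = i}) = #(nbrs H v A) := by
  rw [card_eq_sum_card_fiberwise (f := c) (t := univ) (fun _ _ ↦ mem_coe.2 (mem_univ _))]
  refine sum_congr rfl fun i _ ↦ congrArg card ?_
  ext; simp; tauto

variable [Fintype α] {d : ℕ}

lemma Critical.le_card_nbrs (hG : ∀ a, d ≤ #(nbrs G a univ)) {B : Finset V}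
    (hB : Critical G H m B) {v : V} (hv : v ∈ B) : m * d ≤ #(nbrs H v B) := by
  obtain ⟨c, hc⟩ := hB.2 (B.erase v) (erase_ssubset hv)
  by_contra! hlt
  rw [← nbrs_erase_self, ← sum_card_nbrs_color v _ c] at hlt
  obtain ⟨i, -, hi⟩ : ∃ i ∈ (univ : Finset (Fin m)), #(nbrs H v {x ∈ B.erase v | c x = i}) < d := by
    refine exists_lt_of_sum_lt (hlt.trans_eq ?_)
    simp
  have := partColorable_insert hc
    (copyFree_insert_of_card_nbrs_lt hG (hc i) hi)
  rw [insert_erase hv] at this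
  exact hB.1 this

lemma Critical.card_nbrs_eq (hG : ∀ a, d ≤ #(nbrs G a univ)) {A B : Finset V}
    (hB : Critical G H m B) (hBA : B ⊆ A) (hA : ∀ x ∈ A, #(nbrs H x A) ≤ m * d) {v : V}
    (hv : v ∈ B) : #(nbrs H v B) = m * d ∧ #(nbrs H v A) = m * d := by
  have h1 := hB.le_card_nbrs hG hv
  have h2 := card_nbrs_mono (H := H) v hBA
  have h3 := hA v (hBA hv)
  omega

lemma Critical.nbrs_eq (hG : ∀ a, d ≤ #(nbrs G a univ)) {A B : Finset V}
    (hB : Critical G H m B) (hBA : B ⊆ A) (hA : ∀ x ∈ A, #(nbrs H x A) ≤ m * d) {v : V}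
    (hv : v ∈ B) : nbrs H v B = nbrs H v A :=
  eq_of_subset_of_card_le (nbrs_mono v hBA) (by
    rw [(hB.card_nbrs_eq hG hBA hA hv).1, (hB.card_nbrs_eq hG hBA hA hv).2])

lemma Critical.closed (hG : ∀ a, d ≤ #(nbrs G a univ)) {A B : Finset V}
    (hB : Critical G H m B) (hBA : B ⊆ A) (hA : ∀ x ∈ A, #(nbrs H x A) ≤ m * d) :
    ∀ x ∈ B, ∀ y ∈ A, H.Adj x y → y ∈ B := by
  intro x hx y hy hxy
  have : y ∈ nbrs H x A := by simp [*]
  rw [← hB.nbrs_eq hG hBA hA hx] at this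
  exact (mem_nbrs.1 this).1

lemma Critical.eq_of_inter_nonempty (hGc : G.Preconnected) (hG : ∀ a, d ≤ #(nbrs G a univ))
    {A B C : Finset V} (hB : Critical G H m B) (hBA : B ⊆ A) (hC : Critical G H m C) (hCA : C ⊆ A)
    (hA : ∀ x ∈ A, #(nbrs H x A) ≤ m * d) (h : (B ∩ C).Nonempty) : B = C :=
  ((hB.connectedSet hGc).subset_of_closed hBA (hC.closed hG hCA hA) h).antisymm
    ((hC.connectedSet hGc).subset_of_closed hCA (hB.closed hG hBA hA) (inter_comm B C ▸ h))

/-- If a critical set has `m * d + 1` vertices, then `G` has at most `d + 1` vertices. -/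
lemma Critical.card_le (hm : 0 < m) {B : Finset V} (hB : Critical G H m B)
    (hcard : #B = m * d + 1) : Fintype.card α ≤ d + 1 := by
  by_contra! hlt
  obtain ⟨v, hv⟩ : B.Nonempty := card_pos.1 (by omega)
  obtain ⟨c, hc⟩ := hB.2 (B.erase v) (erase_ssubset hv)
  have : NeZero m := ⟨hm.ne'⟩
  obtain ⟨i, -, hi⟩ := exists_card_fiber_le_of_card_le_mul (f := c) (s := B.erase v)
    (t := univ) (n := d) univ_nonempty (by simp [card_erase_of_mem hv, hcard])
  have := partColorable_insert (v := v) hc (i := i)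
    (copyFree_of_card_lt ((card_insert_le _ _).trans_lt (by omega)))
  rw [insert_erase hv] at this
  exact hB.1 this

end Critical

section Optimal

variable {m d : ℕ}

/-- `S` is a `G`-free subset of `X` of maximum cardinality. -/
def IsMaxFree (G : SimpleGraph α) (H : SimpleGraph V) (X S : Finset V) : Prop :=
  S ⊆ X ∧ CopyFree G H S ∧ ∀ T ⊆ X, CopyFree G H T → #T ≤ #S

/-- The critical subsets of `A`. -/
noncomputable def criticalSubsets (G : SimpleGraph α) (H : SimpleGraph V) (m : ℕ) (A : Finset V) :
    Finset (Finset V) := {B ∈ A.powerset | Critical G H m B}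

/-- `S` is a maximum `G`-free subset of `X` whose complement in `X` has as few critical subsets
as possible. -/
def Optimal (G : SimpleGraph α) (H : SimpleGraph V) (m : ℕ) (X S : Finset V) : Prop :=
  IsMaxFree G H X S ∧ ∀ T, IsMaxFree G H X T →
    #(criticalSubsets G H m (X \ S)) ≤ #(criticalSubsets G H m (X \ T))

/-- The standing assumptions: `G` is connected with minimum degree at least `d`, and the subgraph
of `H` induced by `X` has maximum degree at most `(m + 1) * d`. -/
structure Bounded [Fintype α] (G : SimpleGraph α) (H : SimpleGraph V) (m d : ℕ) (X : Finset V) :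
    Prop where
  preconnected : G.Preconnected
  le_degree : ∀ a, d ≤ #(nbrs G a univ)
  d_pos : 0 < d
  m_pos : 0 < m
  card_nbrs_le : ∀ x ∈ X, #(nbrs H x X) ≤ (m + 1) * d

@[simp] lemma mem_criticalSubsets {A B : Finset V} :
    B ∈ criticalSubsets G H m A ↔ B ⊆ A ∧ Critical G H m B := by
  simp [criticalSubsets]

lemma exists_isMaxFree [Fintype α] [Nonempty α] (X : Finset V) : ∃ S, IsMaxFree G H X S := by
  obtain ⟨S, hS, hmax⟩ := exists_max_image {T ∈ X.powerset | CopyFree G H T} card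
    ⟨∅, by simpa using copyFree_of_card_lt (by simpa using Fintype.card_pos)⟩
  simp only [mem_filter, mem_powerset, and_imp] at hS hmax
  exact ⟨S, hS.1, hS.2, hmax⟩

lemma exists_optimal [Fintype α] [Nonempty α] (m : ℕ) (X : Finset V) : ∃ S, Optimal G H m X S := by
  obtain ⟨S, hS, hmin⟩ := exists_min_image {T ∈ X.powerset | IsMaxFree G H X T}
    (fun T ↦ #(criticalSubsets G H m (X \ T))) (by
      obtain ⟨S, hS⟩ := exists_isMaxFree (G := G) (H := H) X
      exact ⟨S, by simpa using ⟨hS.1, hS⟩⟩)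
  simp only [mem_filter, mem_powerset, and_imp] at hS hmin
  exact ⟨S, hS.2, fun T hT ↦ hmin T hT.1 hT⟩

lemma sdiff_swap {X S : Finset V} {v w : V} (hS : S ⊆ X) (hw : w ∈ S) (hv : v ∉ S) :
    X \ insert v (S.erase w) = insert w ((X \ S).erase v) := by
  ext x
  simp only [mem_sdiff, mem_insert, mem_erase]
  by_cases h : x = w
  · subst h
    simp [hS hw, (ne_of_mem_of_not_mem hw hv)]
  · grind

variable {X S B : Finset V} {v w : V}

lemma IsMaxFree.not_copyFree_insert (hS : IsMaxFree G H X S) (hv : v ∈ X \ S) :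
    ¬ CopyFree G H (insert v S) := by
  intro h
  rw [mem_sdiff] at hv
  have := hS.2.2 _ (insert_subset hv.1 hS.1) h
  rw [card_insert_of_notMem hv.2] at this
  omega

namespace Bounded

variable [Fintype α] (hX : Bounded G H m d X)
include hX

lemma card_nbrs_sdiff_le (hS : IsMaxFree G H X S) : ∀ x ∈ X \ S, #(nbrs H x (X \ S)) ≤ m * d := by
  intro x hx
  have h1 := le_card_nbrs_of_not_copyFree_insert hX.le_degree hS.2.1 (hS.not_copyFree_insert hx)
  have h2 := card_nbrs_add (H := H) (v := x) hS.1
  have h3 := hX.card_nbrs_le x (mem_sdiff.1 hx).1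
  rw [add_mul, one_mul] at h3
  omega

lemma card_nbrs_critical (hS : IsMaxFree G H X S) (hB : Critical G H m B) (hBX : B ⊆ X \ S)
    (hv : v ∈ B) : #(nbrs H v B) = m * d ∧ #(nbrs H v (X \ S)) = m * d :=
  hB.card_nbrs_eq hX.le_degree hBX (hX.card_nbrs_sdiff_le hS) hv

lemma closed_critical (hS : IsMaxFree G H X S) (hB : Critical G H m B) (hBX : B ⊆ X \ S) :
    ∀ x ∈ B, ∀ y ∈ X \ S, H.Adj x y → y ∈ B :=
  hB.closed hX.le_degree hBX (hX.card_nbrs_sdiff_le hS)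

lemma card_nbrs_free (hS : IsMaxFree G H X S) (hB : Critical G H m B) (hBX : B ⊆ X \ S)
    (hv : v ∈ B) : #(nbrs H v S) = d := by
  have h1 := le_card_nbrs_of_not_copyFree_insert hX.le_degree hS.2.1
    (hS.not_copyFree_insert (hBX hv))
  have h2 := card_nbrs_add (H := H) (v := v) hS.1
  have h3 := hX.card_nbrs_le v (mem_sdiff.1 (hBX hv)).1
  have h4 := (hX.card_nbrs_critical hS hB hBX hv).2
  rw [add_mul, one_mul] at h3
  omega

lemma isMaxFree_swap (hS : IsMaxFree G H X S) (hB : Critical G H m B) (hBX : B ⊆ X \ S)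
    (hv : v ∈ B) (hw : w ∈ nbrs H v S) : IsMaxFree G H X (insert v (S.erase w)) := by
  have hvX := mem_sdiff.1 (hBX hv)
  have hwS := (mem_nbrs.1 hw).1
  refine ⟨insert_subset hvX.1 ((erase_subset _ _).trans hS.1),
    hS.2.1.swap hX.le_degree (hX.card_nbrs_free hS hB hBX hv) hw, fun T hT hTf ↦ ?_⟩
  rw [card_insert_of_notMem (fun h ↦ hvX.2 (mem_of_mem_erase h)), card_erase_add_one hwS]
  exact hS.2.2 T hT hTf

/-- Exchanging a vertex of a critical set with one of its neighbours in an optimal set yields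
another optimal set, and the exchanged neighbour lies in a new critical set. -/
lemma swap (hS : Optimal G H m X S) (hB : Critical G H m B) (hBX : B ⊆ X \ S)
    (hv : v ∈ B) (hw : w ∈ nbrs H v S) : Optimal G H m X (insert v (S.erase w)) ∧
      ∃ B', Critical G H m B' ∧ B' ⊆ X \ insert v (S.erase w) ∧ w ∈ B' := by
  have hS' := hX.isMaxFree_swap hS.1 hB hBX hv hw
  have hvX := mem_sdiff.1 (hBX hv)
  have hwS := (mem_nbrs.1 hw).1
  have hR := sdiff_swap hS.1.1 hwS hvX.2
  set F := criticalSubsets G H m (X \ S) with hF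
  set F' := criticalSubsets G H m (X \ insert v (S.erase w)) with hF'
  have h1 : #{C ∈ F' | w ∉ C} < #F := by
    refine card_lt_card ((Finset.ssubset_iff_of_subset fun C hC ↦ ?_).2 ⟨B, ?_, ?_⟩)
    · rw [mem_filter, hF', mem_criticalSubsets, hR, subset_insert_iff_of_notMem] at hC
      · exact mem_criticalSubsets.2 ⟨hC.1.1.trans (erase_subset _ _), hC.1.2⟩
      · exact hC.2
    · exact mem_criticalSubsets.2 ⟨hBX, hB⟩
    · intro h
      have := (mem_criticalSubsets.1 (mem_filter.1 h).1).1 hv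
      simp at this
  have h2 : #{C ∈ F' | w ∈ C} ≤ 1 := by
    refine card_le_one.2 fun C hC D hD ↦ ?_
    rw [mem_filter, hF', mem_criticalSubsets] at hC hD
    exact hC.1.2.eq_of_inter_nonempty hX.preconnected hX.le_degree hC.1.1 hD.1.2 hD.1.1
      (hX.card_nbrs_sdiff_le hS') ⟨w, mem_inter.2 ⟨hC.2, hD.2⟩⟩
  have h3 := card_filter_add_card_filter_not (s := F') (fun C ↦ w ∈ C)
  have h4 := hS.2 _ hS'
  refine ⟨⟨hS', fun T hT ↦ le_trans ?_ (hS.2 T hT)⟩, ?_⟩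
  · change #F' ≤ #F
    omega
  · obtain ⟨C, hC⟩ : ({C ∈ F' | w ∈ C}).Nonempty := card_pos.1 (by
      change #F ≤ #F' at h4
      omega)
    rw [mem_filter, hF', mem_criticalSubsets] at hC
    exact ⟨C, hC.1.2, hC.1.1, hC.2⟩

/-- If a neighbour `w` of `v` in the optimal set also has a neighbour in `B.erase v`, then it has
the same neighbours as `v` in the complement. -/
lemma nbrs_eq_of_adj (hS : Optimal G H m X S) (hB : Critical G H m B) (hBX : B ⊆ X \ S)
    (hv : v ∈ B) (hBv : ConnectedSet H (B.erase v)) (hw : w ∈ nbrs H v S) {u : V}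
    (hu : u ∈ B.erase v) (huw : H.Adj w u) : nbrs H w ((X \ S).erase v) = nbrs H v B := by
  obtain ⟨hS', B', hB', hB'X, hwB'⟩ := hX.swap hS hB hBX hv hw
  have hvX := mem_sdiff.1 (hBX hv)
  have hwS := (mem_nbrs.1 hw).1
  have hR := sdiff_swap hS.1.1 hwS hvX.2
  have hcl := hX.closed_critical hS'.1 hB' hB'X
  have hsub : B.erase v ⊆ X \ insert v (S.erase w) := by
    rw [hR]
    exact (erase_subset_erase _ hBX).trans (subset_insert _ _)
  have hBB' : B.erase v ⊆ B' :=
    hBv.subset_of_closed hsub hcl ⟨u, mem_inter.2 ⟨hu, hcl w hwB' u (hsub hu) huw⟩⟩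
  symm
  refine eq_of_subset_of_card_le (fun y hy ↦ ?_) ?_
  · rw [mem_nbrs] at hy
    have hyv : y ∈ B.erase v := mem_erase.2 ⟨hy.2.ne', hy.1⟩
    have h1 := (hX.card_nbrs_critical hS'.1 hB' hB'X (hBB' hyv)).2
    have h2 := (hX.card_nbrs_critical hS.1 hB hBX hy.1).2
    refine mem_nbrs.2 ⟨erase_subset_erase _ hBX hyv, ?_⟩
    by_contra hwy
    rw [hR, nbrs_insert_of_not_adj (fun h ↦ hwy h.symm)] at h1
    have := card_nbrs_erase (H := H) (hBX hv) hy.2.symm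
    omega
  · rw [(hX.card_nbrs_critical hS.1 hB hBX hv).1]
    have := (hX.card_nbrs_critical hS'.1 hB' hB'X hwB').2
    rw [hR, nbrs_insert_self] at this
    exact this.le

/-- A vertex of the optimal set adjacent to all neighbours of `v` in a critical set `B ∋ v` has
no neighbour elsewhere outside the optimal set. -/
lemma not_adj_of_nbrs_subset (hmd : 1 < m * d) (hS : Optimal G H m X S) (hB : Critical G H m B)
    (hBX : B ⊆ X \ S) (hv : v ∈ B) {x z : V} (hx : x ∈ S) (hxv : ∀ y ∈ nbrs H v B, H.Adj x y)
    (hz : z ∈ X \ S) (hzB : z ∉ B) : ¬ H.Adj x z := by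
  intro hxz
  have hcard := (hX.card_nbrs_critical hS.1 hB hBX hv).1
  obtain ⟨u, hu, u', hu', hne⟩ := one_lt_card.1 (hcard.symm ▸ hmd)
  have hxu := hxv u hu
  have hxu' := hxv u' hu'
  have huB := (mem_nbrs.1 hu).1
  have hvu := (mem_nbrs.1 hu).2
  obtain ⟨hu'B, hvu'⟩ := mem_nbrs.1 hu'
  obtain ⟨hS', B', hB', hB'X, hxB'⟩ := hX.swap hS hB hBX huB (mem_nbrs.2 ⟨hx, hxu.symm⟩)
  have hR := sdiff_swap hS.1.1 hx (mem_sdiff.1 (hBX huB)).2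
  have hcl := hX.closed_critical hS'.1 hB' hB'X
  have hsub : (X \ S).erase u ⊆ X \ insert u (S.erase x) := hR ▸ subset_insert _ _
  have hmemB' : u' ∈ B' := hcl x hxB' u' (hsub (mem_erase.2 ⟨hne.symm, hBX hu'B⟩)) hxu'
  have hvB' : v ∈ B' := hcl u' hmemB' v (hsub (mem_erase.2 ⟨hvu.ne, hBX hv⟩)) hvu'.symm
  have hvx : H.Adj x v := by
    by_contra hvx
    have h1 := (hX.card_nbrs_critical hS'.1 hB' hB'X hvB').2
    have h2 := (hX.card_nbrs_critical hS.1 hB hBX hv).2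
    rw [hR, nbrs_insert_of_not_adj (fun h ↦ hvx h.symm)] at h1
    have := card_nbrs_erase (H := H) (hBX huB) hvu
    omega
  have h1 := (hX.card_nbrs_critical hS'.1 hB' hB'X hxB').2
  have h2 : insert z (insert v ((nbrs H v B).erase u)) ⊆ nbrs H x (X \ insert u (S.erase x)) := by
    intro y hy
    rw [mem_insert, mem_insert, mem_erase] at hy
    rcases hy with rfl | rfl | ⟨hyu, hy⟩
    · exact mem_nbrs.2 ⟨hsub (mem_erase.2 ⟨fun h ↦ hzB (h ▸ huB), hz⟩), hxz⟩
    · exact mem_nbrs.2 ⟨hsub (mem_erase.2 ⟨hvu.ne, hBX hv⟩), hvx⟩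
    · exact mem_nbrs.2 ⟨hsub (mem_erase.2 ⟨hyu, hBX (mem_nbrs.1 hy).1⟩), hxv y hy⟩
  have h3 := card_le_card h2
  rw [card_insert_of_notMem, card_insert_of_notMem, card_erase_add_one hu] at h3
  · omega
  · simp
  · simp only [mem_insert, mem_erase, mem_nbrs]
    rintro (rfl | h)
    · exact hzB hv
    · exact hzB h.2.1

end Bounded

end Optimal

section Exchange

variable [Fintype α] {m d : ℕ} {X S B : Finset V} {v w : V}

/-- `G` is complete on `d + 1` vertices and `X` is a clique on `m * d + 1` vertices. -/
def Exceptional (G : SimpleGraph α) (H : SimpleGraph V) (m d : ℕ) (X : Finset V) : Prop :=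
  Fintype.card α = d + 1 ∧ G = ⊤ ∧ #X = m * d + 1 ∧ ∀ x ∈ X, ∀ y ∈ X, x ≠ y → H.Adj x y

/-- Either no critical set of maximum degree at most `m * d` has a cut vertex, or all critical sets
have the same size. -/
def NoCutOrEqualSize (G : SimpleGraph α) (H : SimpleGraph V) (m d : ℕ) : Prop :=
  (∀ B, Critical G H m B → (∀ x ∈ B, #(nbrs H x B) ≤ m * d) →
    ∀ u ∈ B, ConnectedSet H (B.erase u)) ∨ ∃ n, ∀ B, Critical G H m B → #B = n

namespace Bounded

variable (hX : Bounded G H m d X) (hQ : NoCutOrEqualSize G H m d)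
include hX hQ

lemma connectedSet_erase_of_adj (hS : Optimal G H m X S) (hB : Critical G H m B)
    (hBX : B ⊆ X \ S) {u y : V} (hu : u ∈ B) (hy : y ∈ B) (huy : H.Adj u y)
    (hw : w ∈ nbrs H y S) (hwu : H.Adj w u)
    (hwn : nbrs H w ((X \ S).erase u) = nbrs H u B) : ConnectedSet H (B.erase y) := by
  rcases hQ with hQ | ⟨n, hQ⟩
  · exact hQ B hB (fun x hx ↦ (hX.card_nbrs_critical hS.1 hB hBX hx).1.le) y hy
  obtain ⟨hS', B', hB', hB'X, hwB'⟩ := hX.swap hS hB hBX hy hw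
  have hwS := (mem_nbrs.1 hw).1
  have hR := sdiff_swap hS.1.1 hwS (mem_sdiff.1 (hBX hy)).2
  have hcl := hX.closed_critical hS.1 hB hBX
  have hwB : w ∉ B := fun h ↦ (mem_sdiff.1 (hBX h)).2 hwS
  have hnbr : ∀ z ∈ X \ S, H.Adj w z → z = u ∨ z ∈ nbrs H u B := by
    intro z hz hwz
    by_cases hzu : z = u
    · exact Or.inl hzu
    · exact Or.inr (hwn ▸ mem_nbrs.2 ⟨mem_erase.2 ⟨hzu, hz⟩, hwz⟩)
  have hB'c := hB'.connectedSet hX.preconnected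
  have hB'B : B' = insert w (B.erase y) := by
    refine eq_of_subset_of_card_le (hB'c.subset_of_closed subset_rfl ?_
      ⟨w, mem_inter.2 ⟨hwB', mem_insert_self _ _⟩⟩) ?_
    · intro x hx z hz hxz
      have hz' := hB'X hz
      rw [hR, mem_insert, mem_erase] at hz'
      rcases hz' with rfl | ⟨hzy, hz'⟩
      · exact mem_insert_self _ _
      refine mem_insert_of_mem (mem_erase.2 ⟨hzy, ?_⟩)
      rcases mem_insert.1 hx with rfl | hx
      · rcases hnbr z hz' hxz with rfl | h
        · exact hu
        · exact (mem_nbrs.1 h).1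
      · exact hcl x (mem_of_mem_erase hx) z hz' hxz
    · rw [card_insert_of_notMem (fun h ↦ hwB (mem_of_mem_erase h)), card_erase_add_one hy,
        hQ B hB, hQ B' hB']
  intro C hC hne hCcl
  rw [hB'B] at hB'c
  have hwC : w ∉ C := fun h ↦ hwB (mem_of_mem_erase (hC h))
  by_cases huC : u ∈ C
  · have := hB'c (insert w C) (insert_subset_insert _ hC) ⟨w, mem_insert_self _ _⟩ ?_
    · have h2 := congrArg (fun T ↦ T.erase w) this
      simpa [erase_insert hwC, erase_insert (fun h ↦ hwB (mem_of_mem_erase h))] using h2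
    · intro x hx z hz hxz
      rcases mem_insert.1 hz with rfl | hzB
      · exact mem_insert_self _ _
      refine mem_insert_of_mem ?_
      rcases mem_insert.1 hx with rfl | hx
      · rcases hnbr z (hBX (mem_of_mem_erase hzB)) hxz with rfl | h
        · exact huC
        · exact hCcl u huC z hzB (mem_nbrs.1 h).2
      · exact hCcl x hx z hzB hxz
  · have := hB'c C (hC.trans (subset_insert _ _)) hne ?_
    · exact absurd (this ▸ mem_insert_self _ _) hwC
    · intro x hx z hz hxz
      rcases mem_insert.1 hz with rfl | hz
      · exfalso
        rcases hnbr x (hBX (mem_of_mem_erase (hC hx))) hxz.symm with rfl | h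
        · exact huC hx
        · exact huC (hCcl x hx u (mem_erase.2 ⟨huy.ne, hu⟩) (mem_nbrs.1 h).2.symm)
      · exact hCcl x hx z hz hxz

/-- Outside the exceptional case, every non-cut vertex `v` of a critical set `B` has a neighbour in
the optimal set without neighbours in `B.erase v`. -/
lemma exists_nbr_not_adj (hXc : ConnectedSet H X) (hE : ¬ Exceptional G H (m + 1) d X)
    (hS : Optimal G H m X S) (hB : Critical G H m B) (hBX : B ⊆ X \ S) (hv : v ∈ B)
    (hBv : ConnectedSet H (B.erase v)) :
    ∃ w ∈ nbrs H v S, ∀ u ∈ B.erase v, ¬ H.Adj w u := by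
  by_contra! hcon
  set W := nbrs H v S with hW
  have hWcard : #W = d := hX.card_nbrs_free hS.1 hB hBX hv
  set C : Finset V := {u ∈ B | ConnectedSet H (B.erase u) ∧ nbrs H u S = W ∧
    ∀ w ∈ W, nbrs H w ((X \ S).erase u) = nbrs H u B} with hC
  have hCB : C = B := by
    refine hB.connectedSet hX.preconnected C (filter_subset _ _) ⟨v, ?_⟩ ?_
    · refine mem_filter.2 ⟨hv, hBv, rfl, fun w hw ↦ ?_⟩
      obtain ⟨u, hu, huw⟩ := hcon w hw
      exact hX.nbrs_eq_of_adj hS hB hBX hv hBv hw hu huw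
    · intro u hu y hy huy
      obtain ⟨huB, -, huW, hun⟩ := mem_filter.1 hu
      have hWy : W ⊆ nbrs H y S := by
        intro w hw
        have : y ∈ nbrs H w ((X \ S).erase u) := by
          rw [hun w hw]
          exact mem_nbrs.2 ⟨hy, huy⟩
        exact mem_nbrs.2 ⟨(mem_nbrs.1 hw).1, (mem_nbrs.1 this).2.symm⟩
      have hyW : W = nbrs H y S := eq_of_subset_of_card_le hWy
        (by rw [hWcard, hX.card_nbrs_free hS.1 hB hBX hy])
      have hwu : ∀ w ∈ W, H.Adj w u := fun w hw ↦ (mem_nbrs.1 (huW ▸ hw)).2.symm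
      obtain ⟨w, hw⟩ : W.Nonempty := card_pos.1 (hWcard ▸ hX.d_pos)
      have hBy := hX.connectedSet_erase_of_adj hQ hS hB hBX huB hy huy (hWy hw) (hwu w hw)
        (hun w hw)
      exact mem_filter.2 ⟨hy, hBy, hyW.symm, fun w hw ↦ hX.nbrs_eq_of_adj hS hB hBX hy hBy (hWy hw)
        (mem_erase.2 ⟨huy.ne, huB⟩) (hwu w hw)⟩
  have hBW : ∀ u ∈ B, ∀ w ∈ W, H.Adj u w := by
    intro u hu w hw
    rw [← hCB] at hu
    exact (mem_nbrs.1 ((mem_filter.1 hu).2.2.1 ▸ hw)).2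
  obtain ⟨w₀, hw₀⟩ : W.Nonempty := card_pos.1 (hWcard ▸ hX.d_pos)
  have hBB : ∀ u ∈ B, ∀ y ∈ B, u ≠ y → H.Adj u y := by
    intro u hu y hy huy
    have h := hu
    rw [← hCB] at h
    have h1 := (mem_filter.1 h).2.2.2 w₀ hw₀
    have : y ∈ nbrs H w₀ ((X \ S).erase u) :=
      mem_nbrs.2 ⟨mem_erase.2 ⟨huy.symm, hBX hy⟩, (hBW y hy w₀ hw₀).symm⟩
    exact (mem_nbrs.1 (h1 ▸ this)).2
  have hBcard : #B = m * d + 1 := by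
    have : nbrs H v B = B.erase v := by
      ext y
      simp only [mem_nbrs, mem_erase]
      exact ⟨fun h ↦ ⟨h.2.ne', h.1⟩, fun h ↦ ⟨h.2, hBB v hv y h.2 h.1.symm⟩⟩
    rw [← card_erase_add_one hv, ← this, (hX.card_nbrs_critical hS.1 hB hBX hv).1]
  have hα := hB.card_le hX.m_pos hBcard
  obtain ⟨f, hf, hfS, hadj, a, hav⟩ := exists_copy_of_not_copyFree_insert hS.1.2.1
    (hS.1.not_copyFree_insert (hBX hv))
  have hvS := (mem_sdiff.1 (hBX hv)).2
  have hvW : v ∉ W := fun h ↦ hvS (mem_nbrs.1 h).1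
  have hsub : insert v W ⊆ univ.image f := by
    refine insert_subset (by simpa using ⟨a, hav⟩) fun w hw ↦ ?_
    obtain ⟨b, hb⟩ := mem_copy_of_card_nbrs_eq hX.le_degree hf hfS hadj (a := a) (w := w)
      (by rw [hav, nbrs_insert_self]; exact hWcard) (by rw [hav, nbrs_insert_self]; exact hw)
    simpa using ⟨b, hb⟩
  have himg : insert v W = univ.image f := eq_of_subset_of_card_le hsub (by
    rw [card_image_of_injective _ hf, card_univ, card_insert_of_notMem hvW, hWcard]
    exact hα)
  have hαd : Fintype.card α = d + 1 := by
    have := congrArg card himg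
    rwa [card_image_of_injective _ hf, card_univ, card_insert_of_notMem hvW, hWcard, eq_comm]
      at this
  have hGtop : G = ⊤ := by
    ext x y
    refine ⟨fun h ↦ h.ne, fun hxy ↦ ?_⟩
    have h1 : nbrs G x univ ⊆ univ.erase x := fun z hz ↦ by simpa using (mem_nbrs.1 hz).2.ne'
    have h2 := eq_of_subset_of_card_le h1 (by
      rw [card_erase_of_mem (mem_univ _), card_univ, hαd]; exact hX.le_degree x)
    have : y ∈ nbrs G x univ := by
      rw [h2]
      simpa using Ne.symm hxy
    exact (mem_nbrs.1 this).2
  have hWW : ∀ x ∈ W, ∀ y ∈ W, x ≠ y → H.Adj x y := by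
    intro x hx y hy hxy
    obtain ⟨b, -, rfl⟩ := mem_image.1 (hsub (mem_insert_of_mem hx))
    obtain ⟨c, -, rfl⟩ := mem_image.1 (hsub (mem_insert_of_mem hy))
    refine hadj _ _ ?_
    rw [hGtop]
    exact fun h ↦ hxy (congrArg f h)
  have hdisj : Disjoint B W := disjoint_left.2 fun x hx hxW ↦
    (mem_sdiff.1 (hBX hx)).2 (mem_nbrs.1 hxW).1
  have hKX : B ∪ W ⊆ X := union_subset (hBX.trans sdiff_subset)
    ((filter_subset _ _).trans hS.1.1)
  have hK : ∀ x ∈ B ∪ W, ∀ y ∈ B ∪ W, x ≠ y → H.Adj x y := by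
    intro x hx y hy hxy
    rcases mem_union.1 hx with hx | hx <;> rcases mem_union.1 hy with hy | hy
    · exact hBB x hx y hy hxy
    · exact hBW x hx y hy
    · exact (hBW y hy x hx).symm
    · exact hWW x hx y hy hxy
  have hKcard : #(B ∪ W) = (m + 1) * d + 1 := by
    rw [card_union_of_disjoint hdisj, hBcard, hWcard]
    ring
  have hKX' : B ∪ W = X := by
    refine hXc _ hKX ⟨v, mem_union_left _ hv⟩ fun x hx y hy hxy ↦ ?_
    have h1 : (B ∪ W).erase x ⊆ nbrs H x X := fun z hz ↦
      mem_nbrs.2 ⟨hKX (mem_of_mem_erase hz),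
        hK x hx z (mem_of_mem_erase hz) (ne_of_mem_erase hz).symm⟩
    have h2 := eq_of_subset_of_card_le h1 (by
      rw [card_erase_of_mem hx, hKcard]
      exact hX.card_nbrs_le x (hKX hx))
    have h3 : y ∈ nbrs H x X := mem_nbrs.2 ⟨hy, hxy⟩
    rw [← h2] at h3
    exact mem_of_mem_erase h3
  exact hE ⟨hαd, hGtop, hKX' ▸ hKcard, hKX' ▸ hK⟩

end Bounded

end Exchange

section Walk

variable [Fintype α] {m d : ℕ} {X S B : Finset V} {v w : V}

/-- A record of an earlier stage of the exchange process: at that stage `v₀` was removed from the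
critical set `B₀` and added to the optimal set `S₀`. The current stage is described by the optimal
set `S`, the vertex `w` last removed from it, the set `U` of all remnants `B₀.erase v₀` and
the set `P` of all vertices added so far. -/
structure Visited (G : SimpleGraph α) (H : SimpleGraph V) (m : ℕ) (X S : Finset V) (w : V)
    (U P S₀ B₀ : Finset V) (v₀ : V) : Prop where
  optimal : Optimal G H m X S₀
  critical : Critical G H m B₀
  subset_sdiff : B₀ ⊆ X \ S₀
  mem : v₀ ∈ B₀
  connectedSet : ConnectedSet H (B₀.erase v₀)
  remnant_subset : B₀.erase v₀ ⊆ U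
  mem_placed : v₀ ∈ P
  sdiff_subset_placed : S \ S₀ ⊆ P
  mem_or_eq : ∀ y ∈ X \ S, y ∈ S₀ → y ∈ U ∨ y = w
  closed : ∀ y ∈ B₀.erase v₀, ∀ z ∈ X \ S, H.Adj y z → z ∈ B₀.erase v₀

/-- A stage of the exchange process. -/
structure Stage (G : SimpleGraph α) (H : SimpleGraph V) (m : ℕ) (X S B : Finset V) (w : V)
    (U P : Finset V) : Prop where
  optimal : Optimal G H m X S
  critical : Critical G H m B
  subset_sdiff : B ⊆ X \ S
  mem : w ∈ B
  remnants_subset : U ⊆ X \ S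
  disjoint : Disjoint U B
  placed_subset : P ⊆ S
  not_adj_placed : ∀ p ∈ P, ∀ y ∈ X \ S, y ∉ U → y ≠ w → ¬ H.Adj p y
  visited : ∀ y ∈ U, ∃ S₀ B₀ v₀, Visited G H m X S w U P S₀ B₀ v₀ ∧ y ∈ B₀.erase v₀

namespace Bounded

variable (hX : Bounded G H m d X)
include hX

/-- The exchange process never returns to a remnant of an earlier stage. -/
lemma disjoint_remnants (hmd : 1 < m * d) {U P : Finset V} (hst : Stage G H m X S B w U P)
    (hv : v ∈ B) (hvw : v ≠ w) {w' : V} (hw' : w' ∈ nbrs H v S) {B' : Finset V}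
    (hB' : Critical G H m B') (hB'X : B' ⊆ X \ insert v (S.erase w'))
    (hS' : Optimal G H m X (insert v (S.erase w'))) : Disjoint U B' := by
  rw [Finset.disjoint_left]
  intro y₀ hy₀ hy₀B'
  obtain ⟨S₀, B₀, v₀, hvis, hy₀B₀⟩ := hst.visited y₀ hy₀
  have hvR := hst.subset_sdiff hv
  have hvU : v ∉ U := disjoint_right.1 hst.disjoint hv
  obtain ⟨hw'S, hvw'⟩ := mem_nbrs.1 hw'
  have hR := sdiff_swap hst.optimal.1.1 hw'S (mem_sdiff.1 hvR).2
  have hcl := hX.closed_critical hS'.1 hB' hB'X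
  have hUR : U ⊆ X \ insert v (S.erase w') := fun y hy ↦ by
    rw [hR]
    exact mem_insert_of_mem (mem_erase.2 ⟨fun h ↦ hvU (h ▸ hy), hst.remnants_subset hy⟩)
  have hsub : B₀.erase v₀ ⊆ B' := hvis.connectedSet.subset_of_closed
    (hvis.remnant_subset.trans hUR) hcl ⟨y₀, mem_inter.2 ⟨hy₀B₀, hy₀B'⟩⟩
  have hadj : ∀ y ∈ nbrs H v₀ B₀, H.Adj w' y := by
    intro y hy
    obtain ⟨hyB₀, hv₀y⟩ := mem_nbrs.1 hy
    have hyD : y ∈ B₀.erase v₀ := mem_erase.2 ⟨hv₀y.ne', hyB₀⟩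
    by_contra hyw
    have h1 := (hX.card_nbrs_critical hS'.1 hB' hB'X (hsub hyD)).2
    rw [hR, nbrs_insert_of_not_adj (fun h ↦ hyw h.symm)] at h1
    have h2 : nbrs H y ((X \ S).erase v) ⊆ nbrs H y (B₀.erase v₀) := fun z hz ↦ by
      rw [mem_nbrs, mem_erase] at hz
      exact mem_nbrs.2 ⟨hvis.closed y hyD z hz.1.2 hz.2, hz.2⟩
    have h3 := card_le_card h2
    have h4 := card_nbrs_erase (H := H) hvis.mem hv₀y.symm
    have h5 := (hX.card_nbrs_critical hvis.optimal.1 hvis.critical hvis.subset_sdiff hyB₀).1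
    omega
  have hw'S₀ : w' ∈ S₀ := by
    by_contra h
    exact hst.not_adj_placed w' (hvis.sdiff_subset_placed (mem_sdiff.2 ⟨hw'S, h⟩)) v hvR hvU hvw
      hvw'.symm
  have hvS₀ : v ∉ S₀ := fun h ↦ (hvis.mem_or_eq v hvR h).elim hvU hvw
  have hvB₀ : v ∉ B₀ := by
    intro h
    refine hvU (hvis.remnant_subset (mem_erase.2 ⟨?_, h⟩))
    rintro rfl
    exact (mem_sdiff.1 hvR).2 (hst.placed_subset hvis.mem_placed)
  exact hX.not_adj_of_nbrs_subset hmd hvis.optimal hvis.critical hvis.subset_sdiff hvis.mem hw'S₀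
    hadj (mem_sdiff.2 ⟨(mem_sdiff.1 hvR).1, hvS₀⟩) hvB₀ hvw'.symm

lemma one_lt_card_critical (hS : IsMaxFree G H X S) (hB : Critical G H m B) (hBX : B ⊆ X \ S)
    (hw : w ∈ B) : 1 < #B := by
  have h1 := (hX.card_nbrs_critical hS hB hBX hw).1
  have h2 : nbrs H w B ⊆ B.erase w := fun z hz ↦
    mem_erase.2 ⟨(mem_nbrs.1 hz).2.ne', (mem_nbrs.1 hz).1⟩
  have h3 := card_le_card h2
  rw [card_erase_of_mem hw] at h3
  have := Nat.mul_pos hX.m_pos hX.d_pos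
  omega

variable (hQ : NoCutOrEqualSize G H m d)
include hQ

lemma exists_next_stage (hmd : 1 < m * d) (hXc : ConnectedSet H X)
    (hE : ¬ Exceptional G H (m + 1) d X) {U P : Finset V} (hst : Stage G H m X S B w U P) :
    ∃ S' B' w' U' P', Stage G H m X S' B' w' U' P' ∧ #U < #U' := by
  have hBcard := hX.one_lt_card_critical hst.optimal.1 hst.critical hst.subset_sdiff hst.mem
  obtain ⟨v, hv, hvw, hBv⟩ :=
    (hst.critical.connectedSet hX.preconnected).exists_erase hBcard hst.mem
  obtain ⟨w', hw', hw'B⟩ := hX.exists_nbr_not_adj hQ hXc hE hst.optimal hst.critical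
    hst.subset_sdiff hv hBv
  obtain ⟨hS', B', hB', hB'X, hmemB'⟩ :=
    hX.swap hst.optimal hst.critical hst.subset_sdiff hv hw'
  have hdisj := hX.disjoint_remnants hmd hst hv hvw hw' hB' hB'X hS'
  have hvR := hst.subset_sdiff hv
  have hvU : v ∉ U := disjoint_right.1 hst.disjoint hv
  obtain ⟨hw'S, hvw'⟩ := mem_nbrs.1 hw'
  have hR := sdiff_swap hst.optimal.1.1 hw'S (mem_sdiff.1 hvR).2
  have hcl := hX.closed_critical hst.optimal.1 hst.critical hst.subset_sdiff
  have hcl' := hX.closed_critical hS'.1 hB' hB'X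
  have hDR : B.erase v ⊆ X \ insert v (S.erase w') := by
    rw [hR]
    exact (erase_subset_erase _ hst.subset_sdiff).trans (subset_insert _ _)
  have hDw' : ∀ y ∈ B.erase v, ∀ z ∈ X \ insert v (S.erase w'), H.Adj y z → z ∈ B.erase v := by
    intro y hy z hz hyz
    rw [hR, mem_insert, mem_erase] at hz
    rcases hz with rfl | ⟨hzv, hz⟩
    · exact absurd hyz.symm (hw'B y hy)
    · exact mem_erase.2 ⟨hzv, hcl y (mem_of_mem_erase hy) z hz hyz⟩
  have hDB' : Disjoint (B.erase v) B' := by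
    rw [Finset.disjoint_left]
    intro y hy hyB'
    have h := (hB'.connectedSet hX.preconnected).subset_of_closed hB'X hDw'
      ⟨y, mem_inter.2 ⟨hyB', hy⟩⟩ hmemB'
    exact (mem_sdiff.1 (hst.subset_sdiff (mem_of_mem_erase h))).2 hw'S
  have hw'P : w' ∉ P := fun h ↦ hst.not_adj_placed w' h v hvR hvU hvw hvw'.symm
  have hwD : w ∈ B.erase v := mem_erase.2 ⟨hvw.symm, hst.mem⟩
  have hwU : w ∉ U := disjoint_right.1 hst.disjoint hst.mem
  have hold : ∀ S₀ B₀ v₀, Visited G H m X S w U P S₀ B₀ v₀ →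
      Visited G H m X (insert v (S.erase w')) w' (U ∪ B.erase v) (insert v P) S₀ B₀ v₀ := by
    intro S₀ B₀ v₀ h
    refine ⟨h.optimal, h.critical, h.subset_sdiff, h.mem, h.connectedSet,
      h.remnant_subset.trans subset_union_left, mem_insert_of_mem h.mem_placed, ?_, ?_, ?_⟩
    · intro y hy
      rw [mem_sdiff, mem_insert, mem_erase] at hy
      rcases hy with ⟨rfl | ⟨-, hyS⟩, hy⟩
      · exact mem_insert_self _ _
      · exact mem_insert_of_mem (h.sdiff_subset_placed (mem_sdiff.2 ⟨hyS, hy⟩))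
    · intro y hy hyS₀
      rw [hR, mem_insert, mem_erase] at hy
      rcases hy with rfl | ⟨-, hy⟩
      · exact Or.inr rfl
      · rcases h.mem_or_eq y hy hyS₀ with hy | rfl
        · exact Or.inl (mem_union_left _ hy)
        · exact Or.inl (mem_union_right _ hwD)
    · intro y hy z hz hyz
      have hz' := hz
      rw [hR, mem_insert, mem_erase] at hz
      rcases hz with rfl | ⟨-, hz⟩
      · have hyU := h.remnant_subset hy
        have hyR : y ∈ X \ insert v (S.erase z) := by
          rw [hR]
          exact mem_insert_of_mem (mem_erase.2 ⟨fun h ↦ hvU (h ▸ hyU), hst.remnants_subset hyU⟩)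
        exact absurd (hcl' z hmemB' y hyR hyz.symm) (disjoint_left.1 hdisj hyU)
      · exact h.closed y hy z hz hyz
  have hnew : Visited G H m X (insert v (S.erase w')) w' (U ∪ B.erase v) (insert v P) S B v := by
    refine ⟨hst.optimal, hst.critical, hst.subset_sdiff, hv, hBv, subset_union_right,
      mem_insert_self _ _, ?_, ?_, hDw'⟩
    · intro y hy
      rw [mem_sdiff, mem_insert, mem_erase] at hy
      rcases hy with ⟨rfl | ⟨-, hyS⟩, hy⟩
      · exact mem_insert_self _ _
      · exact absurd hyS hy
    · intro y hy hyS
      rw [hR, mem_insert, mem_erase] at hy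
      exact hy.elim Or.inr fun h ↦ absurd hyS (mem_sdiff.1 h.2).2
  refine ⟨_, B', w', U ∪ B.erase v, insert v P, ⟨hS', hB', hB'X, hmemB', ?_, ?_, ?_, ?_, ?_⟩, ?_⟩
  · refine union_subset (fun y hy ↦ ?_) hDR
    rw [hR]
    exact mem_insert_of_mem (mem_erase.2 ⟨fun h ↦ hvU (h ▸ hy), hst.remnants_subset hy⟩)
  · exact disjoint_union_left.2 ⟨hdisj, hDB'⟩
  · exact insert_subset_insert _ fun p hp ↦
      mem_erase.2 ⟨fun h ↦ hw'P (h ▸ hp), hst.placed_subset hp⟩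
  · intro p hp y hy hyU hyw'
    rw [hR, mem_insert, mem_erase] at hy
    obtain ⟨hyv, hyR⟩ := hy.resolve_left hyw'
    rw [mem_union, not_or] at hyU
    rcases mem_insert.1 hp with rfl | hp
    · exact fun h ↦ hyU.2 (mem_erase.2 ⟨hyv, hcl p hv y hyR h⟩)
    · exact hst.not_adj_placed p hp y hyR hyU.1 (fun h ↦ hyU.2 (h ▸ hwD))
  · intro y hy
    rcases mem_union.1 hy with hy | hy
    · obtain ⟨S₀, B₀, v₀, h, hy⟩ := hst.visited y hy
      exact ⟨S₀, B₀, v₀, hold _ _ _ h, hy⟩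
    · exact ⟨S, B, v, hnew, hy⟩
  · exact card_lt_card ((Finset.ssubset_iff_of_subset subset_union_left).2
      ⟨w, mem_union_right _ hwD, hwU⟩)

lemma not_stage (hmd : 1 < m * d) (hXc : ConnectedSet H X)
    (hE : ¬ Exceptional G H (m + 1) d X) {U P : Finset V} : ¬ Stage G H m X S B w U P := by
  intro hst
  obtain ⟨n, hn⟩ : ∃ n, n = #X - #U := ⟨_, rfl⟩
  induction n using Nat.strong_induction_on generalizing S B w U P with
  | _ n ih =>
    obtain ⟨S', B', w', U', P', hst', hlt⟩ := hX.exists_next_stage hQ hmd hXc hE hst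
    have := card_le_card (hst'.remnants_subset.trans sdiff_subset)
    exact ih _ (by omega) hst' rfl

/-- The complement in `X` of an optimal set is `m`-colorable. -/
lemma partColorable_sdiff (hmd : 1 < m * d) (hXc : ConnectedSet H X)
    (hE : ¬ Exceptional G H (m + 1) d X) (hS : Optimal G H m X S) :
    PartColorable G H m (X \ S) := by
  by_contra h
  obtain ⟨B, hBX, hB⟩ := exists_critical_subset h
  obtain ⟨w, hw⟩ : B.Nonempty := by
    rw [nonempty_iff_ne_empty]
    rintro rfl
    refine hB.1 ⟨fun _ ↦ ⟨0, hX.m_pos⟩, fun i ↦ hS.1.2.1.mono (by simp)⟩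
  exact hX.not_stage hQ hmd hXc hE (U := ∅) (P := ∅) (S := S) (B := B) (w := w)
    ⟨hS, hB, hBX, hw, by simp, by simp, by simp, by simp, by simp⟩

end Bounded

end Walk

section NoCut

variable {m d : ℕ}

lemma exists_coloring_extending {X S : Finset V} (hS : S ⊆ X) (hf : CopyFree G H S)
    (h : PartColorable G H m (X \ S)) :
    ∃ c : V → Fin (m + 1), (∀ i, CopyFree G H {v ∈ X | c v = i}) ∧ {v ∈ X | c v = 0} = S := by
  obtain ⟨c, hc⟩ := h
  have h0 : ({v ∈ X | (if v ∈ S then 0 else (c v).succ : Fin (m + 1)) = 0} : Finset V) = S := by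
    ext v
    by_cases hv : v ∈ S
    · simp [hv, hS hv]
    · simp [hv, Fin.succ_ne_zero]
  refine ⟨fun v ↦ if v ∈ S then 0 else (c v).succ, fun i ↦ ?_, h0⟩
  induction i using Fin.cases with
  | zero => rwa [h0]
  | succ i =>
    refine (hc i).mono fun v hv ↦ ?_
    by_cases hvS : v ∈ S
    · simp [hvS, (Fin.succ_ne_zero i).symm] at hv
    · simpa [hvS] using hv

variable [Fintype α]

lemma Critical.card_eq_of_one {B : Finset V} (hB : Critical G H 1 B) :
    #B = Fintype.card α := by
  simp only [Critical, partColorable_one] at hB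
  obtain ⟨f, hf, hfB, hadj⟩ := not_not.1 hB.1
  have hsub : univ.image f ⊆ B := by simpa [subset_iff] using hfB
  have : univ.image f = B := by
    by_contra hne
    exact hB.2 _ (hsub.ssubset_of_ne hne) ⟨f, hf, by simp, hadj⟩
  rw [← this, card_image_of_injective _ hf, card_univ]

/-- A connected set inducing a `2`-regular subgraph has no cut vertex. -/
lemma connectedSet_erase_of_two {B : Finset V} (hB : ConnectedSet H B)
    (hdeg : ∀ x ∈ B, #(nbrs H x B) = 2) {v : V} (hv : v ∈ B) : ConnectedSet H (B.erase v) := by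
  intro C hC hne hcl
  by_contra hCB
  have hCB' : C ⊆ B := hC.trans (erase_subset _ _)
  have hvC : v ∉ C := fun h ↦ by simpa using hC h
  have hpos : ∀ D ⊆ B.erase v, D.Nonempty → D ≠ B →
      (∀ x ∈ D, ∀ y ∈ B.erase v, H.Adj x y → y ∈ D) → 1 ≤ #(nbrs H v D) := by
    intro D hD hDne hDB hDcl
    by_contra! h0
    rw [Nat.lt_one_iff, card_eq_zero] at h0
    refine hDB (hB D (hD.trans (erase_subset _ _)) hDne fun x hx y hy hxy ↦ ?_)
    by_cases hyv : y = v
    · subst hyv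
      have : x ∈ nbrs H y D := mem_nbrs.2 ⟨hx, hxy.symm⟩
      simp [h0] at this
    · exact hDcl x hx y (mem_erase.2 ⟨hyv, hy⟩) hxy
  have h1 := hpos C hC hne (fun h ↦ hvC (h ▸ hv)) hcl
  have h2 := hpos (B.erase v \ C) sdiff_subset
    (sdiff_nonempty.2 fun h ↦ hCB (hC.antisymm h))
    (fun h ↦ by
      have : v ∈ B.erase v \ C := h.symm ▸ hv
      simp at this) (fun x hx y hy hxy ↦ by
      rw [mem_sdiff] at hx ⊢
      exact ⟨hy, fun h ↦ hx.2 (hcl y h x hx.1 hxy.symm)⟩)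
  have h3 := card_nbrs_add (H := H) (v := v) hC
  rw [nbrs_erase_self, hdeg v hv] at h3
  have hvC1 : #(nbrs H v C) = 1 := by omega
  obtain ⟨u, hu⟩ := card_eq_one.1 hvC1
  have huC : u ∈ C ∧ H.Adj v u := mem_nbrs.1 (hu ▸ mem_singleton_self u)
  have hdegC : ∀ x ∈ C, #(nbrs H x C) = if x = u then 1 else 2 := by
    intro x hx
    have hx2 := hdeg x (hCB' hx)
    have hxC : nbrs H x C = nbrs H x (B.erase v) :=
      (nbrs_mono x hC).antisymm fun y hy ↦
        mem_nbrs.2 ⟨hcl x hx y (mem_nbrs.1 hy).1 (mem_nbrs.1 hy).2, (mem_nbrs.1 hy).2⟩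
    split_ifs with hxu
    · subst hxu
      have := card_nbrs_erase (H := H) hv huC.2.symm
      rw [hxC]
      omega
    · have hxv : ¬ H.Adj x v := fun h ↦ hxu (by
        have : x ∈ nbrs H v C := mem_nbrs.2 ⟨hx, h.symm⟩
        simpa [hu] using this)
      rw [hxC, ← nbrs_insert_of_not_adj hxv, insert_erase hv, hx2]
  have hsum := (H.induce (C : Set V)).sum_degrees_eq_twice_card_edges
  have hdd : ∀ x : (C : Set V), (H.induce (C : Set V)).degree x = #(nbrs H (x : V) C) := by
    intro x
    rw [← SimpleGraph.card_neighborFinset_eq_degree, ← card_map (Function.Embedding.subtype _)]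
    congr 1
    ext y
    simp
    tauto
  have hsum' : ∑ x ∈ C, #(nbrs H x C) = 2 * #(H.induce (C : Set V)).edgeFinset := by
    rw [← hsum, ← Finset.sum_coe_sort C]
    exact (sum_congr rfl fun x _ ↦ hdd x).symm
  rw [← add_sum_erase C _ huC.1, hdegC u huC.1, if_pos rfl, sum_congr rfl (g := fun _ ↦ 2)
    (fun x hx ↦ by rw [hdegC x (mem_of_mem_erase hx), if_neg (ne_of_mem_erase hx)])] at hsum'
  simp only [sum_const, smul_eq_mul] at hsum'
  omega

lemma noCutOrEqualSize [Nonempty α] (hGc : G.Preconnected) (hG : ∀ a, d ≤ #(nbrs G a univ))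
    (hd : 0 < d) (hm : 0 < m) : NoCutOrEqualSize G H m d := by
  induction m, hm using Nat.le_induction with
  | base => exact Or.inr ⟨_, fun B hB ↦ hB.card_eq_of_one⟩
  | succ m hm ih =>
    refine Or.inl fun B hB hdeg u hu ↦ ?_
    have hBc := hB.connectedSet hGc
    have hX : Bounded G H m d B := ⟨hGc, hG, hd, hm, hdeg⟩
    by_cases hmd : 1 < m * d
    · have hE : Exceptional G H (m + 1) d B := by
        by_contra hE
        obtain ⟨S, hS⟩ := exists_optimal (G := G) (H := H) m B
        obtain ⟨c, hc, -⟩ := exists_coloring_extending hS.1.1 hS.1.2.1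
          (hX.partColorable_sdiff ih hmd hBc hE hS)
        exact hB.1 ⟨c, hc⟩
      exact connectedSet_of_pairwise_adj fun x hx y hy hxy ↦
        hE.2.2.2 x (mem_of_mem_erase hx) y (mem_of_mem_erase hy) hxy
    · have h1 : m * d = 1 := by
        have := Nat.mul_pos hm hd
        omega
      refine connectedSet_erase_of_two hBc (fun x hx ↦ ?_) hu
      have h2 := hB.le_card_nbrs hG hx
      have h3 := hdeg x hx
      obtain rfl := Nat.dvd_one.1 ⟨d, h1.symm⟩
      omega

end NoCut

section Final

/-- A nonempty connected set inducing a `1`-regular subgraph has two elements. -/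
lemma ConnectedSet.card_eq_two {B : Finset V} (hB : ConnectedSet H B) (hne : B.Nonempty)
    (hdeg : ∀ x ∈ B, #(nbrs H x B) = 1) : #B = 2 := by
  obtain ⟨v, hv⟩ := hne
  obtain ⟨w, hw⟩ := card_eq_one.1 (hdeg v hv)
  have hvw : w ∈ B ∧ H.Adj v w := mem_nbrs.1 (hw ▸ mem_singleton_self w)
  obtain ⟨v', hv'⟩ := card_eq_one.1 (hdeg w hvw.1)
  have : v ∈ nbrs H w B := mem_nbrs.2 ⟨hv, hvw.2.symm⟩
  obtain rfl : v = v' := by simpa [hv'] using this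
  rw [← hB {v, w} (by simp [insert_subset_iff, hv, hvw.1]) (by simp), card_pair hvw.2.ne]
  intro x hx y hy hxy
  have hyx : y ∈ nbrs H x B := mem_nbrs.2 ⟨hy, hxy⟩
  rcases mem_insert.1 hx with rfl | hx
  · simp_all
  · rw [mem_singleton] at hx
    subst hx
    simp_all

lemma adj_of_card_eq_two [Fintype α] (hα : Fintype.card α = 2) (hG : ∀ a, ∃ b, G.Adj a b)
    {x y : α} (hxy : x ≠ y) : G.Adj x y := by
  obtain ⟨b, hb⟩ := hG x
  have h : ({x, b} : Finset α) = univ := by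
    rw [← card_eq_iff_eq_univ, card_pair hb.ne, hα]
  have hy : y ∈ ({x, b} : Finset α) := h ▸ mem_univ y
  obtain rfl : y = b := by simpa [hxy.symm] using hy
  exact hb

lemma nonempty_iso_top [Fintype α] {n : ℕ} (hα : Fintype.card α = n)
    (hG : ∀ x y, x ≠ y → G.Adj x y) : Nonempty (G ≃g (⊤ : SimpleGraph (Fin n))) :=
  ⟨⟨Fintype.equivFinOfCardEq hα, by
    simp only [SimpleGraph.top_adj, ne_eq, EmbeddingLike.apply_eq_iff_eq]
    exact ⟨hG _ _, SimpleGraph.Adj.ne⟩⟩⟩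

variable [Fintype V]

lemma not_hasCopy_induce_iff {T : Set V} :
    ¬ HasCopy G (H.induce T) ↔ CopyFree G H T.toFinset := by
  refine not_congr ⟨?_, ?_⟩
  · rintro ⟨f, hf⟩
    exact ⟨fun a ↦ f a, Subtype.val_injective.comp hf, fun a ↦ by simp,
      fun a b h ↦ f.map_adj h⟩
  · rintro ⟨f, hf, hT, hadj⟩
    exact ⟨⟨fun a ↦ ⟨f a, Set.mem_toFinset.1 (hT a)⟩, fun h ↦ hadj _ _ h⟩,
      fun a b h ↦ hf (congrArg Subtype.val h)⟩

lemma card_nbrs_univ (v : V) [Fintype (H.neighborSet v)] : #(nbrs H v univ) = H.degree v := by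
  rw [← SimpleGraph.card_neighborFinset_eq_degree]
  congr 1
  ext
  simp

/-- A graph of minimum degree at least `D` embedded in a connected graph of maximum degree at most
`D` is the whole graph and is regular. -/
lemma regular_and_iso_of_injective [Fintype α] [Nonempty α] {D : ℕ}
    (hG : ∀ a, D ≤ #(nbrs G a univ)) (hH : H.Connected) (hD : ∀ v, #(nbrs H v univ) ≤ D)
    {f : α → V} (hf : Function.Injective f) (hadj : ∀ a b, G.Adj a b → H.Adj (f a) (f b)) :
    (∀ a, #(nbrs G a univ) = D) ∧ Nonempty (H ≃g G) := by
  have hsub (a) : (nbrs G a univ).image f ⊆ nbrs H (f a) univ := by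
    simp only [image_subset_iff, mem_nbrs, mem_univ, true_and]
    exact fun b ↦ hadj a b
  have hle (a) := card_le_card (hsub a)
  simp only [card_image_of_injective _ hf] at hle
  have heq (a) : (nbrs G a univ).image f = nbrs H (f a) univ :=
    eq_of_subset_of_card_le (hsub a) (by
      rw [card_image_of_injective _ hf]
      exact (hD _).trans (hG a))
  have hnbr (a) (y) (h : H.Adj (f a) y) : ∃ b, G.Adj a b ∧ f b = y := by
    have : y ∈ (nbrs G a univ).image f := by simp [heq, h]
    simpa using this
  have hsurj : Function.Surjective f := by
    have := connectedSet_univ hH (univ.image f) (subset_univ _) (univ_nonempty.image f) (by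
      simp only [mem_image, mem_univ, true_and]
      rintro _ ⟨a, rfl⟩ y - h
      obtain ⟨b, -, hb⟩ := hnbr a y h
      exact ⟨b, hb⟩)
    intro y
    have hy : y ∈ univ.image f := this ▸ mem_univ y
    simpa using hy
  refine ⟨fun a ↦ le_antisymm ((hle a).trans (hD _)) (hG a), ⟨RelIso.symm
    { toEquiv := Equiv.ofBijective f ⟨hf, hsurj⟩, map_rel_iff' := ?_ }⟩⟩
  intro a b
  refine ⟨fun h ↦ ?_, hadj a b⟩
  obtain ⟨c, hc, hcb⟩ := hnbr a _ h
  rwa [← hf hcb]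

lemma colorable_two_of_not_isOddCycle (hH : H.Connected) (hD : ∀ v, #(nbrs H v univ) ≤ 2)
    (hodd : ¬ IsOddCycle H) : H.Colorable 2 := by
  by_cases hac : H.IsAcyclic
  · exact hac.colorable_two
  rw [SimpleGraph.isAcyclic_iff_free_cycleGraph] at hac
  push Not at hac
  obtain ⟨n, hn, ⟨f⟩⟩ := hac
  obtain ⟨n, rfl⟩ := Nat.exists_eq_add_of_le' hn
  obtain ⟨-, ⟨e⟩⟩ := regular_and_iso_of_injective (G := cycleGraph (n + 3)) (f := f)
    (fun a ↦ by rw [card_nbrs_univ, cycleGraph_degree_three_le]) hH hD f.injective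
    (fun a b h ↦ f.toHom.map_adj h)
  have heven : Even (n + 3) := by
    rw [← Nat.not_odd_iff_even]
    exact fun h ↦ hodd ⟨_, h, hn, ⟨e⟩⟩
  have c : H.Coloring Bool := (cycleGraph.bicoloring_of_even _ heven).comp e.toHom
  simpa using c.colorable

/-- A connected graph of maximum degree at most `2` on `n` vertices has no independent set with
more than `(n + 1) / 2` vertices. -/
lemma two_mul_card_le_of_independent (hH : H.Connected) (hD : ∀ v, #(nbrs H v univ) ≤ 2)
    {T : Finset V} (hT : ∀ x ∈ T, ∀ y ∈ T, ¬ H.Adj x y) : 2 * #T ≤ Fintype.card V + 1 := by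
  have h1 := hH.card_vert_le_card_edgeSet_add_one
  rw [Nat.card_eq_fintype_card, Nat.card_eq_fintype_card, ← SimpleGraph.edgeFinset_card] at h1
  have h2 : H.edgeFinset ⊆ Tᶜ.biUnion fun v ↦ H.incidenceFinset v := by
    intro e he
    induction e with
    | _ x y =>
      rw [SimpleGraph.mem_edgeFinset, SimpleGraph.mem_edgeSet] at he
      simp only [mem_biUnion, mem_compl, SimpleGraph.mem_incidenceFinset,
        SimpleGraph.mk'_mem_incidenceSet_iff]
      by_cases hx : x ∈ T
      · exact ⟨y, fun hy ↦ hT x hx y hy he, he, Or.inr rfl⟩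
      · exact ⟨x, hx, he, Or.inl rfl⟩
  have h3 := (card_le_card h2).trans (card_biUnion_le_card_mul _ _ 2 fun v _ ↦ by
    rw [SimpleGraph.card_incidenceFinset_eq_degree, ← card_nbrs_univ]
    exact hD v)
  have h4 := card_add_card_compl T
  omega

variable [Fintype α] {d k : ℕ}

lemma exists_coloring_of_card_eq_two (hG : ∃ a b, G.Adj a b) (hα : Fintype.card α = 2)
    (hH : H.Connected) (hD : ∀ v, #(nbrs H v univ) ≤ 2) (hodd : ¬ IsOddCycle H) :
    ∃ c : V → Fin 2, (∀ i, CopyFree G H {v | c v = i}) ∧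
      ∃ i, ∀ T, CopyFree G H T → #T ≤ #{v | c v = i} := by
  obtain ⟨c⟩ := colorable_two_of_not_isOddCycle hH hD hodd
  obtain ⟨a, b, hab⟩ := hG
  refine ⟨c, fun i ⟨f, hf, hfi, hadj⟩ ↦ ?_, ?_⟩
  · have h := fun x ↦ (mem_filter.1 (hfi x)).2
    exact c.valid (hadj a b hab) ((h a).trans (h b).symm)
  obtain ⟨i, -, hi⟩ := exists_max_image univ (fun i : Fin 2 ↦ #{v | c v = i}) univ_nonempty
  refine ⟨i, fun T hT ↦ ?_⟩
  have h1 : Fintype.card V ≤ 2 * #{v | c v = i} := by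
    rw [← card_univ, card_eq_sum_card_fiberwise (f := c) (t := univ)
      fun _ _ ↦ mem_coe.2 (mem_univ _)]
    simpa using sum_le_card_nsmul univ _ _ hi
  have h2 : 2 * #T ≤ Fintype.card V + 1 := by
    refine two_mul_card_le_of_independent hH hD fun x hx y hy hxy ↦ hT ?_
    let e := Fintype.equivFinOfCardEq hα
    have hxy' : ∀ i j : Fin 2, i ≠ j → H.Adj (![x, y] i) (![x, y] j) := by
      simp [Fin.forall_fin_two, hxy, hxy.symm]
    refine ⟨fun z ↦ ![x, y] (e z), fun p q hpq ↦ ?_, fun z ↦ ?_, fun p q hpq ↦ ?_⟩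
    · by_contra hne
      exact (hxy' _ _ (e.injective.ne hne)).ne hpq
    · have hxyT : ∀ j : Fin 2, ![x, y] j ∈ T := by simp [Fin.forall_fin_two, hx, hy]
      exact hxyT _
    · exact hxy' _ _ (e.injective.ne hpq.ne)
  omega

/-- The main theorem for `Finset`-valued classes, with degree bounds as hypotheses. -/
theorem exists_coloring_with_maximum_class (hGc : G.Connected)
    (hG : ∀ a, d ≤ #(nbrs G a univ)) (hd : 0 < d) (hk : 0 < k) (hH : H.Connected)
    (hD : ∀ v, #(nbrs H v univ) ≤ k * d)
    (hreg : (∃ r, ∀ a, #(nbrs G a univ) = r) → ¬ Nonempty (H ≃g G))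
    (hE : ¬ Exceptional G H k d univ) (hodd : Fintype.card α = 2 → ¬ IsOddCycle H) :
    ∃ c : V → Fin k, (∀ i, CopyFree G H {v | c v = i}) ∧
      ∃ i, ∀ T, CopyFree G H T → #T ≤ #{v | c v = i} := by
  have := hGc.nonempty
  obtain ⟨m, rfl⟩ := Nat.exists_eq_succ_of_ne_zero hk.ne'
  rcases Nat.eq_zero_or_pos m with rfl | hm
  · refine ⟨fun _ ↦ 0, fun i ⟨f, hf, _, hadj⟩ ↦ ?_, 0, fun T _ ↦ card_le_card (by simp)⟩
    obtain ⟨h1, h2⟩ := regular_and_iso_of_injective hG hH (by simpa using hD) hf hadj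
    exact hreg ⟨_, h1⟩ h2
  have hX : Bounded G H m d univ := ⟨hGc.preconnected, hG, hd, hm, fun v _ ↦ hD v⟩
  have key (S : Finset V) (hS : IsMaxFree G H univ S) (h : PartColorable G H m (univ \ S)) :
      ∃ c : V → Fin (m + 1), (∀ i, CopyFree G H {v | c v = i}) ∧
        ∃ i, ∀ T, CopyFree G H T → #T ≤ #{v | c v = i} := by
    obtain ⟨c, hc, h0⟩ := exists_coloring_extending hS.1 hS.2.1 h
    exact ⟨c, hc, 0, fun T hT ↦ h0 ▸ hS.2.2 T (subset_univ _) hT⟩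
  by_cases hmd : 1 < m * d
  · obtain ⟨S, hS⟩ := exists_optimal (G := G) (H := H) m univ
    exact key S hS.1 (hX.partColorable_sdiff (noCutOrEqualSize hGc.preconnected hG hd hm) hmd
      (connectedSet_univ hH) hE hS)
  obtain rfl : m = 1 := Nat.dvd_one.1 ⟨d, by have := Nat.mul_pos hm hd; omega⟩
  obtain rfl : d = 1 := by omega
  by_cases hα : Fintype.card α = 2
  · obtain ⟨a⟩ := hGc.nonempty
    obtain ⟨b, hb⟩ := card_pos.1 (hG a)
    exact exists_coloring_of_card_eq_two ⟨a, b, (mem_nbrs.1 hb).2⟩ hα hH (by simpa using hD)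
      (hodd hα)
  · obtain ⟨S, hS⟩ := exists_isMaxFree (G := G) (H := H) univ
    refine key S hS ?_
    by_contra h
    obtain ⟨B, hBX, hB⟩ := exists_critical_subset h
    refine hα (hB.card_eq_of_one ▸ (hB.connectedSet hGc.preconnected).card_eq_two ?_
      fun x hx ↦ by simpa using (hX.card_nbrs_critical hS hB hBX hx).1)
    exact card_pos.1 (hB.card_eq_of_one ▸ Fintype.card_pos)

end Final

end GFreeColoring

/-- **Corollary 2.**  Let `G` be connected with `δ(G) ≥ 1` and `H` connected with
`Δ(H) ≥ 1`, and set `k = ⌈Δ(H)/δ(G)⌉`.  Assume (i) if `G` is regular then `H ≇ G`;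
(ii) if `G ≅ K_{δ(G)+1}` then `H ≇ K_{k·δ(G)+1}`; (iii) if `G ≅ K₂` then `H` is neither
an odd cycle nor a complete graph.  Then `H` has a `G`-free `k`-coloring one of whose
colour classes is a maximum `G`-free subset of `V(H)`. -/
theorem gfree_coloring_with_maximum_class
    {α : Type*} [Fintype α] (G : SimpleGraph α) [DecidableRel G.Adj]
    {V : Type*} [Fintype V] (H : SimpleGraph V) [DecidableRel H.Adj]
    (hGconn : G.Connected) (hδ : 1 ≤ G.minDegree)
    (hHconn : H.Connected) (hΔ : 1 ≤ H.maxDegree)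
    (h1 : (∃ r, G.IsRegularOfDegree r) → ¬ Nonempty (H ≃g G))
    (h2 : Nonempty (G ≃g (⊤ : SimpleGraph (Fin (G.minDegree + 1)))) →
      ¬ Nonempty (H ≃g (⊤ : SimpleGraph
        (Fin ((H.maxDegree ⌈/⌉ G.minDegree) * G.minDegree + 1)))))
    (h3 : Nonempty (G ≃g (⊤ : SimpleGraph (Fin 2))) →
      ¬ IsOddCycle H ∧ ¬ ∃ n : ℕ, Nonempty (H ≃g (⊤ : SimpleGraph (Fin n)))) :
    ∃ c : V → Fin (H.maxDegree ⌈/⌉ G.minDegree),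
      (∀ i, ¬ HasCopy G (H.induce {v | c v = i})) ∧
      (∃ i, ∀ T : Set V, ¬ HasCopy G (H.induce T) →
        T.ncard ≤ {v | c v = i}.ncard) := by
  classical
  have hδ0 : 0 < G.minDegree := hδ
  have hle : H.maxDegree ≤ (H.maxDegree ⌈/⌉ G.minDegree) * G.minDegree := by
    rw [mul_comm]
    exact le_smul_ceilDiv hδ0
  have hk : 0 < H.maxDegree ⌈/⌉ G.minDegree :=
    Nat.pos_of_mul_pos_right (lt_of_lt_of_le hΔ hle)
  obtain ⟨c, hc, i, hi⟩ := GFreeColoring.exists_coloring_with_maximum_class (G := G) (H := H)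
    (k := H.maxDegree ⌈/⌉ G.minDegree) hGconn
    (fun a ↦ by rw [GFreeColoring.card_nbrs_univ]; exact G.minDegree_le_degree a) hδ0 hk hHconn
    (fun v ↦ by rw [GFreeColoring.card_nbrs_univ]; exact (H.degree_le_maxDegree v).trans hle)
    (fun ⟨r, hr⟩ ↦ h1 ⟨r, fun a ↦ by rw [← hr a, GFreeColoring.card_nbrs_univ]⟩)
    (fun ⟨hα, hG, hV, hH⟩ ↦ h2
      (GFreeColoring.nonempty_iso_top hα fun x y hxy ↦ by rwa [hG])
      (GFreeColoring.nonempty_iso_top hV fun x y hxy ↦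
        hH x (Finset.mem_univ x) y (Finset.mem_univ y) hxy))
    (fun hα ↦ (h3 (GFreeColoring.nonempty_iso_top hα fun x y hxy ↦
      GFreeColoring.adj_of_card_eq_two hα (fun a ↦ (G.degree_pos_iff_exists_adj a).1
        (hδ0.trans_le (G.minDegree_le_degree a))) hxy)).1)
  refine ⟨c, fun i ↦ ?_, i, fun T hT ↦ ?_⟩
  · rw [GFreeColoring.not_hasCopy_induce_iff]
    convert hc i using 1
    ext; simp
  · rw [GFreeColoring.not_hasCopy_induce_iff] at hT
    have := hi _ hT
    rw [Set.ncard_eq_toFinset_card', Set.ncard_eq_toFinset_card']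
    convert this using 2
    ext; simp
end

section
/- Let G be a connected finite simple graph with minimum degree δ(G) ≥ 1 and let H be a connected finite simple graph with maximum degree Δ(H) ≥ 1. Assume: (i) if G is regular, then H is not isomorphic to G; (ii) if G is isomorphic to K_{δ(G)+1}, then H is not isomorphic to K_{k·δ(G)+1} where k = ⌈Δ(H)/δ(G)⌉; (iii) if G is isomorphic to K_2, then H is neither an odd cycle nor a complete graph. Then the G-free chromatic number of H satisfies χ_G(H) ≤ ⌈Δ(H)/δ(G)⌉. -/
open SimpleGraph

/-- The `G`-free chromatic number of `H`: the least `k` such that `V(H)` can be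
partitioned into `k` sets each inducing a `G`-free subgraph. -/
noncomputable def gFreeChromaticNumber {α V : Type*} (G : SimpleGraph α)
    (H : SimpleGraph V) : ℕ :=
  sInf {k : ℕ | ∃ c : V → Fin k, ∀ i, ¬ HasCopy G (H.induce {v | c v = i})}

section Link

variable {V : Type*} {H : SimpleGraph V}

/-- There is a walk from `a` to `b` avoiding `x` whose only vertices adjacent to `x` can be its
ends. -/
def IsLinked (H : SimpleGraph V) (x a b : V) : Prop :=
  ∃ p : H.Walk a b, ∀ v ∈ p.support, v ≠ x ∧ (H.Adj x v → v = a ∨ v = b)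

theorem IsLinked.symm {x a b : V} (h : IsLinked H x a b) : IsLinked H x b a := by
  obtain ⟨p, hp⟩ := h
  exact ⟨p.reverse, fun v hv ↦ by have := hp v (by simpa using hv); tauto⟩

theorem IsLinked.exists_isPath [DecidableEq V] {x a b : V} (h : IsLinked H x a b) :
    ∃ p : H.Walk a b, p.IsPath ∧ ∀ v ∈ p.support, v ≠ x ∧ (H.Adj x v → v = a ∨ v = b) := by
  obtain ⟨p, hp⟩ := h
  exact ⟨p.bypass, p.bypass_isPath, fun v hv ↦ hp v (p.support_bypass_subset_support hv)⟩

theorem mem_of_forall_isLinked {x : V} (hx : (H.induce {x}ᶜ).Preconnected) {U : Set V} {a : V}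
    (ha : a ∈ U) (hxa : H.Adj x a)
    (hU : ∀ u ∈ U, ∀ v, H.Adj x v → IsLinked H x u v → v ∈ U) {b : V} (hxb : H.Adj x b) :
    b ∈ U := by
  have key : ∀ (u v : ({x}ᶜ : Set V)) (p : (H.induce {x}ᶜ).Walk u v) (s : V), s ∈ U →
      IsLinked H x s u → H.Adj x v → (v : V) ∈ U := by
    intro u v p
    induction p with
    | nil => exact fun s hs hsu hv ↦ hU s hs _ hv hsu
    | @cons u w v huw p ih =>
      intro s hs hsu hv
      have huw' : H.Adj u w := huw
      by_cases hu : H.Adj x u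
      · refine ih u (hU s hs _ hu hsu) ⟨huw'.toWalk, fun t ht ↦ ?_⟩ hv
        have : t = u ∨ t = w := by simpa using ht
        refine ⟨?_, fun _ ↦ this⟩
        rcases this with rfl | rfl
        · exact u.2
        · exact w.2
      · obtain ⟨q, hq⟩ := hsu
        refine ih s hs ⟨q.concat huw', fun t ht ↦ ?_⟩ hv
        rw [Walk.support_concat, List.mem_append, List.mem_singleton] at ht
        rcases ht with ht | rfl
        · refine ⟨(hq t ht).1, fun hxt ↦ .inl (((hq t ht).2 hxt).resolve_right ?_)⟩
          rintro rfl
          exact hu hxt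
        · exact ⟨w.2, fun _ ↦ .inr rfl⟩
  obtain ⟨p⟩ := hx ⟨a, hxa.ne'⟩ ⟨b, hxb.ne'⟩
  refine key _ _ p a ha ⟨Walk.nil, fun t ht ↦ ?_⟩ hxb
  have : t = a := by simpa using ht
  subst this
  exact ⟨hxa.ne', fun _ ↦ .inl rfl⟩

theorem SimpleGraph.Walk.formPerm_support_apply [DecidableEq V] {a b : V} (p : H.Walk a b) :
    p.support.formPerm b = a := by
  cases p with
  | nil => simp
  | cons h p =>
    have := List.formPerm_apply_getLast a p.support
    rwa [List.getLast_cons p.support_ne_nil, Walk.getLast_support] at this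

end Link

section DegenerateColoring

variable {V : Type*} [Fintype V] [DecidableEq V] {H : SimpleGraph V} [DecidableRel H.Adj]
  {k d : ℕ}

/-- Each colour class of `c` restricted to `S` induces a graph all of whose nonempty subgraphs
have a vertex of degree less than `d`. -/
def IsDegenerateColoring {ι : Type*} (H : SimpleGraph V) [DecidableRel H.Adj] (d : ℕ)
    (c : V → ι) (S : Finset V) : Prop :=
  ∀ i, ∀ T ⊆ S, T.Nonempty → (∀ u ∈ T, c u = i) → ∃ v ∈ T, (H.neighborFinset v ∩ T).card < d

theorem IsDegenerateColoring.extend {ι : Type*} [DecidableEq ι] {c c' : V → ι} {S : Finset V} {v : V}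
    (hc : IsDegenerateColoring H d c S) (hcc' : ∀ u ∈ S, u ≠ v → c' u = c u)
    (hv : {u ∈ H.neighborFinset v ∩ S | c u = c' v}.card < d) :
    IsDegenerateColoring H d c' (insert v S) := by
  intro i T hTS hT hTi
  by_cases hvT : v ∈ T
  · refine ⟨v, hvT, (Finset.card_le_card ?_).trans_lt hv⟩
    intro u hu
    have hu' := Finset.mem_inter.1 hu
    have huv : u ≠ v := by
      rintro rfl
      simp at hu'
    have huS : u ∈ S := (Finset.mem_insert.1 (hTS hu'.2)).resolve_left huv
    simp only [Finset.mem_filter, Finset.mem_inter]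
    exact ⟨⟨hu'.1, huS⟩, by rw [← hcc' u huS huv, hTi u hu'.2, hTi v hvT]⟩
  · have hTS' : T ⊆ S := (Finset.subset_insert_iff_of_notMem hvT).1 hTS
    exact hc i T hTS' hT fun u hu ↦ by
      rw [← hcc' u (hTS' hu) (by rintro rfl; exact hvT hu), hTi u hu]

theorem IsDegenerateColoring.exists_extend {c : V → Fin k} {S : Finset V} {v : V}
    (hc : IsDegenerateColoring H d c S) (hv : (H.neighborFinset v ∩ S).card < k * d) :
    ∃ c' : V → Fin k, IsDegenerateColoring H d c' (insert v S) := by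
  obtain ⟨i, -, hi⟩ := Finset.exists_card_fiber_lt_of_card_lt_mul (s := H.neighborFinset v ∩ S)
    (t := (Finset.univ : Finset (Fin k))) (f := c) (n := d) (by simpa using hv)
  exact ⟨Function.update c v i, hc.extend (fun u _ hu ↦ by simp [hu]) (by simpa using hi)⟩

theorem IsDegenerateColoring.mono {ι : Type*} {c : V → ι} {S S' : Finset V}
    (hc : IsDegenerateColoring H d c S) (h : S' ⊆ S) : IsDegenerateColoring H d c S' :=
  fun i T hT ↦ hc i T (hT.trans h)

theorem exists_isDegenerateColoring_of_notMem (hH : H.Connected) (hdeg : ∀ v, H.degree v ≤ k * d)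
    (hk : 0 < k) (x : V) (S : Finset V) (hx : x ∉ S) :
    ∃ c : V → Fin k, IsDegenerateColoring H d c S := by
  induction S using Finset.strongInduction with
  | H S ih =>
    obtain rfl | ⟨s, hs⟩ := S.eq_empty_or_nonempty
    · exact ⟨fun _ ↦ ⟨0, hk⟩, fun i T hT hne ↦ by simp_all⟩
    obtain ⟨p⟩ := hH.preconnected s x
    obtain ⟨⟨⟨v, w⟩, hvw⟩, -, hv, hw⟩ := p.exists_boundary_dart (S : Set V) hs hx
    simp only [Finset.mem_coe] at hv hw hvw
    obtain ⟨c, hc⟩ := ih (S.erase v) (Finset.erase_ssubset hv) (by simp [hx])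
    have := hc.exists_extend (v := v) ?_
    · rwa [Finset.insert_erase hv] at this
    · refine lt_of_lt_of_le (Finset.card_lt_card ?_) (hdeg v)
      refine ⟨Finset.inter_subset_left, fun h ↦ hw ?_⟩
      have := @h w (by simpa using hvw)
      simp at this
      tauto

theorem degree_eq_of_forall_not_isDegenerateColoring (hH : H.Connected)
    (hdeg : ∀ v, H.degree v ≤ k * d) (hk : 0 < k)
    (hno : ∀ c : V → Fin k, ¬ IsDegenerateColoring H d c Finset.univ) (x : V) :
    H.degree x = k * d := by
  refine (hdeg x).antisymm (le_of_not_gt fun hlt ↦ ?_)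
  obtain ⟨c, hc⟩ := exists_isDegenerateColoring_of_notMem hH hdeg hk x (Finset.univ.erase x) (by simp)
  obtain ⟨c', hc'⟩ := hc.exists_extend (v := x)
    ((Finset.card_le_card Finset.inter_subset_left).trans_lt hlt)
  rw [Finset.insert_erase (Finset.mem_univ x)] at hc'
  exact hno c' hc'

/-- `c` is a degenerate colouring of all vertices but `x`. -/
abbrev IsHoleColoring {ι : Type*} (H : SimpleGraph V) [DecidableRel H.Adj] (d : ℕ)
    (c : V → ι) (x : V) : Prop :=
  IsDegenerateColoring H d c (Finset.univ.erase x)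

theorem IsHoleColoring.card_filter_eq (hdeg : ∀ v, H.degree v ≤ k * d)
    (hno : ∀ c : V → Fin k, ¬ IsDegenerateColoring H d c Finset.univ) {c : V → Fin k} {x : V}
    (hc : IsHoleColoring H d c x) (i : Fin k) :
    {u ∈ H.neighborFinset x | c u = i}.card = d := by
  have hle : ∀ j ∈ Finset.univ, d ≤ {u ∈ H.neighborFinset x | c u = j}.card := by
    intro j _
    by_contra! hlt
    refine hno (Function.update c x j) ?_
    rw [← Finset.insert_erase (Finset.mem_univ x)]
    refine hc.extend (fun u _ hu ↦ by simp [hu]) (lt_of_le_of_lt (Finset.card_le_card ?_) hlt)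
    intro u
    simp only [Finset.mem_filter, Finset.mem_inter, Function.update_self]
    tauto
  have hsum := Finset.card_eq_sum_card_fiberwise (f := c) (s := H.neighborFinset x)
    (t := Finset.univ) (by simp)
  have heq := (Finset.sum_eq_sum_iff_of_le hle).1
    ((Finset.sum_le_sum hle).antisymm ?_)
  · exact (heq i (Finset.mem_univ i)).symm
  · rw [← hsum, card_neighborFinset_eq_degree]
    simpa using hdeg x

theorem IsHoleColoring.move (hdeg : ∀ v, H.degree v ≤ k * d)
    (hno : ∀ c : V → Fin k, ¬ IsDegenerateColoring H d c Finset.univ) {c : V → Fin k} {x y : V}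
    (hc : IsHoleColoring H d c x) (hxy : H.Adj x y) :
    IsHoleColoring H d (c ∘ Equiv.swap x y) y := by
  have hS : Finset.univ.erase y = insert x ((Finset.univ.erase x).erase y) := by
    ext u
    simp only [Finset.mem_erase, Finset.mem_univ, Finset.mem_insert]
    have := hxy.ne
    grind
  rw [IsHoleColoring, hS]
  refine (hc.mono (Finset.erase_subset _ _)).extend (fun u hu hux ↦ ?_) ?_
  · simp only [Finset.mem_erase] at hu
    simp [Equiv.swap_apply_of_ne_of_ne hux hu.1]
  · rw [← hc.card_filter_eq hdeg hno (c y)]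
    refine Finset.card_lt_card (Finset.ssubset_iff_of_subset ?_ |>.2 ⟨y, ?_, ?_⟩)
    · intro u
      simp
      tauto
    · simpa using hxy
    · simp

theorem IsHoleColoring.formPerm_cons (hdeg : ∀ v, H.degree v ≤ k * d)
    (hno : ∀ c : V → Fin k, ¬ IsDegenerateColoring H d c Finset.univ) {x : V} (l : List V)
    {c : V → Fin k} (hc : IsHoleColoring H d c x) (hl : (x :: l).IsChain H.Adj) :
    IsHoleColoring H d (c ∘ (x :: l).formPerm) ((x :: l).getLast (by simp)) := by
  induction l generalizing x c with
  | nil => simpa using hc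
  | cons y l ih =>
    rw [List.isChain_cons_cons] at hl
    have := ih (hc.move hdeg hno hl.1) hl.2
    rwa [List.getLast_cons (by simp), List.formPerm_cons_cons, Equiv.Perm.coe_mul,
      ← Function.comp_assoc]

/-- Moving the hole once around a cycle `x, v₁, …, vₘ` rotates the colours of `v₁, …, vₘ`. -/
theorem IsHoleColoring.rotate (hdeg : ∀ v, H.degree v ≤ k * d)
    (hno : ∀ c : V → Fin k, ¬ IsDegenerateColoring H d c Finset.univ) {x : V} {l : List V}
    {c : V → Fin k} (hc : IsHoleColoring H d c x) (hne : l ≠ []) (hl : l.IsChain H.Adj)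
    (hxl : x ∉ l) (hhead : H.Adj x (l.head hne)) (hlast : H.Adj x (l.getLast hne)) :
    IsHoleColoring H d (c ∘ l.formPerm) x := by
  obtain ⟨v, l, rfl⟩ := List.exists_cons_of_ne_nil hne
  have hchain : (x :: v :: l).IsChain H.Adj := List.isChain_cons_cons.2 ⟨hhead, hl⟩
  have h := (hc.formPerm_cons hdeg hno _ hchain).move hdeg hno
    (y := x) (by rw [List.getLast_cons (by simp)]; exact hlast.symm)
  convert h using 1
  rw [Function.comp_assoc, ← Equiv.Perm.coe_mul, List.getLast_cons (by simp),
    List.formPerm_cons_cons, mul_assoc, Equiv.mul_swap_eq_swap_mul, List.formPerm_apply_getLast,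
    List.formPerm_apply_of_notMem hxl, Equiv.swap_comm v x, Equiv.swap_mul_self_mul]

/-- Rotating the colours along a link of `a` and `b` swaps the colours of `a` and `b` and changes
no other colour around the hole; hence the second vertex of the link has the colour of `b`. -/
theorem IsHoleColoring.rotate_link (hdeg : ∀ v, H.degree v ≤ k * d)
    (hno : ∀ c : V → Fin k, ¬ IsDegenerateColoring H d c Finset.univ) {x a w b : V}
    {c : V → Fin k} (hc : IsHoleColoring H d c x) (haw : H.Adj a w) (p : H.Walk w b)
    (hp : (Walk.cons haw p).IsPath) (hxa : H.Adj x a) (hxb : H.Adj x b)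
    (hlink : ∀ v ∈ (Walk.cons haw p).support, v ≠ x ∧ (H.Adj x v → v = a ∨ v = b)) :
    IsHoleColoring H d (c ∘ (Walk.cons haw p).support.formPerm) x ∧
      (∀ u, H.Adj x u → (c ∘ (Walk.cons haw p).support.formPerm) u = c (Equiv.swap a b u)) ∧
      c w = c b := by
  set π := (Walk.cons haw p).support.formPerm with hπ
  have hab : a ≠ b := by
    rintro rfl
    simp at hp
  have hrot : IsHoleColoring H d (c ∘ π) x := by
    refine hc.rotate hdeg hno (Walk.support_ne_nil _) (Walk.isChain_adj_support _)
      (fun h ↦ (hlink x h).1 rfl) ?_ ?_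
    · simpa using hxa
    · simpa using hxb
  have hπa : π a = w := by
    have hnd := hp.support_nodup
    rw [hπ, Walk.support_cons]
    rw [Walk.support_cons] at hnd
    rw [← p.cons_tail_support] at hnd ⊢
    exact List.formPerm_apply_head _ _ _ hnd
  have hπb : π b = a := by rw [hπ, Walk.formPerm_support_apply]
  have hπu : ∀ u, H.Adj x u → u ≠ a → u ≠ b → π u = u := by
    intro u hu hua hub
    refine List.formPerm_apply_of_notMem fun h ↦ ?_
    have := (hlink u h).2 hu
    tauto
  have hcw : c w = c b := by
    by_contra hne
    have h1 := hc.card_filter_eq hdeg hno (c b)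
    have h2 := hrot.card_filter_eq hdeg hno (c b)
    have hsub : {u ∈ H.neighborFinset x | (c ∘ π) u = c b} ⊆
        {u ∈ H.neighborFinset x | c u = c b} := by
      intro u
      simp only [Finset.mem_filter, mem_neighborFinset, Function.comp]
      rintro ⟨hxu, hu⟩
      refine ⟨hxu, ?_⟩
      by_cases hua : u = a
      · subst hua; rw [hπa] at hu; exact absurd hu hne
      by_cases hub : u = b
      · rw [hub]
      · rwa [hπu u hxu hua hub] at hu
    have heq := Finset.eq_of_subset_of_card_le hsub (by rw [h1, h2])
    have hb : b ∈ ({u ∈ H.neighborFinset x | (c ∘ π) u = c b} : Finset V) := by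
      rw [heq]; simpa using hxb
    have hca : c a = c b := by simpa [hπb, hxb] using hb
    have ha : a ∈ ({u ∈ H.neighborFinset x | (c ∘ π) u = c b} : Finset V) := by
      rw [heq]; simpa [hxa] using hca
    exact hne (by simpa [hπa, hxa] using ha)
  refine ⟨hrot, fun u hu ↦ ?_, hcw⟩
  by_cases hua : u = a
  · subst hua; simpa [hπa] using hcw
  by_cases hub : u = b
  · subst hub; simp [hπb]
  · simp [hπu u hu hua hub, Equiv.swap_apply_of_ne_of_ne hua hub]

theorem IsHoleColoring.exists_swap_of_isLinked (hdeg : ∀ v, H.degree v ≤ k * d)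
    (hno : ∀ c : V → Fin k, ¬ IsDegenerateColoring H d c Finset.univ) {x a b : V}
    {c : V → Fin k} (hc : IsHoleColoring H d c x) (hxa : H.Adj x a) (hxb : H.Adj x b)
    (hab : IsLinked H x a b) :
    ∃ c' : V → Fin k, IsHoleColoring H d c' x ∧ ∀ u, H.Adj x u → c' u = c (Equiv.swap a b u) := by
  obtain ⟨p, hp, hlink⟩ := hab.exists_isPath
  cases p with
  | nil => exact ⟨c, hc, by simp⟩
  | cons haw p =>
    obtain ⟨h1, h2, -⟩ := hc.rotate_link hdeg hno haw p hp hxa hxb hlink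
    exact ⟨_, h1, h2⟩

theorem IsHoleColoring.exists_swap (hdeg : ∀ v, H.degree v ≤ k * d)
    (hno : ∀ c : V → Fin k, ¬ IsDegenerateColoring H d c Finset.univ) {x a b : V}
    (hx : (H.induce {x}ᶜ).Preconnected) {c : V → Fin k} (hc : IsHoleColoring H d c x)
    (hxa : H.Adj x a) (hxb : H.Adj x b) :
    ∃ c' : V → Fin k, IsHoleColoring H d c' x ∧ ∀ u, H.Adj x u → c' u = c (Equiv.swap a b u) := by
  let U : Set V := {b | H.Adj x b ∧ ∀ c : V → Fin k, IsHoleColoring H d c x →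
    ∃ c' : V → Fin k, IsHoleColoring H d c' x ∧ ∀ u, H.Adj x u → c' u = c (Equiv.swap a b u)}
  have hU : b ∈ U := by
    refine mem_of_forall_isLinked hx (U := U) (a := a) ⟨hxa, fun c hc ↦ ⟨c, hc, by simp⟩⟩ hxa ?_ hxb
    rintro u ⟨hxu, hu⟩ v hxv huv
    refine ⟨hxv, fun c hc ↦ ?_⟩
    by_cases hav : a = v
    · subst hav; exact ⟨c, hc, by simp⟩
    by_cases huv' : u = v
    · subst huv'; exact hu c hc
    obtain ⟨c₁, hc₁, h₁⟩ := hu c hc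
    obtain ⟨c₂, hc₂, h₂⟩ := hc₁.exists_swap_of_isLinked hdeg hno hxu hxv huv
    obtain ⟨c₃, hc₃, h₃⟩ := hu c₂ hc₂
    refine ⟨c₃, hc₃, fun t ht ↦ ?_⟩
    rw [h₃ t ht, h₂ _ (by grind),
      h₁ _ (by grind)]
    congr 1
    grind
  exact hU.2 c hc

theorem IsHoleColoring.exists_apply_ne (hdeg : ∀ v, H.degree v ≤ k * d)
    (hno : ∀ c : V → Fin k, ¬ IsDegenerateColoring H d c Finset.univ) (hk : 2 ≤ k) (hd : 1 ≤ d)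
    {x a b : V} (hx : (H.induce {x}ᶜ).Preconnected) {c : V → Fin k} (hc : IsHoleColoring H d c x)
    (hxa : H.Adj x a) (hxb : H.Adj x b) (hab : a ≠ b) :
    ∃ c' : V → Fin k, IsHoleColoring H d c' x ∧ c' a ≠ c' b := by
  by_cases h : c a = c b
  · have : Nontrivial (Fin k) := Fin.nontrivial_iff_two_le.2 hk
    obtain ⟨i, hi⟩ := exists_ne (c a)
    obtain ⟨e, he⟩ := Finset.card_pos.1 (hd.trans_eq (hc.card_filter_eq hdeg hno i).symm)
    simp only [Finset.mem_filter, mem_neighborFinset] at he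
    obtain ⟨c', hc', hc'u⟩ := hc.exists_swap hdeg hno hx hxa he.1
    have hbe : b ≠ e := by rintro rfl; exact hi (he.2.symm.trans h.symm)
    refine ⟨c', hc', ?_⟩
    rw [hc'u a hxa, hc'u b hxb, Equiv.swap_apply_left,
      Equiv.swap_apply_of_ne_of_ne hab.symm hbe, he.2, ← h]
    exact hi
  · exact ⟨c, hc, h⟩

theorem IsHoleColoring.adj_of_isLinked_of_isLinked (hdeg : ∀ v, H.degree v ≤ k * d)
    (hno : ∀ c : V → Fin k, ¬ IsDegenerateColoring H d c Finset.univ) (hk : 2 ≤ k) (hd : 1 ≤ d)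
    {x a e b : V} (hx : (H.induce {x}ᶜ).Preconnected) {c : V → Fin k} (hc : IsHoleColoring H d c x)
    (hxa : H.Adj x a) (hxe : H.Adj x e) (hxb : H.Adj x b) (hae : a ≠ e) (hab : a ≠ b) (heb : e ≠ b)
    (h₁ : IsLinked H x a e) (h₂ : IsLinked H x e b) : H.Adj e b := by
  by_contra hadj
  obtain ⟨P, hP, hPx⟩ := h₁.exists_isPath
  obtain ⟨Q₀, hQ₀, hQ₀x⟩ := h₂.exists_isPath
  cases Q₀ with
  | nil => exact heb rfl
  | @cons _ q _ heq Q =>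
  have hqb : q ≠ b := by
    rintro rfl
    exact hadj heq
  have hQ := (Walk.cons_isPath_iff heq Q).1 hQ₀
  have hQx : ∀ v ∈ Q.support, v ≠ x ∧ (H.Adj x v → v = b) := by
    intro v hv
    have hve : v ≠ e := by
      rintro rfl
      exact hQ.2 hv
    have := hQ₀x v (by simp [hv])
    tauto
  have hdisj : P.support.Disjoint Q.support := by
    intro m hmP hmQ
    have hmb : m ≠ b := by
      rintro rfl
      have := (hPx m hmP).2 hxb
      tauto
    have hxm : ¬ H.Adj x m := fun h ↦ hmb ((hQx m hmQ).2 h)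
    have hme : m ≠ e := by
      rintro rfl
      exact hxm hxe
    let R := ((Q.takeUntil m hmQ).append (P.takeUntil m hmP).reverse).bypass
    have hR : ∀ v ∈ R.support, v ≠ x ∧ (H.Adj x v → v = a) := by
      intro v hv
      have hv' := Walk.support_bypass_subset_support _ hv
      rw [Walk.mem_support_append_iff, Walk.support_reverse, List.mem_reverse] at hv'
      rcases hv' with hv' | hv'
      · have hvb : v ≠ b := by
          rintro rfl
          exact Walk.endpoint_notMem_support_takeUntil hQ.1 hmQ hmb.symm hv'
        have := hQx v (Walk.support_takeUntil_subset_support _ _ hv')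
        tauto
      · have hve : v ≠ e := by
          rintro rfl
          exact Walk.endpoint_notMem_support_takeUntil hP hmP hme.symm hv'
        have := hPx v (Walk.support_takeUntil_subset_support _ _ hv')
        tauto
    have hcR : (Walk.cons heq R).IsPath :=
      (Walk.cons_isPath_iff _ _).2 ⟨Walk.bypass_isPath _, fun h ↦ hae ((hR e h).2 hxe).symm⟩
    obtain ⟨f, hf, hfab⟩ := hc.exists_apply_ne hdeg hno hk hd hx hxa hxb hab
    have hfa := (hf.rotate_link hdeg hno heq R hcR hxe hxa fun v hv ↦ by
      rw [Walk.support_cons, List.mem_cons] at hv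
      rcases hv with rfl | hv
      · exact ⟨hxe.ne', fun _ ↦ .inl rfl⟩
      · have := hR v hv; tauto).2.2
    have hfb := (hf.rotate_link hdeg hno heq Q hQ₀ hxe hxb hQ₀x).2.2
    exact hfab (hfa.symm.trans hfb)
  obtain ⟨f, hf, hfae⟩ := hc.exists_apply_ne hdeg hno hk hd hx hxa hxe hae
  cases Q with
  | nil => exact hqb rfl
  | @cons _ n _ hqn Q =>
  have hsupp : (Walk.cons hqn Q).support = q :: n :: Q.support.tail := by
    rw [Walk.support_cons, Q.cons_tail_support]
  have hfn : f n = f e := by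
    obtain ⟨hf', hf'u, -⟩ := hf.rotate_link hdeg hno heq _ hQ₀ hxe hxb hQ₀x
    have hq := (hf'.rotate_link hdeg hno heq _ hQ₀ hxe hxb hQ₀x).2.2
    rw [hf'u b hxb, Equiv.swap_apply_right, Function.comp] at hq
    rw [← hq]
    congr 1
    have hnd := hQ₀.support_nodup
    have hrot : (Walk.cons heq (Walk.cons hqn Q)).support ~r (Walk.cons hqn Q).support ++ [e] := by
      rw [Walk.support_cons]
      exact List.isRotated_append (l := [e])
    rw [List.formPerm_eq_of_isRotated hnd hrot]
    rw [hrot.nodup_iff, hsupp] at hnd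
    rw [hsupp]
    exact (List.formPerm_apply_head _ _ _ hnd).symm
  have hnd : (P.support ++ (Walk.cons hqn Q).support).Nodup :=
    List.Nodup.append hP.support_nodup hQ.1.support_nodup hdisj
  let W := P.append (Walk.cons heq (Walk.cons hqn Q))
  have hW : P.support ++ (Walk.cons hqn Q).support = W.support := by
    rw [Walk.support_append, Walk.support_cons heq, List.tail_cons]
  have hf' : IsHoleColoring H d (f ∘ (P.support ++ (Walk.cons hqn Q).support).formPerm) x := by
    have hxW : x ∉ W.support := by
      rw [← hW, List.mem_append, not_or]
      exact ⟨fun h ↦ (hPx x h).1 rfl, fun h ↦ (hQx x h).1 rfl⟩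
    rw [hW]
    exact hf.rotate hdeg hno W.support_ne_nil W.isChain_adj_support hxW (by simpa using hxa)
      (by simpa using hxb)
  have hq := (hf'.rotate_link hdeg hno heq _ hQ₀ hxe hxb hQ₀x).2.2
  have hb : (P.support ++ (Walk.cons hqn Q).support).formPerm b = a := by
    rw [hW, W.formPerm_support_apply]
  have hq' : (P.support ++ (Walk.cons hqn Q).support).formPerm q = n := by
    have hrot := List.isRotated_append (l := P.support) (l' := (Walk.cons hqn Q).support)
    rw [List.formPerm_eq_of_isRotated hnd hrot]
    rw [hrot.nodup_iff, hsupp] at hnd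
    rw [hsupp]
    exact List.formPerm_apply_head _ _ _ hnd
  rw [Function.comp, Function.comp, hb, hq', hfn] at hq
  exact hfae hq.symm

theorem IsHoleColoring.adj_trans (hdeg : ∀ v, H.degree v ≤ k * d)
    (hno : ∀ c : V → Fin k, ¬ IsDegenerateColoring H d c Finset.univ) (hk : 2 ≤ k) (hd : 1 ≤ d)
    {x a e b : V} (hx : (H.induce {x}ᶜ).Preconnected) {c : V → Fin k} (hc : IsHoleColoring H d c x)
    (hxa : H.Adj x a) (hxe : H.Adj x e) (hxb : H.Adj x b) (hab : a ≠ b)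
    (hae : H.Adj a e) (heb : H.Adj e b) : H.Adj a b := by
  by_contra hadj
  obtain ⟨f, hf, hfeb⟩ := hc.exists_apply_ne hdeg hno hk hd hx hxe hxb heb.ne
  have hf' := hf.rotate hdeg hno (l := [e, b]) (by simp) (by simpa using heb)
    (by simp [hxe.ne, hxb.ne]) (by simpa using hxe) (by simpa using hxb)
  rw [List.formPerm_pair] at hf'
  have h₁ := (hf.move hdeg hno hxa).card_filter_eq hdeg hno (f e)
  have h₂ := (hf'.move hdeg hno hxa).card_filter_eq hdeg hno (f e)
  refine (Finset.card_lt_card (Finset.ssubset_iff_of_subset ?_ |>.2 ⟨e, ?_, ?_⟩)).ne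
    (h₂.trans h₁.symm)
  · intro u
    simp only [Finset.mem_filter, mem_neighborFinset, Function.comp]
    rintro ⟨hau, hu⟩
    have hub : u ≠ b := by rintro rfl; exact hadj hau
    refine ⟨hau, ?_⟩
    grind [hau.ne, hxa.ne, hxe.ne, hxb.ne, hae.ne]
  · simp [hae, Equiv.swap_apply_of_ne_of_ne hxe.ne' hae.ne']
  · simp [hae, Equiv.swap_apply_of_ne_of_ne hxe.ne' hae.ne', hfeb.symm]

theorem IsHoleColoring.isClique_neighborSet (hdeg : ∀ v, H.degree v ≤ k * d)
    (hno : ∀ c : V → Fin k, ¬ IsDegenerateColoring H d c Finset.univ) (hk : 2 ≤ k) (hd : 1 ≤ d)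
    {x : V} (hx : (H.induce {x}ᶜ).Preconnected) {c : V → Fin k} (hc : IsHoleColoring H d c x)
    (hx3 : 3 ≤ H.degree x) : H.IsClique (H.neighborSet x) := by
  have hlink : ∀ e b, H.Adj x e → H.Adj x b → e ≠ b → IsLinked H x e b → H.Adj e b := by
    intro e b hxe hxb heb hl
    by_contra hadj
    have hU : ∀ a, H.Adj x a → a ∈ ({e, b} : Set V) := by
      intro a hxa
      refine mem_of_forall_isLinked hx (a := e) (by simp) hxe (fun u hu v hxv huv ↦ ?_) hxa
      by_contra hv
      simp only [Set.mem_insert_iff, Set.mem_singleton_iff, not_or] at hu hv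
      rcases hu with rfl | rfl
      · exact hadj (hc.adj_of_isLinked_of_isLinked hdeg hno hk hd hx hxv hxe hxb hv.1 hv.2 heb
          huv.symm hl)
      · exact hadj (hc.adj_of_isLinked_of_isLinked hdeg hno hk hd hx hxv hxb hxe hv.2 hv.1 heb.symm
          huv.symm hl.symm).symm
    have := Finset.card_le_card (s := H.neighborFinset x) (t := {e, b})
      fun a ha ↦ by simpa using hU a (by simpa using ha)
    rw [card_neighborFinset_eq_degree] at this
    have := Finset.card_le_two (a := e) (b := b)
    omega
  intro e hxe b hxb heb
  refine (mem_of_forall_isLinked hx (a := e) (U := {v | H.Adj x v ∧ (e ≠ v → H.Adj e v)})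
    ⟨hxe, by simp⟩ hxe (fun u hu v hxv huv ↦ ⟨hxv, fun hev ↦ ?_⟩) hxb).2 heb
  by_cases huv' : u = v
  · exact huv' ▸ hu.2 (huv' ▸ hev)
  by_cases heu : e = u
  · subst heu
    exact hlink _ _ hxe hxv hev huv
  · exact hc.adj_trans hdeg hno hk hd hx hxe hu.1 hxv hev (hu.2 heu)
      (hlink _ _ hu.1 hxv huv' huv)

end DegenerateColoring

section GraphFree

variable {α V : Type*} [Fintype α] [Fintype V] {G : SimpleGraph α} [DecidableRel G.Adj]
  {H : SimpleGraph V} [DecidableRel H.Adj]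

theorem SimpleGraph.Preconnected.nonempty_iso_of_injective [Nonempty α] (hH : H.Preconnected)
    (f : G →g H) (hf : Function.Injective f) (hdeg : ∀ a, H.degree (f a) ≤ G.degree a) :
    Nonempty (G ≃g H) := by
  classical
  have hadj : ∀ a w, H.Adj (f a) w → ∃ a', G.Adj a a' ∧ f a' = w := by
    intro a w hw
    have hsub : (G.neighborFinset a).image f ⊆ H.neighborFinset (f a) := by
      intro v hv
      simp only [Finset.mem_image, mem_neighborFinset] at hv ⊢
      obtain ⟨b, hb, rfl⟩ := hv
      exact f.map_adj hb
    have heq := Finset.eq_of_subset_of_card_le hsub (by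
      rw [Finset.card_image_of_injective _ hf]
      exact hdeg a)
    have hw' : w ∈ (G.neighborFinset a).image f := by
      rw [heq]; simpa using hw
    simpa using hw'
  have hsurj : Function.Surjective f := by
    intro w
    by_contra hw
    obtain ⟨a⟩ := ‹Nonempty α›
    obtain ⟨p⟩ := hH (f a) w
    obtain ⟨⟨⟨u, v⟩, huv⟩, -, ⟨b, rfl⟩, hv⟩ := p.exists_boundary_dart (Set.range f) ⟨a, rfl⟩ hw
    obtain ⟨b', -, hb'⟩ := hadj b v huv
    exact hv ⟨b', hb'⟩
  refine ⟨⟨Equiv.ofBijective f ⟨hf, hsurj⟩, fun {a b} ↦ ⟨fun h ↦ ?_, fun h ↦ f.map_adj h⟩⟩⟩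
  obtain ⟨b', hb', hbb'⟩ := hadj a (f b) h
  exact hf hbb' ▸ hb'

theorem HasCopy.exists_finset [DecidableEq V] [Nonempty α] {ι : Type*} {c : V → ι} {i : ι} {d : ℕ}
    (hG : ∀ a, d ≤ G.degree a) (h : HasCopy G (H.induce {v | c v = i})) :
    ∃ T : Finset V, T.Nonempty ∧ T.card = Fintype.card α ∧ (∀ v ∈ T, c v = i) ∧
      ∀ v ∈ T, d ≤ (H.neighborFinset v ∩ T).card := by
  obtain ⟨f, hf⟩ := h
  have hinj : Function.Injective fun a ↦ (f a : V) := Subtype.val_injective.comp hf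
  refine ⟨Finset.univ.image fun a ↦ (f a : V), by simp,
    Finset.card_image_of_injective _ hinj, ?_, ?_⟩
  · intro v hv
    obtain ⟨a, -, rfl⟩ := Finset.mem_image.1 hv
    exact (f a).2
  · intro v hv
    obtain ⟨a, -, rfl⟩ := Finset.mem_image.1 hv
    refine (hG a).trans ?_
    rw [← card_neighborFinset_eq_degree, ← Finset.card_image_of_injective _ hinj]
    refine Finset.card_le_card fun w hw ↦ ?_
    obtain ⟨b, hb, rfl⟩ := Finset.mem_image.1 hw
    have hab : H.Adj (f a) (f b) := f.map_adj ((mem_neighborFinset _ _ _).1 hb)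
    simpa using hab

theorem IsDegenerateColoring.not_hasCopy [DecidableEq V] [Nonempty α] {ι : Type*} {c : V → ι}
    {d : ℕ} (hG : ∀ a, d ≤ G.degree a) (hc : IsDegenerateColoring H d c Finset.univ) (i : ι) :
    ¬ HasCopy G (H.induce {v | c v = i}) := by
  intro h
  obtain ⟨T, hT, -, hTi, hTd⟩ := h.exists_finset hG
  obtain ⟨v, hv, hlt⟩ := hc i T (Finset.subset_univ T) hT hTi
  exact (hTd v hv).not_gt hlt

theorem SimpleGraph.Coloring.isDegenerateColoring [DecidableEq V] {ι : Type*} (c : H.Coloring ι) :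
    IsDegenerateColoring H 1 c Finset.univ := by
  intro i T _ hT hTi
  obtain ⟨v, hv⟩ := hT
  refine ⟨v, hv, ?_⟩
  rw [Nat.lt_one_iff, Finset.card_eq_zero, Finset.eq_empty_iff_forall_notMem]
  intro w hw
  simp only [Finset.mem_inter, mem_neighborFinset] at hw
  exact c.valid hw.1 ((hTi v hv).trans (hTi w hw.2).symm)

theorem SimpleGraph.nonempty_iso_top_of_card_le [Nonempty α] {d : ℕ} (hG : ∀ a, d ≤ G.degree a)
    (hcard : Fintype.card α ≤ d + 1) : Nonempty (G ≃g (⊤ : SimpleGraph (Fin (d + 1)))) := by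
  classical
  obtain ⟨f⟩ : Nonempty (α ↪ Fin (d + 1)) := Function.Embedding.nonempty_of_card_le (by simpa)
  exact Preconnected.nonempty_iso_of_injective preconnected_top
    ⟨f, fun h ↦ f.injective.ne h.ne⟩ f.injective fun a ↦ by simpa using hG a

theorem SimpleGraph.Connected.nonempty_iso_top_of_isClique_neighborSet (hH : H.Connected) {n : ℕ}
    (hdeg : ∀ v, H.degree v = n) {x : V} (hx : H.IsClique (H.neighborSet x)) :
    Nonempty (H ≃g (⊤ : SimpleGraph (Fin (n + 1)))) := by
  classical
  have hcard : (insert x (H.neighborFinset x)).card = n + 1 := by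
    rw [Finset.card_insert_of_notMem (by simp), card_neighborFinset_eq_degree, hdeg]
  let e := (Finset.equivFinOfCardEq hcard).symm
  have hclique : H.IsClique (insert x (H.neighborFinset x) : Finset V) := by
    rw [Finset.coe_insert, coe_neighborFinset]
    exact hx.insert fun b hb _ ↦ hb
  have hinj : Function.Injective fun i ↦ (e i : V) := Subtype.val_injective.comp e.injective
  refine (hH.preconnected.nonempty_iso_of_injective (G := (⊤ : SimpleGraph (Fin (n + 1))))
    ⟨fun i ↦ (e i : V), fun {i j} h ↦ hclique (e i).2 (e j).2 (hinj.ne h.ne)⟩ hinj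
    fun a ↦ ?_).map RelIso.symm
  simp [hdeg]

theorem SimpleGraph.Connected.isOddCycle_of_not_colorable (hH : H.Connected)
    (hdeg : ∀ v, H.degree v ≤ 2) (hcol : ¬ H.Colorable 2) : IsOddCycle H := by
  have hcyc : ¬ H.IsAcyclic := fun h ↦ hcol h.isBipartite
  rw [isAcyclic_iff_free_cycleGraph] at hcyc
  simp only [Free, not_forall, not_not] at hcyc
  obtain ⟨n, hn, ⟨f⟩⟩ := hcyc
  obtain ⟨m, rfl⟩ := Nat.exists_eq_add_of_le' hn
  obtain ⟨e⟩ := hH.preconnected.nonempty_iso_of_injective f.toHom f.injective fun a ↦ by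
    rw [cycleGraph_degree_three_le]
    exact hdeg _
  refine ⟨m + 3, ?_, hn, ⟨e.symm⟩⟩
  by_contra hodd
  rw [Nat.not_odd_iff_even] at hodd
  exact hcol (by simpa using
    (cycleGraph.bicoloring_of_even _ hodd).colorable.of_hom e.symm.toHom)

theorem card_le_of_isHoleColoring [DecidableEq V] [Nonempty α] {k d : ℕ}
    (hG : ∀ a, d ≤ G.degree a) (hdeg : ∀ v, H.degree v ≤ k * d)
    (hno : ∀ c : V → Fin k, ¬ IsDegenerateColoring H d c Finset.univ) {c : V → Fin k} {x : V}
    (hc : IsHoleColoring H d c x) {i : Fin k} (hcopy : HasCopy G (H.induce {v | c v = i}))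
    (hH : (∀ v, v ≠ x → H.Adj x v) ∨ d = 1) : Fintype.card α ≤ d + 1 := by
  obtain ⟨T, hT, hTcard, hTi, hTd⟩ := hcopy.exists_finset hG
  have hTx : T ⊆ insert x {u ∈ H.neighborFinset x | c u = i} := by
    intro v hv
    simp only [Finset.mem_insert, Finset.mem_filter, mem_neighborFinset]
    refine or_iff_not_imp_left.2 fun hvx ↦ ⟨?_, hTi v hv⟩
    obtain hH | rfl := hH
    · exact hH v hvx
    obtain ⟨w, hw⟩ := Finset.card_pos.1 (hTd v hv)
    simp only [Finset.mem_inter, mem_neighborFinset] at hw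
    by_contra hxv
    have hwx : w ≠ x := by
      rintro rfl
      exact hxv hw.1.symm
    obtain ⟨t, ht, hlt⟩ := hc i {v, w} (by intro t; simp; grind) (by simp)
      (by simp [hTi v hv, hTi w hw.2])
    rw [Nat.lt_one_iff, Finset.card_eq_zero, Finset.eq_empty_iff_forall_notMem] at hlt
    simp only [Finset.mem_insert, Finset.mem_singleton] at ht
    rcases ht with rfl | rfl
    · exact hlt w (by simp [hw.1])
    · exact hlt v (by simp [hw.1.symm])
  rw [← hTcard, ← hc.card_filter_eq hdeg hno i]
  exact (Finset.card_le_card hTx).trans (Finset.card_insert_le _ _)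

theorem exists_coloring_forall_not_hasCopy [Nonempty α] {k d : ℕ} (hk : 1 ≤ k) (hd : 1 ≤ d)
    (hG : ∀ a, d ≤ G.degree a) (hH : H.Connected) (hdeg : ∀ v, H.degree v ≤ k * d)
    (h1 : (∃ r, G.IsRegularOfDegree r) → ¬ Nonempty (H ≃g G))
    (h2 : Nonempty (G ≃g (⊤ : SimpleGraph (Fin (d + 1)))) →
      ¬ Nonempty (H ≃g (⊤ : SimpleGraph (Fin (k * d + 1)))))
    (h3 : Nonempty (G ≃g (⊤ : SimpleGraph (Fin 2))) → ¬ IsOddCycle H) :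
    ∃ c : V → Fin k, ∀ i, ¬ HasCopy G (H.induce {v | c v = i}) := by
  classical
  by_contra! hcopy
  have hno : ∀ c : V → Fin k, ¬ IsDegenerateColoring H d c Finset.univ := fun c hc ↦
    have ⟨i, hi⟩ := hcopy c
    hc.not_hasCopy hG i hi
  have hreg := degree_eq_of_forall_not_isDegenerateColoring hH hdeg hk hno
  obtain rfl | hk2 := hk.eq_or_lt
  · obtain ⟨i, f, hf⟩ := hcopy fun _ ↦ 0
    obtain ⟨e⟩ := hH.preconnected.nonempty_iso_of_injective
      ((Embedding.induce _).toHom.comp f) (Subtype.val_injective.comp hf)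
      fun a ↦ (hdeg _).trans (by simpa using hG a)
    exact h1 ⟨d, fun a ↦ by rw [← e.degree_eq a, hreg, one_mul]⟩ ⟨e.symm⟩
  have : Nontrivial V := by
    obtain ⟨x⟩ := hH.nonempty
    obtain ⟨y, hy⟩ := (H.degree_pos_iff_exists_adj x).1 (by rw [hreg]; positivity)
    exact ⟨x, y, hy.ne⟩
  obtain ⟨x, hx⟩ := hH.exists_connected_induce_compl_singleton_of_finite_nontrivial
  obtain ⟨c, hc⟩ := exists_isDegenerateColoring_of_notMem hH hdeg hk x
    (Finset.univ.erase x) (by simp)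
  obtain ⟨i, hi⟩ := hcopy c
  by_cases hkd : 3 ≤ k * d
  · obtain ⟨e⟩ := hH.nonempty_iso_top_of_isClique_neighborSet hreg
      (IsHoleColoring.isClique_neighborSet hdeg hno hk2 hd hx.preconnected hc (by rwa [hreg]))
    refine h2 (nonempty_iso_top_of_card_le hG (card_le_of_isHoleColoring hG hdeg hno hc hi
      (.inl fun v hv ↦ ?_))) ⟨e⟩
    rw [← e.map_adj_iff]
    simpa using hv.symm
  · obtain ⟨rfl, rfl⟩ : k = 2 ∧ d = 1 := by constructor <;> nlinarith
    refine h3 (nonempty_iso_top_of_card_le hG (card_le_of_isHoleColoring hG hdeg hno hc hi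
      (.inr rfl))) (hH.isOddCycle_of_not_colorable hdeg fun ⟨c⟩ ↦ hno c c.isDegenerateColoring)

end GraphFree

/-- The bound `χ_G(H) ≤ ⌈Δ(H)/δ(G)⌉` from Corollary 2. -/
theorem gFreeChromaticNumber_le_ceilDiv
    {α : Type*} [Fintype α] (G : SimpleGraph α) [DecidableRel G.Adj]
    {V : Type*} [Fintype V] (H : SimpleGraph V) [DecidableRel H.Adj]
    (hGconn : G.Connected) (hδ : 1 ≤ G.minDegree)
    (hHconn : H.Connected) (hΔ : 1 ≤ H.maxDegree)
    (h1 : (∃ r, G.IsRegularOfDegree r) → ¬ Nonempty (H ≃g G))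
    (h2 : Nonempty (G ≃g (⊤ : SimpleGraph (Fin (G.minDegree + 1)))) →
      ¬ Nonempty (H ≃g (⊤ : SimpleGraph
        (Fin ((H.maxDegree ⌈/⌉ G.minDegree) * G.minDegree + 1)))))
    (h3 : Nonempty (G ≃g (⊤ : SimpleGraph (Fin 2))) →
      ¬ IsOddCycle H ∧ ¬ ∃ n : ℕ, Nonempty (H ≃g (⊤ : SimpleGraph (Fin n)))) :
    gFreeChromaticNumber G H ≤ H.maxDegree ⌈/⌉ G.minDegree := by
  have hδ' : 0 < G.minDegree := hδ
  have := hGconn.nonempty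
  have hle : H.maxDegree ≤ H.maxDegree ⌈/⌉ G.minDegree * G.minDegree := by
    rw [mul_comm]
    exact (ceilDiv_le_iff_le_mul hδ').1 le_rfl
  have hk : 1 ≤ H.maxDegree ⌈/⌉ G.minDegree := Nat.pos_of_mul_pos_right (hΔ.trans hle)
  exact Nat.sInf_le (exists_coloring_forall_not_hasCopy hk hδ G.minDegree_le_degree hHconn
    (fun v ↦ (H.degree_le_maxDegree v).trans hle) h1 h2 fun h ↦ (h3 h).1)
end
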